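/- arXiv:1701.08184 — 2 statements merged into one kernel-verified Lean document; each statement's English description precedes it below -/
import Mathlib

section
/- Let a : 𝕋¹ × ℤ → ℂ be a symbol on the one-dimensional torus, smooth in x, such that for all α, β ∈ ℕ with α, β ≤ 1 there are constants C_{α,β} > 0 with |∂_x^β Δ_ξ^α a(x,ξ)| ≤ C_{α,β} ⟨ξ⟩^{−α} for all (x,ξ) ∈ 𝕋¹ × ℤ. Then the periodic pseudo-differential operator a(x,D) : L^p(𝕋¹) → L^p(𝕋¹) is bounded for every 1 < p < ∞. -/
open MeasureTheory Real ENNReal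

noncomputable section

/-- Partial derivative of a complex-valued function on `ℝⁿ` in the `j`-th coordinate
direction. -/
def pd {n : ℕ} (j : Fin n) (f : (Fin n → ℝ) → ℂ) : (Fin n → ℝ) → ℂ :=
  fun x => fderiv ℝ f x (Pi.single j 1)

/-- The canonical list of directions associated to a multi-index `β ∈ ℕⁿ`. -/
def mIdxList {n : ℕ} (β : Fin n → ℕ) : List (Fin n) :=
  (List.finRange n).flatMap fun j => List.replicate (β j) j

/-- Iterated partial derivative `∂^β` associated to a multi-index `β`. -/
def pdM {n : ℕ} (β : Fin n → ℕ) (f : (Fin n → ℝ) → ℂ) : (Fin n → ℝ) → ℂ :=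
  (mIdxList β).foldr pd f

/-- Forward difference operator in the `j`-th direction on functions of `ξ ∈ ℤⁿ`. -/
def dd {n : ℕ} (j : Fin n) (g : (Fin n → ℤ) → ℂ) : (Fin n → ℤ) → ℂ :=
  fun ξ => g (ξ + Pi.single j 1) - g ξ

/-- Iterated difference operator `Δ_ξ^α` associated to a multi-index `α`. -/
def ddM {n : ℕ} (α : Fin n → ℕ) (g : (Fin n → ℤ) → ℂ) : (Fin n → ℤ) → ℂ :=
  (mIdxList α).foldr dd g

/-- Japanese bracket `⟨ξ⟩ = (1+|ξ|²)^{1/2}` of a lattice point `ξ ∈ ℤⁿ`. -/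
def jb {n : ℕ} (ξ : Fin n → ℤ) : ℝ := Real.sqrt (1 + ∑ j, ((ξ j : ℝ)) ^ 2)

/-- Japanese bracket `⟨ξ⟩ = (1+|ξ|²)^{1/2}` of a vector `ξ ∈ ℝⁿ`. -/
def jbR {n : ℕ} (ξ : Fin n → ℝ) : ℝ := Real.sqrt (1 + ∑ j, (ξ j) ^ 2)

/-- The canonical embedding `ℤⁿ → ℝⁿ`. -/
def castZ {n : ℕ} (ξ : Fin n → ℤ) : Fin n → ℝ := fun j => (ξ j : ℝ)

/-- The fundamental domain `[0,1)ⁿ` of the torus `𝕋ⁿ = ℝⁿ/ℤⁿ`. -/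
def cube (n : ℕ) : Set (Fin n → ℝ) := Set.univ.pi fun _ => Set.Ico (0 : ℝ) 1

/-- The normalized Lebesgue measure of the torus `𝕋ⁿ`, realized as the Lebesgue measure
on `ℝⁿ` restricted to the fundamental domain `[0,1)ⁿ`. -/
def μT (n : ℕ) : Measure (Fin n → ℝ) := volume.restrict (cube n)

/-- `1`-periodicity of a function on `ℝⁿ` (i.e. the function descends to `𝕋ⁿ`). -/
def Per {n : ℕ} (f : (Fin n → ℝ) → ℂ) : Prop :=
  ∀ (x : Fin n → ℝ) (v : Fin n → ℤ), f (x + fun j => (v j : ℝ)) = f x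

/-- The character `e^{2πi⟨x,ξ⟩}`. -/
def eChar {n : ℕ} (x : Fin n → ℝ) (ξ : Fin n → ℤ) : ℂ :=
  Complex.exp (2 * (π : ℂ) * Complex.I * ∑ j, (x j : ℂ) * (ξ j : ℂ))

/-- Fourier coefficient `f̂(ξ) = ∫_{𝕋ⁿ} e^{-2πi⟨x,ξ⟩} f(x) dx` of a function on `𝕋ⁿ`. -/
def fc {n : ℕ} (f : (Fin n → ℝ) → ℂ) (ξ : Fin n → ℤ) : ℂ :=
  ∫ x, Complex.exp (-(2 * (π : ℂ) * Complex.I) * ∑ j, (x j : ℂ) * (ξ j : ℂ)) * f x ∂(μT n)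

/-- Periodic pseudo-differential operator
    `σ(x,D)f(x) = Σ_{ξ ∈ ℤⁿ} e^{2πi⟨x,ξ⟩} σ(x,ξ) f̂(ξ)`
with symbol `σ` on `𝕋ⁿ × ℤⁿ`. -/
def Op {n : ℕ} (σ : (Fin n → ℝ) → (Fin n → ℤ) → ℂ) (f : (Fin n → ℝ) → ℂ) :
    (Fin n → ℝ) → ℂ :=
  fun x => ∑' ξ : Fin n → ℤ, eChar x ξ * σ x ξ * fc f ξ

/-- The `L^p(𝕋ⁿ)` norm, for a real exponent `p`. -/
def lpT (n : ℕ) (p : ℝ) (g : (Fin n → ℝ) → ℂ) : ℝ :=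
  (∫ x, ‖g x‖ ^ p ∂(μT n)) ^ (1 / p)

/-- `∂_x^β Δ_ξ^α σ(x,ξ)` for a symbol `σ` on `𝕋ⁿ × ℤⁿ` (difference operator applied first,
then the derivatives in `x`). -/
def symbDxD {n : ℕ} (β α : Fin n → ℕ) (σ : (Fin n → ℝ) → (Fin n → ℤ) → ℂ)
    (x : Fin n → ℝ) (ξ : Fin n → ℤ) : ℂ :=
  pdM β (fun x' => ddM α (σ x') ξ) x

/-- `Δ_ξ^α ∂_x^β σ(x,ξ)` for a symbol `σ` on `𝕋ⁿ × ℤⁿ` (derivatives in `x` applied first,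
then the difference operator in `ξ`). -/
def symbDDx {n : ℕ} (α β : Fin n → ℕ) (σ : (Fin n → ℝ) → (Fin n → ℤ) → ℂ)
    (x : Fin n → ℝ) (ξ : Fin n → ℤ) : ℂ :=
  ddM α (fun ξ' => pdM β (fun x' => σ x' ξ') x) ξ

/-- `∂_ξ^α ∂_x^β σ(x,ξ)` for a symbol `σ` on `𝕋ⁿ × ℝⁿ` (derivatives in `x` applied first,
then the derivatives in `ξ`). -/
def symbDξDx {n : ℕ} (α β : Fin n → ℕ) (σ : (Fin n → ℝ) → (Fin n → ℝ) → ℂ)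
    (x ξ : Fin n → ℝ) : ℂ :=
  pdM α (fun ξ' => pdM β (fun x' => σ x' ξ') x) ξ

/-- `∂_x^β ∂_ξ^α σ(x,ξ)` for a symbol `σ` on `𝕋ⁿ × ℝⁿ` (derivatives in `ξ` applied first,
then the derivatives in `x`). -/
def symbDxDξ {n : ℕ} (β α : Fin n → ℕ) (σ : (Fin n → ℝ) → (Fin n → ℝ) → ℂ)
    (x ξ : Fin n → ℝ) : ℂ :=
  pdM β (fun x' => pdM α (σ x') ξ) x

/-- The Euclidean Fourier transform `û(ξ) = ∫_{ℝⁿ} e^{-2πi⟨x,ξ⟩} u(x) dx`. -/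
def FT {n : ℕ} (u : (Fin n → ℝ) → ℂ) (ξ : Fin n → ℝ) : ℂ :=
  ∫ x, Complex.exp (-(2 * (π : ℂ) * Complex.I) * ∑ j, (x j : ℂ) * (ξ j : ℂ)) * u x

/-- Pseudo-differential operator on `ℝⁿ`:
`T_σ u(x) = ∫_{ℝⁿ} e^{2πi⟨x,ξ⟩} σ(x,ξ) û(ξ) dξ`. -/
def OpR {n : ℕ} (σ : (Fin n → ℝ) → (Fin n → ℝ) → ℂ) (u : (Fin n → ℝ) → ℂ) :
    (Fin n → ℝ) → ℂ :=
  fun x => ∫ ξ, Complex.exp (2 * (π : ℂ) * Complex.I * ∑ j, (x j : ℂ) * (ξ j : ℂ)) * σ x ξ * FT u ξ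

/-- Periodic amplitude operator
`a(x,y,D)u(x) = ∫_{𝕋ⁿ} ∫_{ℝⁿ} e^{2πi⟨x-y,ξ⟩} a(x,y,ξ) u(y) dξ dy`. -/
def OpAmp {n : ℕ} (a : (Fin n → ℝ) → (Fin n → ℝ) → (Fin n → ℝ) → ℂ)
    (u : (Fin n → ℝ) → ℂ) : (Fin n → ℝ) → ℂ :=
  fun x => ∫ y,
    (∫ ξ, Complex.exp (2 * (π : ℂ) * Complex.I * ∑ j, ((x j : ℂ) - (y j : ℂ)) * (ξ j : ℂ)) *
        a x y ξ) * u y ∂(μT n)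

/-- The `L^p(ℝⁿ)` norm, for a real exponent `p`. -/
def lpR (n : ℕ) (p : ℝ) (g : (Fin n → ℝ) → ℂ) : ℝ :=
  (∫ x, ‖g x‖ ^ p) ^ (1 / p)

theorem exists_dyadic_stopping {X : Type*} [Fintype X] [DecidableEq X] (n : ℕ) (b : ℕ → X → ℕ)
    (hstep : ∀ k x y, b k x = b k y → b (k + 1) x = b (k + 1) y)
    (htop : ∀ x y, b n x = b n y)
    (hdbl : ∀ k < n, ∀ x, (Finset.univ.filter fun y => b (k + 1) y = b (k + 1) x).card
      ≤ 2 * (Finset.univ.filter fun y => b k y = b k x).card)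
    (F : X → ℝ) (hF : ∀ x, 0 ≤ F x) (t : ℝ) (ht : 0 < t)
    (hmean : ∑ x, F x ≤ t * Fintype.card X) :
    ∃ k : X → ℕ, (∀ x, k x ≤ n) ∧
      (∀ x y, b (k x) y = b (k x) x → k y = k x) ∧
      (∀ x, ∑ y with b (k x) y = b (k x) x, F y
        ≤ 2 * t * (Finset.univ.filter fun y => b (k x) y = b (k x) x).card) ∧
      (∀ x, k x = 0 ∨ t * (Finset.univ.filter fun y => b (k x) y = b (k x) x).card
        < ∑ y with b (k x) y = b (k x) x, F y) := by
  classical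
  have hmono : ∀ x y i j, i ≤ j → b i x = b i y → b j x = b j y := by
    intro x y i j hij h
    induction j, hij using Nat.le_induction with
    | base => exact h
    | succ j _ ih => exact hstep _ _ _ ih
  let P : X → ℕ → Prop := fun x k =>
    t * (Finset.univ.filter fun y => b k y = b k x).card < ∑ y with b k y = b k x, F y
  have hP : ∀ x y k, b k y = b k x → (P y k ↔ P x k) := by
    intro x y k h
    simp only [P, h]
  refine ⟨fun x => Nat.findGreatest (P x) n, fun x => Nat.findGreatest_le _, ?_, ?_, ?_⟩
  · intro x y h
    set k := Nat.findGreatest (P x) n with hk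
    rw [Nat.findGreatest_eq_iff]
    obtain ⟨h1, h2, h3⟩ := Nat.findGreatest_eq_iff.1 hk.symm
    refine ⟨h1, fun h0 => (hP x y k h).2 (h2 h0), fun j hj hjn hc => h3 hj hjn ?_⟩
    exact (hP x y j (hmono _ _ _ _ hj.le h)).1 hc
  · intro x
    obtain ⟨h1, h2, h3⟩ := Nat.findGreatest_eq_iff.1 (rfl : Nat.findGreatest (P x) n = _)
    set k := Nat.findGreatest (P x) n with hk
    rcases h1.lt_or_eq with hlt | heq
    · have h4 := h3 (Nat.lt_succ_self k) hlt
      simp only [P, not_lt] at h4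
      have h5 : (((Finset.univ.filter fun y => b (k + 1) y = b (k + 1) x).card : ℕ) : ℝ)
          ≤ 2 * (Finset.univ.filter fun y => b k y = b k x).card := by
        exact_mod_cast hdbl k hlt x
      calc ∑ y with b k y = b k x, F y ≤ ∑ y with b (k + 1) y = b (k + 1) x, F y := by
            apply Finset.sum_le_sum_of_subset_of_nonneg
            · intro y; simpa using hstep k y x
            · intros; exact hF _
        _ ≤ _ := h4
        _ ≤ t * (2 * (Finset.univ.filter fun y => b k y = b k x).card) := by gcongr
        _ = _ := by ring
    · have h6 : (Finset.univ.filter fun y => b k y = b k x) = Finset.univ := by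
        rw [heq]; ext y; simpa using htop y x
      rw [h6, Finset.card_univ]
      have : (0:ℝ) ≤ t * Fintype.card X := by positivity
      linarith
  · intro x
    obtain ⟨h1, h2, h3⟩ := Nat.findGreatest_eq_iff.1 (rfl : Nat.findGreatest (P x) n = _)
    by_cases h : Nat.findGreatest (P x) n = 0
    · exact Or.inl h
    · exact Or.inr (h2 h)

theorem sum_sum_symm_average {X R : Type*} [Fintype X] [DecidableEq X] [Field R]
    (Q : X → Finset X) (hQ : ∀ x y, y ∈ Q x → x ∈ Q y ∧ Q y = Q x) (f : X → X → R) :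
    ∑ x, ∑ y ∈ Q x, f x y / (Q x).card = ∑ x, ∑ y ∈ Q x, f y x / (Q x).card := by
  rw [Finset.sum_comm' (t' := Finset.univ) (s' := Q)]
  · refine Finset.sum_congr rfl fun x _ => Finset.sum_congr rfl fun y hy => ?_
    rw [(hQ x y hy).2]
  · intro x y
    simp only [Finset.mem_univ, true_and, and_true]
    exact ⟨fun h => (hQ x y h).1, fun h => (hQ y x h).1⟩

set_option maxHeartbeats 1000000 in
theorem weak_type_of_dyadic {X : Type*} [Fintype X] [DecidableEq X] (n : ℕ) (b : ℕ → X → ℕ)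
    (hinj : Function.Injective (b 0))
    (hstep : ∀ k x y, b k x = b k y → b (k + 1) x = b (k + 1) y)
    (htop : ∀ x y, b n x = b n y)
    (hdbl : ∀ k < n, ∀ x, (Finset.univ.filter fun y => b (k + 1) y = b (k + 1) x).card
      ≤ 2 * (Finset.univ.filter fun y => b k y = b k x).card)
    (κ : X → X → ℂ) (S : ℕ → ℕ → Finset X) (c A : ℝ) (hc : 0 ≤ c) (hA : 0 ≤ A)
    (hS : ∀ k ≤ n, ∀ x, ((S k (b k x)).card : ℝ)
      ≤ c * (Finset.univ.filter fun y => b k y = b k x).card)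
    (hL2 : ∀ f : X → ℂ, ∑ x, ‖∑ y, κ x y * f y‖ ^ 2 ≤ A * ∑ x, ‖f x‖ ^ 2)
    (hH : ∀ k ≤ n, ∀ y y', b k y' = b k y →
      ∑ x with x ∉ S k (b k y), ‖κ x y - κ x y'‖ ≤ A)
    (f : X → ℂ) (t : ℝ) (ht : 0 < t) :
    t * (Finset.univ.filter fun x => t < ‖∑ y, κ x y * f y‖).card
      ≤ (10 * A + c + 1) * ∑ x, ‖f x‖ := by
  classical
  set s := ∑ x, ‖f x‖ with hs
  have hs0 : 0 ≤ s := by positivity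
  rcases lt_or_ge (t * Fintype.card X) s with hbig | hmean
  · calc t * (Finset.univ.filter fun x => t < ‖∑ y, κ x y * f y‖).card
        ≤ t * Fintype.card X := by
          gcongr; exact Finset.card_le_univ _
      _ ≤ 1 * s := by linarith
      _ ≤ _ := by gcongr; linarith
  obtain ⟨k, hkn, hk, hup, hlow⟩ := exists_dyadic_stopping n b hstep htop hdbl
    (fun x => ‖f x‖) (fun x => norm_nonneg _) t ht hmean
  set Q : X → Finset X := fun x => Finset.univ.filter fun y => b (k x) y = b (k x) x with hQdef
  have hmem : ∀ x, x ∈ Q x := fun x => by simp [Q]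
  have hQ : ∀ x y, y ∈ Q x → x ∈ Q y ∧ Q y = Q x := by
    intro x y hy
    have h1 : b (k x) y = b (k x) x := by simpa [Q] using hy
    have h2 := hk x y h1
    constructor
    · simp [Q, h2, h1]
    · simp [Q, h2, h1]
  have hcard : ∀ x, (0:ℝ) < (Q x).card := fun x => by
    exact_mod_cast Finset.card_pos.2 ⟨x, hmem x⟩
  have hone : ∀ x (v : ℝ), ∑ y ∈ Q x, v / (Q x).card = v := by
    intro x v
    rw [Finset.sum_const, nsmul_eq_mul]
    have := (hcard x).ne'
    field_simp
  have honeC : ∀ x (v : ℂ), ∑ y ∈ Q x, v / (Q x).card = v := by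
    intro x v
    rw [Finset.sum_const, nsmul_eq_mul]
    have : ((Q x).card : ℂ) ≠ 0 := by exact_mod_cast (hcard x).ne'
    field_simp
  -- the good part
  set g : X → ℂ := fun x => ∑ y ∈ Q x, f y / (Q x).card with hg
  have hgle : ∀ x, ‖g x‖ ≤ ∑ y ∈ Q x, ‖f y‖ / (Q x).card := by
    intro x
    refine (norm_sum_le _ _).trans (le_of_eq ?_)
    simp
  have hg2 : ∀ x, ‖g x‖ ≤ 2 * t := by
    intro x
    refine (hgle x).trans ?_
    rw [← Finset.sum_div, div_le_iff₀ (hcard x)]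
    exact hup x
  have hg1 : ∑ x, ‖g x‖ ≤ s := by
    calc ∑ x, ‖g x‖ ≤ ∑ x, ∑ y ∈ Q x, ‖f y‖ / (Q x).card := Finset.sum_le_sum fun x _ => hgle x
      _ = ∑ x, ∑ y ∈ Q x, ‖f x‖ / (Q x).card :=
          sum_sum_symm_average Q hQ (fun _ y => ‖f y‖)
      _ = s := by simp only [hone, hs]
  have hTg : t ^ 2 * (Finset.univ.filter fun x => t / 2 < ‖∑ y, κ x y * g y‖).card
      ≤ 8 * A * t * s := by
    have h1 : (t / 2) ^ 2 * (Finset.univ.filter fun x => t / 2 < ‖∑ y, κ x y * g y‖).card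
        ≤ ∑ x, ‖∑ y, κ x y * g y‖ ^ 2 := by
      rw [mul_comm, ← nsmul_eq_mul]
      refine (Finset.card_nsmul_le_sum (Finset.univ.filter fun x => t / 2 < ‖∑ y, κ x y * g y‖)
        (fun x => ‖∑ y, κ x y * g y‖ ^ 2) _ fun x hx => ?_).trans
        (Finset.sum_le_sum_of_subset_of_nonneg (Finset.subset_univ _) fun _ _ _ => by positivity)
      have := (Finset.mem_filter.1 hx).2
      gcongr
    have h2 : ∑ x, ‖g x‖ ^ 2 ≤ 2 * t * s := by
      calc ∑ x, ‖g x‖ ^ 2 ≤ ∑ x, 2 * t * ‖g x‖ := by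
            refine Finset.sum_le_sum fun x _ => ?_
            rw [pow_two]; gcongr; exact hg2 x
        _ = 2 * t * ∑ x, ‖g x‖ := by rw [Finset.mul_sum]
        _ ≤ _ := by gcongr
    have h3 := hL2 g
    have h4 := mul_le_mul_of_nonneg_left h2 hA
    linarith
  -- the bad set
  set bad : Finset X := Finset.univ.filter fun x => k x ≠ 0 with hbad
  have hbadQ : ∀ x y, y ∈ Q x → (k y = k x) := by
    intro x y hy
    exact hk x y (by simpa [Q] using hy)
  have hbadcard : t * bad.card ≤ s := by
    calc t * bad.card = ∑ x with k x ≠ 0, t := by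
          rw [Finset.sum_const, nsmul_eq_mul, mul_comm]
      _ ≤ ∑ x with k x ≠ 0, ∑ y ∈ Q x, ‖f y‖ / (Q x).card := by
          refine Finset.sum_le_sum fun x hx => ?_
          rw [← Finset.sum_div, le_div_iff₀ (hcard x)]
          exact ((hlow x).resolve_left (Finset.mem_filter.1 hx).2).le
      _ ≤ ∑ x, ∑ y ∈ Q x, ‖f y‖ / (Q x).card :=
          Finset.sum_le_sum_of_subset_of_nonneg (Finset.subset_univ _)
            fun _ _ _ => by positivity
      _ = ∑ x, ∑ y ∈ Q x, ‖f x‖ / (Q x).card :=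
          sum_sum_symm_average Q hQ (fun _ y => ‖f y‖)
      _ = s := by simp only [hone, hs]
  set Ω : Finset X := bad.biUnion fun y => S (k y) (b (k y) y) with hΩ
  have hΩcard : (Ω.card : ℝ) ≤ c * bad.card := by
    have key : ∀ z ∈ Ω, (1:ℝ) ≤ ∑ y ∈ bad, if z ∈ S (k y) (b (k y) y) then 1 / ((Q y).card : ℝ) else 0 := by
      intro z hz
      obtain ⟨y, hy, hzy⟩ := Finset.mem_biUnion.1 hz
      have hsub : Q y ⊆ bad := by
        intro y' hy'
        have := hbadQ y y' hy'
        simp only [bad, Finset.mem_filter, Finset.mem_univ, true_and] at hy ⊢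
        rwa [this]
      calc (1:ℝ) = ∑ y' ∈ Q y, 1 / ((Q y).card : ℝ) := (hone y 1).symm
        _ = ∑ y' ∈ Q y, if z ∈ S (k y') (b (k y') y') then 1 / ((Q y').card : ℝ) else 0 := by
            refine Finset.sum_congr rfl fun y' hy' => ?_
            have h1 := hbadQ y y' hy'
            have h2 : b (k y) y' = b (k y) y := by simpa [Q] using hy'
            rw [h1, h2, if_pos hzy, (hQ y y' hy').2]
        _ ≤ _ := Finset.sum_le_sum_of_subset_of_nonneg hsub fun _ _ _ => by
            split_ifs <;> positivity
    calc (Ω.card : ℝ) = ∑ z ∈ Ω, (1:ℝ) := by simp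
      _ ≤ ∑ z ∈ Ω, ∑ y ∈ bad, if z ∈ S (k y) (b (k y) y) then 1 / ((Q y).card : ℝ) else 0 :=
          Finset.sum_le_sum key
      _ ≤ ∑ z, ∑ y ∈ bad, if z ∈ S (k y) (b (k y) y) then 1 / ((Q y).card : ℝ) else 0 :=
          Finset.sum_le_sum_of_subset_of_nonneg (Finset.subset_univ _) fun _ _ _ =>
            Finset.sum_nonneg fun _ _ => by split_ifs <;> positivity
      _ = ∑ y ∈ bad, ((S (k y) (b (k y) y)).card : ℝ) / (Q y).card := by
          rw [Finset.sum_comm]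
          refine Finset.sum_congr rfl fun y _ => ?_
          rw [← Finset.sum_filter, Finset.sum_const, nsmul_eq_mul]
          simp [div_eq_mul_inv]
      _ ≤ ∑ y ∈ bad, c := by
          refine Finset.sum_le_sum fun y _ => ?_
          rw [div_le_iff₀ (hcard y)]
          exact hS (k y) (hkn y) y
      _ = c * bad.card := by rw [Finset.sum_const, nsmul_eq_mul, mul_comm]
  -- the bad part
  have hTb : ∀ z, ∑ y, κ z y * (f y - g y)
      = ∑ y, ∑ y' ∈ Q y, f y * (κ z y - κ z y') / (Q y).card := by
    intro z
    have h1 : ∑ y, κ z y * g y = ∑ y, ∑ y' ∈ Q y, κ z y' * f y / (Q y).card := by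
      rw [← sum_sum_symm_average Q hQ (fun y y' => κ z y * f y')]
      refine Finset.sum_congr rfl fun y _ => ?_
      rw [hg, Finset.mul_sum]
      refine Finset.sum_congr rfl fun y' _ => by ring
    have h2 : ∑ y, κ z y * f y = ∑ y, ∑ y' ∈ Q y, κ z y * f y / (Q y).card := by
      simp only [honeC]
    simp only [mul_sub, Finset.sum_sub_distrib]
    rw [h1, h2, ← Finset.sum_sub_distrib]
    refine Finset.sum_congr rfl fun y _ => ?_
    rw [← Finset.sum_sub_distrib]
    refine Finset.sum_congr rfl fun y' _ => by ring
  have hTb1 : ∑ z with z ∉ Ω, ‖∑ y, κ z y * (f y - g y)‖ ≤ A * s := by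
    calc ∑ z with z ∉ Ω, ‖∑ y, κ z y * (f y - g y)‖
        ≤ ∑ z with z ∉ Ω, ∑ y, ∑ y' ∈ Q y, ‖f y‖ * ‖κ z y - κ z y'‖ / (Q y).card := by
          refine Finset.sum_le_sum fun z _ => ?_
          rw [hTb]
          refine (norm_sum_le _ _).trans (Finset.sum_le_sum fun y _ => ?_)
          refine (norm_sum_le _ _).trans (le_of_eq ?_)
          simp
      _ = ∑ y, ∑ y' ∈ Q y, ‖f y‖ * (∑ z with z ∉ Ω, ‖κ z y - κ z y'‖) / (Q y).card := by
          rw [Finset.sum_comm]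
          refine Finset.sum_congr rfl fun y _ => ?_
          rw [Finset.sum_comm]
          refine Finset.sum_congr rfl fun y' _ => ?_
          rw [Finset.mul_sum, Finset.sum_div]
      _ ≤ ∑ y, ∑ y' ∈ Q y, ‖f y‖ * A / (Q y).card := by
          refine Finset.sum_le_sum fun y _ => Finset.sum_le_sum fun y' hy' => ?_
          have h2 : b (k y) y' = b (k y) y := by simpa [Q] using hy'
          gcongr
          by_cases h0 : k y = 0
          · rw [h0] at h2
            have := hinj h2
            simpa [this] using hA
          · refine le_trans ?_ (hH (k y) (hkn y) y y' h2)
            refine Finset.sum_le_sum_of_subset_of_nonneg ?_ fun _ _ _ => norm_nonneg _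
            intro z hz
            simp only [Finset.mem_filter, Finset.mem_univ, true_and] at hz ⊢
            intro hz'
            exact hz (Finset.mem_biUnion.2 ⟨y, by simp [bad, h0], hz'⟩)
      _ = A * s := by
          simp only [hone]
          rw [← Finset.sum_mul, mul_comm]
  have hTb2 : t / 2 * (Finset.univ.filter fun z => z ∉ Ω ∧ t / 2 < ‖∑ y, κ z y * (f y - g y)‖).card
      ≤ A * s := by
    refine le_trans ?_ hTb1
    rw [mul_comm, ← nsmul_eq_mul]
    refine (Finset.card_nsmul_le_sum _ (fun z => ‖∑ y, κ z y * (f y - g y)‖) _ fun x hx => ?_).trans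
        (Finset.sum_le_sum_of_subset_of_nonneg ?_ fun _ _ _ => by positivity)
    · exact (Finset.mem_filter.1 hx).2.2.le
    · intro z hz
      simp only [Finset.mem_filter, Finset.mem_univ, true_and] at hz ⊢
      exact hz.1
  have hunion : (Finset.univ.filter fun x => t < ‖∑ y, κ x y * f y‖)
      ⊆ (Finset.univ.filter fun x => t / 2 < ‖∑ y, κ x y * g y‖) ∪ (Ω ∪
        (Finset.univ.filter fun z => z ∉ Ω ∧ t / 2 < ‖∑ y, κ z y * (f y - g y)‖)) := by
    intro x hx
    simp only [Finset.mem_union, Finset.mem_filter, Finset.mem_univ, true_and] at hx ⊢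
    by_contra! hcon
    obtain ⟨h1, h2, h3⟩ := hcon
    have h4 := h3 h2
    have h5 : ∑ y, κ x y * f y = ∑ y, κ x y * g y + ∑ y, κ x y * (f y - g y) := by
      rw [← Finset.sum_add_distrib]
      refine Finset.sum_congr rfl fun y _ => by ring
    have := norm_add_le (∑ y, κ x y * g y) (∑ y, κ x y * (f y - g y))
    rw [← h5] at this
    linarith
  have hfin : (((Finset.univ.filter fun x => t < ‖∑ y, κ x y * f y‖).card : ℕ) : ℝ)
      ≤ (Finset.univ.filter fun x => t / 2 < ‖∑ y, κ x y * g y‖).card + (Ω.card +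
        (Finset.univ.filter fun z => z ∉ Ω ∧ t / 2 < ‖∑ y, κ z y * (f y - g y)‖).card) := by
    exact_mod_cast (Finset.card_le_card hunion).trans
      ((Finset.card_union_le _ _).trans (Nat.add_le_add_left (Finset.card_union_le _ _) _))
  have hTg' : t * (Finset.univ.filter fun x => t / 2 < ‖∑ y, κ x y * g y‖).card
      ≤ 8 * A * s := by
    have : t * (t * (Finset.univ.filter fun x => t / 2 < ‖∑ y, κ x y * g y‖).card)
      ≤ t * (8 * A * s) := by linarith
    exact le_of_mul_le_mul_left this ht
  have h7 := mul_le_mul_of_nonneg_left hfin ht.le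
  have h8 := mul_le_mul_of_nonneg_left hΩcard ht.le
  have h9 := mul_le_mul_of_nonneg_left hbadcard hc
  linarith

theorem integral_rpow_indicator_lt {q s : ℝ} (hq : -1 < q) (hs : 0 ≤ s) :
    IntegrableOn (fun t : ℝ => if t < s then t ^ q else 0) (Set.Ioi 0) ∧
      ∫ t in Set.Ioi (0 : ℝ), (if t < s then t ^ q else 0) = s ^ (q + 1) / (q + 1) := by
  have h1 : (fun t : ℝ => if t < s then t ^ q else 0) = (Set.Iio s).indicator fun t => t ^ q := by
    ext t; simp [Set.indicator_apply]
  have h2 : Set.Ioi (0 : ℝ) ∩ Set.Iio s = Set.Ioo 0 s := rfl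
  rw [h1]
  constructor
  · rw [IntegrableOn, integrable_indicator_iff measurableSet_Iio, IntegrableOn,
      Measure.restrict_restrict measurableSet_Iio, Set.inter_comm, h2]
    exact ((intervalIntegral.intervalIntegrable_rpow' hq (a := 0) (b := s)).1).mono_set
      Set.Ioo_subset_Ioc_self
  · rw [setIntegral_indicator measurableSet_Iio, h2, ← integral_Ioc_eq_integral_Ioo,
      ← intervalIntegral.integral_of_le hs, integral_rpow (Or.inl hq),
      Real.zero_rpow (by linarith), sub_zero]

theorem integral_rpow_indicator_ge {q s : ℝ} (hq : q < -1) (hs : 0 < s) :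
    IntegrableOn (fun t : ℝ => if s ≤ t then t ^ q else 0) (Set.Ioi 0) ∧
      ∫ t in Set.Ioi (0 : ℝ), (if s ≤ t then t ^ q else 0) = -s ^ (q + 1) / (q + 1) := by
  have h1 : (fun t : ℝ => if s ≤ t then t ^ q else 0) = (Set.Ici s).indicator fun t => t ^ q := by
    ext t; simp [Set.indicator_apply]
  have h2 : Set.Ioi (0 : ℝ) ∩ Set.Ici s = Set.Ici s :=
    Set.inter_eq_right.2 fun t ht => lt_of_lt_of_le hs ht
  rw [h1]
  constructor
  · rw [IntegrableOn, integrable_indicator_iff measurableSet_Ici, IntegrableOn,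
      Measure.restrict_restrict measurableSet_Ici, Set.inter_comm, h2]
    exact (integrableOn_Ici_iff_integrableOn_Ioi (by simp)).2 (integrableOn_Ioi_rpow_of_lt hq hs)
  · rw [setIntegral_indicator measurableSet_Ici, h2, integral_Ici_eq_integral_Ioi,
      integral_Ioi_rpow_of_lt hq hs]

theorem strong_type_of_weak_type {X : Type*} [Fintype X] {p : ℝ} (hp1 : 1 < p) (hp2 : p < 2)
    (T : (X → ℂ) → X → ℂ) (hT : ∀ f g, T (f + g) = T f + T g) {W A : ℝ}
    (hweak : ∀ f t, 0 < t → t * (Finset.univ.filter fun x => t < ‖T f x‖).card ≤ W * ∑ x, ‖f x‖)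
    (hL2 : ∀ f, ∑ x, ‖T f x‖ ^ 2 ≤ A * ∑ x, ‖f x‖ ^ 2) (f : X → ℂ) :
    ∑ x, ‖T f x‖ ^ p ≤ 2 ^ p * p * (W / (p - 1) + A / (2 - p)) * ∑ x, ‖f x‖ ^ p := by
  classical
  have hpt : ∀ t : ℝ, 0 < t → ∑ x, (if t < ‖T f x‖ / 2 then t ^ (p - 1) else 0) ≤
      W * ∑ x, ‖f x‖ * (if t < ‖f x‖ then t ^ (p - 2) else 0)
      + A * ∑ x, ‖f x‖ ^ 2 * (if ‖f x‖ ≤ t then t ^ (p - 3) else 0) := by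
    intro t ht
    set f₁ : X → ℂ := fun x => if t < ‖f x‖ then f x else 0 with hf₁
    set f₂ : X → ℂ := fun x => if ‖f x‖ ≤ t then f x else 0 with hf₂
    have hsum : f = f₁ + f₂ := by
      ext x
      simp only [f₁, f₂, Pi.add_apply]
      by_cases h : t < ‖f x‖
      · simp [h, not_le.2 h]
      · simp [h, not_lt.1 h]
    have h1 := hweak f₁ t ht
    have h2 : t ^ 2 * (Finset.univ.filter fun x => t < ‖T f₂ x‖).card
        ≤ A * ∑ x, ‖f₂ x‖ ^ 2 := by
      refine le_trans ?_ (hL2 f₂)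
      rw [mul_comm, ← nsmul_eq_mul]
      refine (Finset.card_nsmul_le_sum (Finset.univ.filter fun x => t < ‖T f₂ x‖)
        (fun x => ‖T f₂ x‖ ^ 2) _ fun x hx => ?_).trans
        (Finset.sum_le_sum_of_subset_of_nonneg (Finset.subset_univ _) fun _ _ _ => by positivity)
      have := (Finset.mem_filter.1 hx).2
      gcongr
    have hcard : (((Finset.univ.filter fun x => t < ‖T f x‖ / 2).card : ℕ) : ℝ)
        ≤ (Finset.univ.filter fun x => t < ‖T f₁ x‖).card
          + (Finset.univ.filter fun x => t < ‖T f₂ x‖).card := by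
      have hsub : (Finset.univ.filter fun x => t < ‖T f x‖ / 2) ⊆
          (Finset.univ.filter fun x => t < ‖T f₁ x‖)
            ∪ (Finset.univ.filter fun x => t < ‖T f₂ x‖) := by
        intro x hx
        simp only [Finset.mem_union, Finset.mem_filter, Finset.mem_univ, true_and] at hx ⊢
        by_contra! hcon
        have h5 : T f x = T f₁ x + T f₂ x := by
          conv_lhs => rw [hsum, hT]
          rfl
        have := norm_add_le (T f₁ x) (T f₂ x)
        rw [← h5] at this
        linarith [hcon.1, hcon.2]
      exact_mod_cast (Finset.card_le_card hsub).trans (Finset.card_union_le _ _)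
    have e1 : t ^ (p - 1) = t ^ (p - 2) * t := by
      rw [← Real.rpow_add_one ht.ne']; ring_nf
    have e2 : t ^ (p - 1) = t ^ (p - 3) * t ^ 2 := by
      rw [← Real.rpow_natCast, ← Real.rpow_add ht]; congr 1; push_cast; ring
    have e3 : ∑ x, ‖f x‖ * (if t < ‖f x‖ then t ^ (p - 2) else 0)
        = t ^ (p - 2) * ∑ x, ‖f₁ x‖ := by
      rw [Finset.mul_sum]
      refine Finset.sum_congr rfl fun x _ => ?_
      simp only [f₁]; split_ifs <;> simp [mul_comm]
    have e4 : ∑ x, ‖f x‖ ^ 2 * (if ‖f x‖ ≤ t then t ^ (p - 3) else 0)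
        = t ^ (p - 3) * ∑ x, ‖f₂ x‖ ^ 2 := by
      rw [Finset.mul_sum]
      refine Finset.sum_congr rfl fun x _ => ?_
      simp only [f₂]; split_ifs <;> simp [mul_comm]
    rw [e3, e4, ← Finset.sum_filter, Finset.sum_const, nsmul_eq_mul, mul_comm]
    have hp0 : 0 ≤ t ^ (p - 1) := by positivity
    calc t ^ (p - 1) * (Finset.univ.filter fun x => t < ‖T f x‖ / 2).card
        ≤ t ^ (p - 1) * ((Finset.univ.filter fun x => t < ‖T f₁ x‖).card
          + (Finset.univ.filter fun x => t < ‖T f₂ x‖).card) := by gcongr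
      _ = t ^ (p - 2) * (t * (Finset.univ.filter fun x => t < ‖T f₁ x‖).card)
          + t ^ (p - 3) * (t ^ 2 * (Finset.univ.filter fun x => t < ‖T f₂ x‖).card) := by
          rw [mul_add]; nth_rewrite 1 [e1]; rw [e2]; ring
      _ ≤ t ^ (p - 2) * (W * ∑ x, ‖f₁ x‖) + t ^ (p - 3) * (A * ∑ x, ‖f₂ x‖ ^ 2) := by gcongr
      _ = _ := by ring
  have I1 := fun x => integral_rpow_indicator_lt (q := p - 1) (s := ‖T f x‖ / 2) (by linarith)
    (by positivity)
  have I2 := fun x => integral_rpow_indicator_lt (q := p - 2) (s := ‖f x‖) (by linarith)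
    (by positivity)
  have I3 : ∀ x, IntegrableOn (fun t : ℝ => ‖f x‖ ^ 2 * (if ‖f x‖ ≤ t then t ^ (p - 3) else 0))
      (Set.Ioi 0) ∧ ∫ t in Set.Ioi (0 : ℝ), ‖f x‖ ^ 2 * (if ‖f x‖ ≤ t then t ^ (p - 3) else 0)
        = ‖f x‖ ^ p / (2 - p) := by
    intro x
    rcases (norm_nonneg (f x)).eq_or_lt with h0 | h0
    · rw [← h0]
      simp [Real.zero_rpow (by linarith : p ≠ 0)]
    · have h := integral_rpow_indicator_ge (q := p - 3) (by linarith) h0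
      refine ⟨h.1.const_mul _, ?_⟩
      rw [integral_const_mul, h.2]
      have : ‖f x‖ ^ p = ‖f x‖ ^ 2 * ‖f x‖ ^ (p - 3 + 1) := by
        rw [← Real.rpow_natCast, ← Real.rpow_add h0]; congr 1; push_cast; ring
      rw [this]
      have h3 : p - 3 + 1 ≠ 0 := by linarith
      have h4 : 2 - p ≠ 0 := by linarith
      field_simp
      ring
  have hInt := setIntegral_mono_on (μ := volume) (s := Set.Ioi (0 : ℝ))
    (f := fun t => ∑ x, (if t < ‖T f x‖ / 2 then t ^ (p - 1) else 0))
    (g := fun t => W * ∑ x, ‖f x‖ * (if t < ‖f x‖ then t ^ (p - 2) else 0)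
      + A * ∑ x, ‖f x‖ ^ 2 * (if ‖f x‖ ≤ t then t ^ (p - 3) else 0))
    (integrable_finsetSum _ fun x _ => (I1 x).1)
    (((integrable_finsetSum _ fun x _ => (I2 x).1.const_mul _).const_mul _).add
      ((integrable_finsetSum _ fun x _ => (I3 x).1).const_mul _)) measurableSet_Ioi
    (fun t ht => hpt t ht)
  rw [integral_add ((integrable_finsetSum _ fun x _ => (I2 x).1.const_mul _).const_mul _)
      ((integrable_finsetSum _ fun x _ => (I3 x).1).const_mul _),
    integral_const_mul, integral_const_mul, integral_finsetSum _ fun x _ => (I1 x).1,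
    integral_finsetSum _ fun x _ => (I2 x).1.const_mul _,
    integral_finsetSum _ fun x _ => (I3 x).1] at hInt
  simp only [fun x => (I1 x).2, fun x => (I2 x).2, fun x => (I3 x).2, integral_const_mul] at hInt
  have hp0 : p ≠ 0 := by linarith
  have r1 : ∑ x, (‖T f x‖ / 2) ^ (p - 1 + 1) / (p - 1 + 1) = (2 ^ p * p)⁻¹ * ∑ x, ‖T f x‖ ^ p := by
    rw [Finset.mul_sum]
    refine Finset.sum_congr rfl fun x _ => ?_
    rw [sub_add_cancel, Real.div_rpow (norm_nonneg _) (by norm_num)]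
    field_simp
  have r2 : ∑ x, ‖f x‖ * (‖f x‖ ^ (p - 2 + 1) / (p - 2 + 1)) = (∑ x, ‖f x‖ ^ p) / (p - 1) := by
    rw [Finset.sum_div]
    refine Finset.sum_congr rfl fun x _ => ?_
    have e : p - 2 + 1 = p - 1 := by ring
    rw [e, ← mul_div_assoc]
    congr 1
    rcases (norm_nonneg (f x)).eq_or_lt with h0 | h0
    · rw [← h0]; simp [Real.zero_rpow hp0]
    · rw [mul_comm, ← Real.rpow_add_one h0.ne', sub_add_cancel]
  rw [r1, r2, ← Finset.sum_div] at hInt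
  have hpos : (0:ℝ) < 2 ^ p * p := by positivity
  rw [inv_mul_le_iff₀ hpos] at hInt
  refine hInt.trans (le_of_eq ?_)
  ring

theorem lp_bound_of_transpose {X : Type*} [Fintype X] {p q : ℝ} (hpq : p.HolderConjugate q)
    (κ : X → X → ℂ) {C : ℝ} (hC : 0 ≤ C)
    (hκ : ∀ g : X → ℂ, ∑ x, ‖∑ y, κ y x * g y‖ ^ q ≤ C * ∑ x, ‖g x‖ ^ q) (f : X → ℂ) :
    ∑ x, ‖∑ y, κ x y * f y‖ ^ p ≤ C ^ (p - 1) * ∑ x, ‖f x‖ ^ p := by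
  set T : X → ℂ := fun x => ∑ y, κ x y * f y with hT
  set g : X → ℂ := fun x => (starRingEnd ℂ) (T x) * ((‖T x‖ ^ (p - 2) : ℝ) : ℂ) with hg
  have hp := hpq.pos
  have hq := hpq.symm.pos
  have hp1 := hpq.lt
  have hgT : ∀ x, g x * T x = ((‖T x‖ ^ p : ℝ) : ℂ) := by
    intro x
    have h1 : g x * T x = ((‖T x‖ ^ 2 * ‖T x‖ ^ (p - 2) : ℝ) : ℂ) := by
      have := Complex.conj_mul' (T x)
      push_cast
      rw [← this, hg]; ring
    rw [h1]
    congr 1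
    rcases (norm_nonneg (T x)).eq_or_lt with h0 | h0
    · rw [← h0]; simp [Real.zero_rpow hp.ne']
    · rw [← Real.rpow_natCast, ← Real.rpow_add h0]; congr 1; push_cast; ring
  have hgq : ∀ x, ‖g x‖ ^ q = ‖T x‖ ^ p := by
    intro x
    have h1 : ‖g x‖ = ‖T x‖ * ‖T x‖ ^ (p - 2) := by
      simp only [g, norm_mul, RCLike.norm_conj, Complex.norm_real, Real.norm_eq_abs]
      rw [abs_of_nonneg (by positivity)]
    rw [h1]
    rcases (norm_nonneg (T x)).eq_or_lt with h0 | h0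
    · rw [← h0]; simp [Real.zero_rpow hp.ne', Real.zero_rpow hq.ne']
    · rw [mul_comm, ← Real.rpow_add_one h0.ne', ← Real.rpow_mul h0.le]
      congr 1
      have := hpq.sub_one_mul_conj
      linarith
  set P := ∑ x, ‖T x‖ ^ p with hP
  set F := ∑ x, ‖f x‖ ^ p with hF
  have hP0 : 0 ≤ P := by positivity
  have hF0 : 0 ≤ F := by positivity
  have hPle : P ≤ F ^ (1 / p) * (C * P) ^ (1 / q) := by
    have h1 : ((P : ℝ) : ℂ) = ∑ y, f y * ∑ x, κ x y * g x := by
      rw [hP]; push_cast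
      calc ∑ x, ((‖T x‖ ^ p : ℝ) : ℂ) = ∑ x, ∑ y, g x * (κ x y * f y) := by
            refine Finset.sum_congr rfl fun x _ => ?_
            rw [← hgT, hT, Finset.mul_sum]
        _ = _ := by
            rw [Finset.sum_comm]
            refine Finset.sum_congr rfl fun y _ => ?_
            rw [Finset.mul_sum]
            refine Finset.sum_congr rfl fun x _ => by ring
    calc P = ‖((P : ℝ) : ℂ)‖ := by simp [abs_of_nonneg hP0]
      _ ≤ ∑ y, ‖f y‖ * ‖∑ x, κ x y * g x‖ := by
          rw [h1]
          refine (norm_sum_le _ _).trans (le_of_eq ?_)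
          simp
      _ ≤ (∑ y, ‖f y‖ ^ p) ^ (1 / p) * (∑ y, ‖∑ x, κ x y * g x‖ ^ q) ^ (1 / q) :=
          Real.inner_le_Lp_mul_Lq_of_nonneg _ hpq (fun _ _ => norm_nonneg _)
            (fun _ _ => norm_nonneg _)
      _ ≤ _ := by
          gcongr
          refine (hκ g).trans (le_of_eq ?_)
          simp only [hgq, hP]
  change P ≤ _
  rcases hP0.eq_or_lt with h0 | h0
  · rw [← h0]; positivity
  have h2 : P ^ (1 / p) ≤ F ^ (1 / p) * C ^ (1 / q) := by
    rw [Real.mul_rpow hC hP0, ← mul_assoc] at hPle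
    have e : P = P ^ (1 / p) * P ^ (1 / q) := by
      rw [← Real.rpow_add h0, one_div, one_div, hpq.inv_add_inv_eq_one, Real.rpow_one]
    have h3 : P ^ (1 / p) * P ^ (1 / q) ≤ F ^ (1 / p) * C ^ (1 / q) * P ^ (1 / q) := by
      rw [← e]; exact hPle
    exact le_of_mul_le_mul_right h3 (by positivity)
  have h4 := Real.rpow_le_rpow (by positivity) h2 hp.le
  rw [Real.mul_rpow (by positivity) (by positivity), ← Real.rpow_mul hP0, ← Real.rpow_mul hF0,
    ← Real.rpow_mul hC, one_div_mul_cancel hp.ne', Real.rpow_one, Real.rpow_one] at h4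
  have h5 : 1 / q * p = p - 1 := by
    have := hpq.div_conj_eq_sub_one
    rw [← this]; ring
  rw [h5] at h4
  linarith

/-- The chordal distance from `e^{2πiu/N}` to `1`. -/
def chord {N : ℕ} [NeZero N] (u : ZMod N) : ℝ := ‖ZMod.stdAddChar u - 1‖

/-- The distance from `η` to `0` in the cyclic group `ℤ/N`. -/
def freq {N : ℕ} (η : ZMod N) : ℕ := η.valMinAbs.natAbs

theorem freq_neg {N : ℕ} (η : ZMod N) : freq (-η) = freq η := ZMod.natAbs_valMinAbs_neg η

section Cyclic

variable {N : ℕ} [NeZero N]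

theorem chord_nonneg (u : ZMod N) : 0 ≤ chord u := norm_nonneg _

theorem norm_stdAddChar_add_sub (u h : ZMod N) :
    ‖ZMod.stdAddChar (u + h) - ZMod.stdAddChar u‖ = chord h := by
  rw [AddChar.map_add_eq_mul, ← mul_sub_one, norm_mul, AddChar.norm_apply, one_mul, chord]

theorem chord_neg (u : ZMod N) : chord (-u) = chord u := by
  rw [← norm_stdAddChar_add_sub u (-u), add_neg_cancel, AddChar.map_zero_eq_one, norm_sub_rev, chord]

theorem chord_add_le (u h : ZMod N) : chord (u + h) ≤ chord u + chord h := by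
  have := norm_sub_le_norm_sub_add_norm_sub (ZMod.stdAddChar (u + h)) (ZMod.stdAddChar u) 1
  rw [norm_stdAddChar_add_sub u h] at this
  rw [add_comm (chord u)]
  exact this

theorem chord_le_two (u : ZMod N) : chord u ≤ 2 := by
  refine (norm_sub_le _ _).trans ?_
  rw [AddChar.norm_apply]; norm_num

theorem chord_intCast (j : ℤ) : chord (j : ZMod N) = 2 * |Real.sin (π * j / N)| := by
  have h : 2 * (π : ℂ) * Complex.I * j / N = Complex.I * ((2 * π * j / N : ℝ) : ℂ) := by
    push_cast; ring
  rw [chord, ZMod.stdAddChar_coe, h, Complex.norm_exp_I_mul_ofReal_sub_one, norm_mul]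
  simp only [Real.norm_eq_abs, Nat.abs_ofNat]
  congr 3; ring

theorem chord_intCast_le (j : ℤ) : chord (j : ZMod N) ≤ 2 * π * |(j : ℝ)| / N := by
  rw [chord_intCast]
  have := Real.abs_sin_le_abs (x := π * j / N)
  have h2 : |π * j / N| = π * |(j : ℝ)| / N := by
    rw [abs_div, abs_mul, abs_of_pos Real.pi_pos, Nat.abs_cast]
  rw [h2] at this
  calc _ ≤ 2 * (π * |(j : ℝ)| / N) := by linarith
    _ = _ := by ring

theorem freq_le_chord (u : ZMod N) : 4 * (freq u : ℝ) ≤ N * chord u := by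
  have hN : (0 : ℝ) < N := by exact_mod_cast Nat.pos_of_ne_zero (NeZero.ne N)
  have h1 : chord u = 2 * |Real.sin (π * u.valMinAbs / N)| := by
    rw [← chord_intCast, ZMod.coe_valMinAbs]
  have h2 : (freq u : ℝ) = |(u.valMinAbs : ℝ)| := by
    rw [freq, Nat.cast_natAbs]; push_cast; rfl
  have h3 : (freq u : ℝ) ≤ N / 2 := by
    have := ZMod.natAbs_valMinAbs_le u
    have h : freq u * 2 ≤ N := by unfold freq; omega
    have h' : (freq u : ℝ) * 2 ≤ N := by exact_mod_cast h
    linarith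
  have h4 : |π * u.valMinAbs / N| = π * freq u / N := by
    rw [abs_div, abs_mul, abs_of_pos Real.pi_pos, Nat.abs_cast, h2]
  have h5 : |π * u.valMinAbs / N| ≤ π / 2 := by
    rw [h4, div_le_iff₀ hN]
    nlinarith [Real.pi_pos]
  have h6 := Real.mul_abs_le_abs_sin h5
  rw [h4] at h6
  have h7 : 2 / π * (π * freq u / N) = 2 * freq u / N := by field_simp
  rw [h7, div_le_iff₀ hN] at h6
  rw [h1]; linarith

theorem chord_mul_le (u η : ZMod N) : chord (u * η) ≤ freq η * chord u := by
  have key : ∀ k : ℕ, chord (u * (k : ZMod N)) ≤ k * chord u := by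
    intro k
    induction k with
    | zero => simp [chord]
    | succ k ih =>
      push_cast
      rw [mul_add_one]
      refine (chord_add_le _ _).trans ?_
      linarith
  rcases Int.natAbs_eq η.valMinAbs with h | h
  · have : (η : ZMod N) = ((freq η : ℕ) : ZMod N) := by
      conv_lhs => rw [← ZMod.coe_valMinAbs η, h]
      simp [freq]
    conv_lhs => rw [this]
    exact key _
  · have : (η : ZMod N) = -((freq η : ℕ) : ZMod N) := by
      conv_lhs => rw [← ZMod.coe_valMinAbs η, h]
      simp [freq]
    conv_lhs => rw [this, mul_neg, chord_neg]
    exact key _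

theorem freq_add_one_le (η : ZMod N) : freq (η + 1) ≤ freq η + 1 := by
  have h1 := ZMod.natAbs_valMinAbs_add_le η 1
  have h2 : (1 : ZMod N).valMinAbs.natAbs ≤ 1 := by
    by_cases hN : N / 2 = 0
    · have := ZMod.natAbs_valMinAbs_le (1 : ZMod N); omega
    · have : (((1 : ℕ) : ZMod N)).valMinAbs = (1 : ℕ) :=
        ZMod.valMinAbs_natCast_of_le_half (by omega)
      rw [Nat.cast_one] at this
      rw [this]; simp
  have := Int.natAbs_add_le η.valMinAbs (1 : ZMod N).valMinAbs
  unfold freq; omega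

theorem freq_le_freq_add_one (η : ZMod N) : freq η ≤ freq (η + 1) + 1 := by
  have := freq_add_one_le (-(η + 1))
  rwa [freq_neg, show -(η + 1) + 1 = -η by ring, freq_neg] at this

theorem card_freq_eq_le (k : ℕ) :
    (Finset.univ.filter fun η : ZMod N => freq η = k).card ≤ 2 := by
  classical
  calc _ ≤ ({(k : ℤ), -(k : ℤ)} : Finset ℤ).card := by
        refine Finset.card_le_card_of_injOn ZMod.valMinAbs ?_ (ZMod.injective_valMinAbs.injOn)
        intro η hη
        have h : freq η = k := by simpa using hη
        unfold freq at h
        simp only [Finset.coe_insert, Finset.coe_singleton, Set.mem_insert_iff,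
          Set.mem_singleton_iff]
        omega
    _ ≤ 2 := Finset.card_le_two

theorem card_freq_lt_le (T : ℕ) :
    (Finset.univ.filter fun η : ZMod N => freq η < T).card ≤ 2 * T := by
  classical
  have : (Finset.univ.filter fun η : ZMod N => freq η < T)
      = (Finset.range T).biUnion fun k => Finset.univ.filter fun η : ZMod N => freq η = k := by
    ext η; simp
  rw [this]
  refine Finset.card_biUnion_le.trans ?_
  refine (Finset.sum_le_sum fun k _ => card_freq_eq_le k).trans ?_
  simp [mul_comm]

theorem card_chord_lt_le {R : ℝ} (hR : 1 ≤ N * R) :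
    ((Finset.univ.filter fun u : ZMod N => chord u < R).card : ℝ) ≤ 3 * (N * R) := by
  have h1 : (Finset.univ.filter fun u : ZMod N => chord u < R).card ≤ 2 * (⌊N * R / 4⌋₊ + 1) := by
    refine le_trans (Finset.card_le_card ?_) (card_freq_lt_le (N := N) (⌊N * R / 4⌋₊ + 1))
    intro u hu
    simp only [Finset.mem_filter, Finset.mem_univ, true_and] at hu ⊢
    rw [Nat.lt_succ_iff]
    apply Nat.le_floor
    have := freq_le_chord u
    have h3 : N * chord u ≤ N * R := by gcongr
    linarith
  have h2 : ((Finset.univ.filter fun u : ZMod N => chord u < R).card : ℝ)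
      ≤ 2 * (⌊N * R / 4⌋₊ + 1) := by exact_mod_cast h1
  have := Nat.floor_le (show 0 ≤ N * R / 4 by linarith)
  linarith

theorem sum_freq_ge_inv_sq_le (T : ℕ) :
    ∑ η : ZMod N with T ≤ freq η, (1 : ℝ) / (1 + freq η) ^ 2 ≤ 4 / ((T : ℝ) + 1) := by
  classical
  have hmap : ∀ η ∈ (Finset.univ.filter fun η : ZMod N => T ≤ freq η),
      freq η + 1 ∈ Finset.Ioo T (N + 2) := by
    intro η hη
    have h1 := ZMod.natAbs_valMinAbs_le η
    have h2 : T ≤ freq η := by simpa using hη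
    simp only [Finset.mem_Ioo]
    unfold freq at *
    omega
  rw [← Finset.sum_fiberwise_of_maps_to hmap]
  calc ∑ k ∈ Finset.Ioo T (N + 2), ∑ η ∈ (Finset.univ.filter fun η : ZMod N => T ≤ freq η)
        with freq η + 1 = k, (1 : ℝ) / (1 + freq η) ^ 2
      ≤ ∑ k ∈ Finset.Ioo T (N + 2), 2 * ((k : ℝ) ^ 2)⁻¹ := by
        refine Finset.sum_le_sum fun k _ => ?_
        have h1 : ∀ η ∈ (Finset.univ.filter fun η : ZMod N => T ≤ freq η).filter
            (fun η => freq η + 1 = k), (1 : ℝ) / (1 + freq η) ^ 2 = ((k : ℝ) ^ 2)⁻¹ := by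
          intro η hη
          rw [← (Finset.mem_filter.1 hη).2]
          push_cast; rw [one_div, add_comm]
        rw [Finset.sum_congr rfl h1, Finset.sum_const, nsmul_eq_mul]
        gcongr
        have h2 : ((Finset.univ.filter fun η : ZMod N => T ≤ freq η).filter
            (fun η => freq η + 1 = k)).card ≤ 2 := by
          refine le_trans (Finset.card_le_card ?_) (card_freq_eq_le (N := N) (k - 1))
          intro η hη
          simp only [Finset.mem_filter, Finset.mem_univ, true_and] at hη ⊢
          omega
        exact_mod_cast h2
    _ = 2 * ∑ k ∈ Finset.Ioo T (N + 2), ((k : ℝ) ^ 2)⁻¹ := by rw [Finset.mul_sum]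
    _ ≤ 2 * (2 / (T + 1)) := by gcongr; exact sum_Ioo_inv_sq_le _ _
    _ = _ := by ring

theorem sum_div_sq_chord_le {w : ZMod N → ℝ} (hw : ∀ u, 0 ≤ w u) {c ρ : ℝ} (hρ : 0 < ρ)
    (hc : 0 ≤ c) (h : ∀ R, ρ ≤ R → ∑ u with chord u < R, w u ≤ c * R) :
    ∑ u with ρ ≤ chord u, w u / chord u ^ 2 ≤ 4 * c / ρ := by
  obtain ⟨K, hK⟩ := pow_unbounded_of_one_lt (2 / ρ) (one_lt_two)
  have hK' : 2 < 2 ^ K * ρ := (div_lt_iff₀ hρ).1 hK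
  have hpt : ∀ u : ZMod N, ρ ≤ chord u → w u / chord u ^ 2 ≤
      ∑ k ∈ Finset.range K, if chord u < 2 ^ (k + 1) * ρ then w u / (2 ^ k * ρ) ^ 2 else 0 := by
    intro u hu
    have hex : ∃ k, chord u < 2 ^ (k + 1) * ρ :=
      ⟨K, (chord_le_two u).trans_lt (hK'.trans_le (by gcongr <;> simp))⟩
    classical
    set k := Nat.find hex with hk
    have hk1 : chord u < 2 ^ (k + 1) * ρ := Nat.find_spec hex
    have hk2 : 2 ^ k * ρ ≤ chord u := by
      rcases Nat.eq_zero_or_pos k with h0 | h0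
      · rw [h0]; simpa using hu
      · have := Nat.find_min hex (m := k - 1) (by omega)
        rw [Nat.sub_add_cancel h0] at this
        exact not_lt.1 this
    have hkK : k < K := by
      by_contra! hcon
      have : (2:ℝ) ^ K * ρ ≤ 2 ^ k * ρ := by gcongr; norm_num
      linarith [chord_le_two u]
    refine le_trans ?_ (Finset.single_le_sum (fun j _ => ?_) (Finset.mem_range.2 hkK))
    · rw [if_pos hk1]
      have := hw u
      gcongr
    · have := hw u
      split_ifs <;> positivity
  calc ∑ u with ρ ≤ chord u, w u / chord u ^ 2
      ≤ ∑ u with ρ ≤ chord u, ∑ k ∈ Finset.range K,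
          if chord u < 2 ^ (k + 1) * ρ then w u / (2 ^ k * ρ) ^ 2 else 0 :=
        Finset.sum_le_sum fun u hu => hpt u (Finset.mem_filter.1 hu).2
    _ ≤ ∑ u, ∑ k ∈ Finset.range K,
          if chord u < 2 ^ (k + 1) * ρ then w u / (2 ^ k * ρ) ^ 2 else 0 :=
        Finset.sum_le_sum_of_subset_of_nonneg (Finset.subset_univ _) fun u _ _ =>
          Finset.sum_nonneg fun k _ => by have := hw u; split_ifs <;> positivity
    _ = ∑ k ∈ Finset.range K, (∑ u with chord u < 2 ^ (k + 1) * ρ, w u) / (2 ^ k * ρ) ^ 2 := by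
        rw [Finset.sum_comm]
        refine Finset.sum_congr rfl fun k _ => ?_
        rw [Finset.sum_div, Finset.sum_filter]
    _ ≤ ∑ k ∈ Finset.range K, (2 * c / ρ) * (1 / 2) ^ k := by
        refine Finset.sum_le_sum fun k _ => ?_
        rw [div_le_iff₀ (by positivity)]
        have h1 : (1:ℝ) ≤ 2 ^ (k + 1) := one_le_pow₀ (by norm_num)
        refine (h (2 ^ (k + 1) * ρ) (by nlinarith)).trans (le_of_eq ?_)
        rw [one_div, inv_pow]
        field_simp
        ring
    _ = (2 * c / ρ) * ∑ k ∈ Finset.range K, (1 / 2 : ℝ) ^ k := by rw [Finset.mul_sum]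
    _ ≤ (2 * c / ρ) * 2 := by
        gcongr
        exact sum_geometric_two_le K
    _ = _ := by ring

theorem parseval_zmod (c : ZMod N → ℂ) :
    ∑ u : ZMod N, ‖∑ η, c η * ZMod.stdAddChar (u * η)‖ ^ 2 = N * ∑ η, ‖c η‖ ^ 2 := by
  classical
  have h1 : ((∑ u : ZMod N, ‖∑ η, c η * ZMod.stdAddChar (u * η)‖ ^ 2 : ℝ) : ℂ)
      = ((N * ∑ η, ‖c η‖ ^ 2 : ℝ) : ℂ) := by
    push_cast
    have h2 : ∀ u : ZMod N, (‖∑ η, c η * ZMod.stdAddChar (u * η)‖ : ℂ) ^ 2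
        = ∑ η, ∑ η', (starRingEnd ℂ) (c η) * c η' * ZMod.stdAddChar (u * (η' - η)) := by
      intro u
      rw [← Complex.conj_mul', map_sum, Finset.sum_mul_sum]
      refine Finset.sum_congr rfl fun η _ => Finset.sum_congr rfl fun η' _ => ?_
      rw [map_mul, ← AddChar.map_neg_eq_conj, mul_sub, sub_eq_add_neg, AddChar.map_add_eq_mul]
      ring
    simp only [h2]
    rw [Finset.sum_comm, Finset.mul_sum]
    refine Finset.sum_congr rfl fun η _ => ?_
    rw [Finset.sum_comm]
    simp only [← Finset.mul_sum, AddChar.sum_mulShift _ (ZMod.isPrimitive_stdAddChar N),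
      sub_eq_zero, ZMod.card, Nat.cast_ite, Nat.cast_zero]
    simp only [mul_ite, mul_zero]
    rw [Finset.sum_ite_eq' Finset.univ η]
    simp only [Finset.mem_univ, if_true]
    rw [Complex.conj_mul']; ring
  exact_mod_cast h1

end Cyclic

/-- The convolution kernel on `ℤ/N` of the Fourier multiplier `M`. -/
def multKernel {N : ℕ} [NeZero N] (M : ZMod N → ℂ) (u : ZMod N) : ℂ :=
  ∑ η, M η * ZMod.stdAddChar (u * η)

section Kernel

variable {N : ℕ} [NeZero N]

theorem multKernel_mul_sub_one (M : ZMod N → ℂ) (u : ZMod N) :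
    (ZMod.stdAddChar u - 1) * multKernel M u = multKernel (fun η => M (η - 1) - M η) u := by
  have h1 : ∑ η, M (η - 1) * ZMod.stdAddChar (u * η) = ∑ η, M η * ZMod.stdAddChar (u * (η + 1)) :=
    Fintype.sum_equiv (Equiv.subRight 1) _ _ fun η => by simp
  simp only [multKernel, sub_mul, Finset.sum_sub_distrib]
  rw [h1, Finset.mul_sum, one_mul]
  congr 1
  refine Finset.sum_congr rfl fun η _ => ?_
  rw [mul_add_one, AddChar.map_add_eq_mul]; ring

theorem sum_sq_multKernel_diff_le {A : ℝ} (hA : 0 ≤ A) {d : ZMod N → ℂ}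
    (hd : ∀ η, ‖d η‖ * (1 + freq η) ≤ A) {ρ : ℝ} (hρ : 0 < ρ) {h : ZMod N} (hh : chord h ≤ ρ) :
    ∑ u, ‖multKernel d (u + h) - multKernel d u‖ ^ 2 ≤ 18 * N * A ^ 2 * ρ := by
  have h1 : ∀ u, multKernel d (u + h) - multKernel d u
      = ∑ η, (d η * (ZMod.stdAddChar (h * η) - 1)) * ZMod.stdAddChar (u * η) := by
    intro u
    simp only [multKernel]
    rw [← Finset.sum_sub_distrib]
    refine Finset.sum_congr rfl fun η _ => ?_
    rw [add_mul, AddChar.map_add_eq_mul]; ring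
  simp only [h1]
  rw [parseval_zmod]
  have hd' : ∀ η, ‖d η‖ ≤ A / (1 + freq η) := fun η => by
    rw [le_div_iff₀ (by positivity)]; exact hd η
  set T := ⌊1 / ρ⌋₊ with hT
  have hT1 : (T : ℝ) ≤ 1 / ρ := Nat.floor_le (by positivity)
  have hT2 : 1 / ρ < T + 1 := Nat.lt_floor_add_one _
  have hlow : ∑ η with freq η < T, ‖d η * (ZMod.stdAddChar (h * η) - 1)‖ ^ 2 ≤ 2 * A ^ 2 * ρ := by
    calc _ ≤ ∑ η : ZMod N with freq η < T, (A * ρ) ^ 2 := by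
          refine Finset.sum_le_sum fun η _ => ?_
          rw [norm_mul]
          have h2 : ‖ZMod.stdAddChar (h * η) - 1‖ ≤ (1 + freq η) * ρ := by
            have := chord_nonneg h
            refine (chord_mul_le h η).trans (mul_le_mul ?_ hh this (by positivity))
            linarith
          refine pow_le_pow_left₀ (by positivity) ?_ 2
          calc _ ≤ ‖d η‖ * ((1 + freq η) * ρ) := mul_le_mul_of_nonneg_left h2 (norm_nonneg _)
            _ = ‖d η‖ * (1 + freq η) * ρ := by ring
            _ ≤ _ := mul_le_mul_of_nonneg_right (hd η) hρ.le
      _ = (Finset.univ.filter fun η : ZMod N => freq η < T).card * (A * ρ) ^ 2 := by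
          rw [Finset.sum_const, nsmul_eq_mul]
      _ ≤ (2 * (1 / ρ)) * (A * ρ) ^ 2 := by
          gcongr
          have : ((Finset.univ.filter fun η : ZMod N => freq η < T).card : ℝ) ≤ 2 * T := by
            exact_mod_cast card_freq_lt_le T
          linarith
      _ = _ := by field_simp
  have hhigh : ∑ η with T ≤ freq η, ‖d η * (ZMod.stdAddChar (h * η) - 1)‖ ^ 2
      ≤ 16 * A ^ 2 * ρ := by
    calc _ ≤ ∑ η : ZMod N with T ≤ freq η, 4 * A ^ 2 * (1 / (1 + (freq η : ℝ)) ^ 2) := by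
          refine Finset.sum_le_sum fun η _ => ?_
          rw [norm_mul]
          calc _ ≤ (A / (1 + freq η) * 2) ^ 2 := by
                gcongr
                · exact hd' η
                · exact chord_le_two (h * η)
            _ = _ := by field_simp; ring
      _ = 4 * A ^ 2 * ∑ η : ZMod N with T ≤ freq η, (1 : ℝ) / (1 + freq η) ^ 2 := by
          rw [Finset.mul_sum]
      _ ≤ 4 * A ^ 2 * (4 / ((T : ℝ) + 1)) := by gcongr; exact sum_freq_ge_inv_sq_le T
      _ ≤ 4 * A ^ 2 * (4 / (1 / ρ)) := by gcongr
      _ = _ := by field_simp; ring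
  have hsplit := Finset.sum_filter_add_sum_filter_not Finset.univ (fun η : ZMod N => freq η < T)
    (fun η => ‖d η * (ZMod.stdAddChar (h * η) - 1)‖ ^ 2)
  simp only [not_lt] at hsplit
  rw [← hsplit]
  calc _ ≤ (N : ℝ) * (2 * A ^ 2 * ρ + 16 * A ^ 2 * ρ) := by gcongr
    _ = _ := by ring

theorem norm_low_freq_le {A : ℝ} (hA : 0 ≤ A) {M : ZMod N → ℂ} (hM : ∀ η, ‖M η‖ ≤ A) (T : ℕ)
    (u : ZMod N) :
    ‖∑ η with freq η < T, (M (η - 1) - M η) * ZMod.stdAddChar (u * η)‖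
      ≤ 2 * T * A * chord u + 4 * A := by
  classical
  have h1 : ∑ η with freq η < T, M (η - 1) * ZMod.stdAddChar (u * η)
      = ∑ η with freq (η + 1) < T, M η * ZMod.stdAddChar (u * (η + 1)) := by
    rw [Finset.sum_filter, Finset.sum_filter]
    exact Fintype.sum_equiv (Equiv.subRight 1) _ _ fun η => by simp
  have h2 : ∑ η with freq η < T, (M (η - 1) - M η) * ZMod.stdAddChar (u * η)
      = ∑ η with freq η < T, M η * (ZMod.stdAddChar (u * (η + 1)) - ZMod.stdAddChar (u * η))
      + ((∑ η with freq (η + 1) < T ∧ T ≤ freq η, M η * ZMod.stdAddChar (u * (η + 1)))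
        - ∑ η with freq η < T ∧ T ≤ freq (η + 1), M η * ZMod.stdAddChar (u * (η + 1))) := by
    simp only [sub_mul, mul_sub, Finset.sum_sub_distrib]
    rw [h1]
    simp only [Finset.sum_filter]
    rw [sub_add_eq_add_sub, ← add_sub_assoc, sub_left_inj, eq_sub_iff_add_eq,
      ← Finset.sum_add_distrib, ← Finset.sum_add_distrib]
    refine Finset.sum_congr rfl fun η _ => ?_
    by_cases ha : freq η < T <;> by_cases hb : freq (η + 1) < T <;> simp [ha, hb, not_lt.1, not_le.2]
  have hn : ∀ η, ‖M η * ZMod.stdAddChar (u * (η + 1))‖ ≤ A := fun η => by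
    rw [norm_mul, AddChar.norm_apply, mul_one]; exact hM η
  have h3 : ‖∑ η with freq η < T, M η * (ZMod.stdAddChar (u * (η + 1)) - ZMod.stdAddChar (u * η))‖
      ≤ 2 * T * A * chord u := by
    refine (norm_sum_le _ _).trans ?_
    calc _ ≤ ∑ η : ZMod N with freq η < T, A * chord u := by
          refine Finset.sum_le_sum fun η _ => ?_
          rw [norm_mul, mul_add_one, norm_stdAddChar_add_sub]
          have := chord_nonneg u
          gcongr; exact hM η
      _ = (Finset.univ.filter fun η : ZMod N => freq η < T).card * (A * chord u) := by
          rw [Finset.sum_const, nsmul_eq_mul]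
      _ ≤ (2 * T) * (A * chord u) := by
          have := chord_nonneg u
          gcongr
          exact_mod_cast card_freq_lt_le T
      _ = _ := by ring
  have hcard : ∀ s : Finset (ZMod N), s.card ≤ 2 →
      ‖∑ η ∈ s, M η * ZMod.stdAddChar (u * (η + 1))‖ ≤ 2 * A := by
    intro s hs
    refine (norm_sum_le _ _).trans ((Finset.sum_le_card_nsmul _ _ _ fun η _ => hn η).trans ?_)
    rw [nsmul_eq_mul]
    gcongr
    exact_mod_cast hs
  have h4 := hcard (Finset.univ.filter fun η : ZMod N => freq (η + 1) < T ∧ T ≤ freq η) (by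
    refine le_trans (Finset.card_le_card ?_) (card_freq_eq_le (N := N) T)
    intro η hη
    have := freq_le_freq_add_one η
    simp only [Finset.mem_filter, Finset.mem_univ, true_and] at hη ⊢
    omega)
  have h5 := hcard (Finset.univ.filter fun η : ZMod N => freq η < T ∧ T ≤ freq (η + 1)) (by
    refine le_trans (Finset.card_le_card ?_) (card_freq_eq_le (N := N) (T - 1))
    intro η hη
    have := freq_add_one_le η
    simp only [Finset.mem_filter, Finset.mem_univ, true_and] at hη ⊢
    omega)
  rw [h2]
  refine (norm_add_le _ _).trans ?_
  have := norm_sub_le (∑ η with freq (η + 1) < T ∧ T ≤ freq η, M η * ZMod.stdAddChar (u * (η + 1)))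
    (∑ η with freq η < T ∧ T ≤ freq (η + 1), M η * ZMod.stdAddChar (u * (η + 1)))
  linarith

theorem sum_norm_multKernel_diff_le {A : ℝ} (hA : 0 ≤ A) {M : ZMod N → ℂ} (hM : ∀ η, ‖M η‖ ≤ A)
    (hd : ∀ η, ‖M (η - 1) - M η‖ * (1 + freq η) ≤ A) {R : ℝ} (hR : 1 ≤ N * R) :
    ∑ u with chord u < R, ‖multKernel (fun η => M (η - 1) - M η) u‖ ≤ 22 * N * A * R := by
  have hN : (0 : ℝ) < N := by exact_mod_cast Nat.pos_of_ne_zero (NeZero.ne N)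
  have hR0 : 0 < R := by
    by_contra! hcon
    nlinarith
  set d : ZMod N → ℂ := fun η => M (η - 1) - M η with hd_def
  have hd' : ∀ η, ‖d η‖ ≤ A / (1 + freq η) := fun η => by
    rw [le_div_iff₀ (by positivity)]; exact hd η
  set T := ⌊1 / R⌋₊ with hT
  have hT1 : (T : ℝ) ≤ 1 / R := Nat.floor_le (by positivity)
  have hT2 : 1 / R < T + 1 := Nat.lt_floor_add_one _
  have hcard := card_chord_lt_le hR
  set H : ZMod N → ℂ := fun u => ∑ η with T ≤ freq η, d η * ZMod.stdAddChar (u * η) with hH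
  have hsplit : ∀ u, multKernel d u
      = ∑ η with freq η < T, d η * ZMod.stdAddChar (u * η) + H u := by
    intro u
    have := Finset.sum_filter_add_sum_filter_not Finset.univ (fun η : ZMod N => freq η < T)
      (fun η => d η * ZMod.stdAddChar (u * η))
    simp only [not_lt] at this
    rw [multKernel, ← this]
  have hlow : ∀ u, chord u < R → ‖∑ η with freq η < T, d η * ZMod.stdAddChar (u * η)‖ ≤ 6 * A := by
    intro u hu
    refine (norm_low_freq_le hA hM T u).trans ?_
    have : T * chord u ≤ 1 := by
      calc T * chord u ≤ 1 / R * R := by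
            have := chord_nonneg u
            gcongr
        _ = 1 := by field_simp
    nlinarith
  have hH2 : ∑ u, ‖H u‖ ^ 2 ≤ 4 * N * A ^ 2 * R := by
    have h1 : ∀ u, H u = ∑ η, (if T ≤ freq η then d η else 0) * ZMod.stdAddChar (u * η) := by
      intro u
      rw [hH]
      simp only [ite_mul, zero_mul]
      rw [Finset.sum_filter]
    simp only [h1]
    rw [parseval_zmod]
    have h2 : ∑ η : ZMod N, ‖if T ≤ freq η then d η else 0‖ ^ 2
        ≤ A ^ 2 * ∑ η : ZMod N with T ≤ freq η, (1 : ℝ) / (1 + freq η) ^ 2 := by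
      rw [Finset.mul_sum, Finset.sum_filter]
      refine Finset.sum_le_sum fun η _ => ?_
      split_ifs
      · calc ‖d η‖ ^ 2 ≤ (A / (1 + freq η)) ^ 2 := by gcongr; exact hd' η
          _ = _ := by rw [div_pow]; ring
      · simp
    calc _ ≤ (N : ℝ) * (A ^ 2 * ∑ η : ZMod N with T ≤ freq η, (1 : ℝ) / (1 + freq η) ^ 2) := by
          gcongr
      _ ≤ N * (A ^ 2 * (4 / ((T : ℝ) + 1))) := by gcongr; exact sum_freq_ge_inv_sq_le T
      _ ≤ N * (A ^ 2 * (4 / (1 / R))) := by gcongr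
      _ = _ := by field_simp
  have hH1 : ∑ u with chord u < R, ‖H u‖ ≤ 4 * N * A * R := by
    have h1 := Real.sum_mul_le_sqrt_mul_sqrt (Finset.univ.filter fun u : ZMod N => chord u < R)
      (fun _ => 1) (fun u => ‖H u‖)
    simp only [one_mul, one_pow, Finset.sum_const, nsmul_eq_mul, mul_one] at h1
    refine h1.trans ?_
    rw [← Real.sqrt_mul (by positivity)]
    apply Real.sqrt_le_iff.2
    refine ⟨by positivity, ?_⟩
    have h2 : ∑ u with chord u < R, ‖H u‖ ^ 2 ≤ 4 * N * A ^ 2 * R :=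
      (Finset.sum_le_sum_of_subset_of_nonneg (Finset.subset_univ _)
        fun _ _ _ => by positivity).trans hH2
    calc _ ≤ 3 * (N * R) * (4 * N * A ^ 2 * R) := by gcongr
      _ ≤ _ := by nlinarith [sq_nonneg (N * A * R)]
  calc ∑ u with chord u < R, ‖multKernel d u‖
      ≤ ∑ u with chord u < R, (6 * A + ‖H u‖) := by
        refine Finset.sum_le_sum fun u hu => ?_
        rw [hsplit]
        refine (norm_add_le _ _).trans ?_
        have := hlow u (Finset.mem_filter.1 hu).2
        linarith
    _ = (Finset.univ.filter fun u : ZMod N => chord u < R).card * (6 * A)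
        + ∑ u with chord u < R, ‖H u‖ := by
        rw [Finset.sum_add_distrib, Finset.sum_const, nsmul_eq_mul]
    _ ≤ 3 * (N * R) * (6 * A) + 4 * N * A * R := by gcongr
    _ = _ := by ring

theorem multKernel_hormander {A : ℝ} (hA : 0 ≤ A) {M : ZMod N → ℂ} (hM : ∀ η, ‖M η‖ ≤ A)
    (hd : ∀ η, ‖M (η - 1) - M η‖ * (1 + freq η) ≤ A) {ρ : ℝ} (hρ : 1 ≤ N * ρ) {h : ZMod N}
    (hh : chord h ≤ ρ) :
    ∑ u with 2 * ρ ≤ chord u, ‖multKernel M (u + h) - multKernel M u‖ ≤ 200 * N * A := by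
  have hN : (0 : ℝ) < N := by exact_mod_cast Nat.pos_of_ne_zero (NeZero.ne N)
  have hρ0 : 0 < ρ := by
    by_contra! hcon
    nlinarith
  have hRρ : ∀ R, ρ ≤ R → 1 ≤ N * R := fun R hR => hρ.trans (by gcongr)
  set G := multKernel (fun η => M (η - 1) - M η) with hG
  have hGK : ∀ u, (ZMod.stdAddChar u - 1) * multKernel M u = G u := multKernel_mul_sub_one M
  have hpt : ∀ u, 2 * ρ ≤ chord u → ‖multKernel M (u + h) - multKernel M u‖
      ≤ ‖G (u + h) - G u‖ * (1 / chord u)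
        + 2 * ρ * (if ρ ≤ chord (u + h) then ‖G (u + h)‖ / chord (u + h) ^ 2 else 0) := by
    intro u hu
    have h1 : chord (u + h) ≤ chord u + ρ := (chord_add_le u h).trans (by linarith)
    have h2 : chord u ≤ chord (u + h) + ρ := by
      have := chord_add_le (u + h) (-h)
      rw [add_neg_cancel_right, chord_neg] at this
      linarith
    have h3 : ρ ≤ chord (u + h) := by linarith
    have hu0 : 0 < chord u := by linarith
    have huh0 : 0 < chord (u + h) := by linarith
    have hne : ZMod.stdAddChar u - 1 ≠ 0 := norm_pos_iff.1 hu0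
    have hne' : ZMod.stdAddChar (u + h) - 1 ≠ 0 := norm_pos_iff.1 huh0
    have e : multKernel M (u + h) - multKernel M u
        = (G (u + h) - G u) / (ZMod.stdAddChar u - 1)
          - G (u + h) * (ZMod.stdAddChar (u + h) - ZMod.stdAddChar u)
            / ((ZMod.stdAddChar (u + h) - 1) * (ZMod.stdAddChar u - 1)) := by
      rw [← hGK u, ← hGK (u + h)]
      field_simp
      ring
    rw [e, if_pos h3]
    refine (norm_sub_le _ _).trans ?_
    rw [norm_div, norm_div, norm_mul, norm_mul, norm_stdAddChar_add_sub]
    change ‖G (u + h) - G u‖ / chord u + ‖G (u + h)‖ * chord h / (chord (u + h) * chord u) ≤ _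
    have h4 : ‖G (u + h)‖ * chord h / (chord (u + h) * chord u)
        ≤ 2 * ρ * (‖G (u + h)‖ / chord (u + h) ^ 2) := by
      rw [← mul_div_assoc, div_le_div_iff₀ (by positivity) (by positivity)]
      have h5 : chord (u + h) ≤ 2 * chord u := by linarith
      calc ‖G (u + h)‖ * chord h * chord (u + h) ^ 2
          = ‖G (u + h)‖ * chord h * chord (u + h) * chord (u + h) := by ring
        _ ≤ ‖G (u + h)‖ * ρ * chord (u + h) * (2 * chord u) := by gcongr
        _ = _ := by ring
    rw [div_eq_mul_one_div ‖G (u + h) - G u‖]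
    linarith
  have hfirst : ∑ u with 2 * ρ ≤ chord u, ‖G (u + h) - G u‖ * (1 / chord u) ≤ 24 * N * A := by
    refine (Real.sum_mul_le_sqrt_mul_sqrt _ _ _).trans ?_
    rw [← Real.sqrt_mul (by positivity)]
    apply Real.sqrt_le_iff.2
    refine ⟨by positivity, ?_⟩
    have h1 : ∑ u with 2 * ρ ≤ chord u, ‖G (u + h) - G u‖ ^ 2 ≤ 18 * N * A ^ 2 * ρ :=
      (Finset.sum_le_sum_of_subset_of_nonneg (Finset.subset_univ _)
        fun _ _ _ => by positivity).trans (sum_sq_multKernel_diff_le hA hd hρ0 hh)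
    have h2 : ∑ u : ZMod N with 2 * ρ ≤ chord u, (1 / chord u) ^ 2 ≤ 12 * N / ρ := by
      have h3 := sum_div_sq_chord_le (N := N) (w := fun _ => 1) (fun _ => zero_le_one)
        (c := 3 * N) hρ0 (by positivity) (fun R hR => by
          have := card_chord_lt_le (hRρ R hR)
          simp only [Finset.sum_const, nsmul_eq_mul, mul_one]
          linarith)
      calc _ ≤ ∑ u : ZMod N with ρ ≤ chord u, 1 / chord u ^ 2 := by
            simp only [one_div, inv_pow]
            refine Finset.sum_le_sum_of_subset_of_nonneg ?_ fun _ _ _ => by positivity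
            intro u hu
            simp only [Finset.mem_filter, Finset.mem_univ, true_and] at hu ⊢
            linarith
        _ ≤ _ := h3
        _ = _ := by ring
    calc _ ≤ 18 * N * A ^ 2 * ρ * (12 * N / ρ) := by gcongr
      _ = 216 * (N * A) ^ 2 := by field_simp; ring
      _ ≤ _ := by nlinarith [sq_nonneg (N * A)]
  have hsecond : ∑ u with 2 * ρ ≤ chord u,
      2 * ρ * (if ρ ≤ chord (u + h) then ‖G (u + h)‖ / chord (u + h) ^ 2 else 0)
      ≤ 176 * N * A := by
    calc _ ≤ ∑ u, 2 * ρ * (if ρ ≤ chord (u + h) then ‖G (u + h)‖ / chord (u + h) ^ 2 else 0) :=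
          Finset.sum_le_sum_of_subset_of_nonneg (Finset.subset_univ _)
            fun _ _ _ => by split_ifs <;> positivity
      _ = ∑ v, 2 * ρ * (if ρ ≤ chord v then ‖G v‖ / chord v ^ 2 else 0) :=
          Fintype.sum_equiv (Equiv.addRight h) _ _ fun u => rfl
      _ = 2 * ρ * ∑ v with ρ ≤ chord v, ‖G v‖ / chord v ^ 2 := by
          rw [← Finset.mul_sum, Finset.sum_filter]
      _ ≤ 2 * ρ * (4 * (22 * N * A) / ρ) := by
          gcongr
          exact sum_div_sq_chord_le (fun _ => norm_nonneg _) hρ0 (by positivity) fun R hR =>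
            sum_norm_multKernel_diff_le hA hM hd (hRρ R hR)
      _ = _ := by field_simp; ring
  calc _ ≤ _ := Finset.sum_le_sum fun u hu => hpt u (Finset.mem_filter.1 hu).2
    _ ≤ 200 * N * A := by rw [Finset.sum_add_distrib]; linarith

theorem sum_sq_multKernel_conv_le {A : ℝ} {M : ZMod N → ℂ} (hM : ∀ η, ‖M η‖ ≤ A)
    (f : ZMod N → ℂ) :
    ∑ u, ‖∑ v, multKernel M (u - v) / N * f v‖ ^ 2 ≤ A ^ 2 * ∑ v, ‖f v‖ ^ 2 := by
  have hN : (0 : ℝ) < N := by exact_mod_cast Nat.pos_of_ne_zero (NeZero.ne N)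
  set c : ZMod N → ℂ := fun η => (∑ v, f v * ZMod.stdAddChar (-η * v)) / N with hc
  have h1 : ∀ u, ∑ v, multKernel M (u - v) / N * f v
      = ∑ η, (M η * c η) * ZMod.stdAddChar (u * η) := by
    intro u
    simp only [multKernel, hc, Finset.sum_div, Finset.sum_mul, Finset.mul_sum]
    rw [Finset.sum_comm]
    refine Finset.sum_congr rfl fun η _ => Finset.sum_congr rfl fun v _ => ?_
    rw [show (u - v) * η = u * η + -η * v by ring, AddChar.map_add_eq_mul]
    ring
  have h2 : ∑ η, ‖c η‖ ^ 2 = (∑ v, ‖f v‖ ^ 2) / N := by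
    have h3 := parseval_zmod f
    have h4 : ∑ η, ‖c η‖ ^ 2 = (∑ η, ‖∑ v, f v * ZMod.stdAddChar (η * v)‖ ^ 2) / N ^ 2 := by
      rw [Finset.sum_div]
      refine Fintype.sum_equiv (Equiv.neg _) _ _ fun η => ?_
      simp only [hc, norm_div, Complex.norm_natCast, div_pow, Equiv.neg_apply]
    rw [h4, h3]; field_simp
  simp only [h1]
  rw [parseval_zmod]
  calc _ ≤ (N : ℝ) * ∑ η, A ^ 2 * ‖c η‖ ^ 2 := by
        gcongr with η
        rw [norm_mul, mul_pow]
        gcongr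
        exact hM η
    _ = _ := by rw [← Finset.mul_sum, h2]; field_simp

end Kernel

theorem card_dyadic_block {n k : ℕ} (hk : k ≤ n) (x : ZMod (2 ^ n)) :
    (Finset.univ.filter fun y : ZMod (2 ^ n) => y.val / 2 ^ k = x.val / 2 ^ k).card = 2 ^ k := by
  set q := x.val / 2 ^ k with hq
  have hpos : 0 < 2 ^ k := by positivity
  have hlt : q * 2 ^ k + 2 ^ k ≤ 2 ^ n := by
    have h1 : 2 ^ n = 2 ^ (n - k) * 2 ^ k := by rw [← pow_add]; congr 1; omega
    have h2 : q < 2 ^ (n - k) := by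
      rw [hq, Nat.div_lt_iff_lt_mul hpos, ← h1]
      exact ZMod.val_lt x
    rw [h1, ← Nat.succ_mul]
    exact Nat.mul_le_mul_right _ h2
  have h3 : (Finset.Ico (q * 2 ^ k) (q * 2 ^ k + 2 ^ k)).card = 2 ^ k := by simp
  have hdiv : ∀ m, m / 2 ^ k = q ↔ q * 2 ^ k ≤ m ∧ m < q * 2 ^ k + 2 ^ k := fun m => by
    rw [Nat.div_eq_iff hpos]; omega
  refine Eq.trans ?_ h3
  refine Finset.card_nbij' (fun y => y.val) (fun m => (m : ZMod (2 ^ n))) ?_ ?_ ?_ ?_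
  · intro y hy
    simpa [hdiv] using hy
  · intro m hm
    have hm' := Finset.mem_Ico.1 (Finset.mem_coe.1 hm)
    simp only [Finset.coe_filter, Finset.mem_univ, true_and, Set.mem_ofPred_eq]
    rw [ZMod.val_natCast_of_lt (by omega), hdiv]
    exact hm'
  · intro y _
    simp
  · intro m hm
    have hm' := Finset.mem_Ico.1 (Finset.mem_coe.1 hm)
    exact ZMod.val_natCast_of_lt (by omega)

theorem chord_sub_le_of_block {n k : ℕ} {i j : ℕ} (hij : i / 2 ^ k = j / 2 ^ k) :
    chord ((i : ZMod (2 ^ n)) - (j : ZMod (2 ^ n))) ≤ 2 * π * 2 ^ k / (2 ^ n : ℕ) := by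
  have h1 : (i : ZMod (2 ^ n)) - (j : ZMod (2 ^ n)) = (((i : ℤ) - j : ℤ) : ZMod (2 ^ n)) := by push_cast; ring
  rw [h1]
  refine (chord_intCast_le _).trans ?_
  have h2 : |(i : ℤ) - j| ≤ 2 ^ k := by
    have e1 := Nat.div_add_mod i (2 ^ k)
    have e2 := Nat.div_add_mod j (2 ^ k)
    have l1 := Nat.mod_lt i (show 2 ^ k > 0 by positivity)
    have l2 := Nat.mod_lt j (show 2 ^ k > 0 by positivity)
    rw [hij] at e1
    zify at e1 e2 l1 l2
    rw [abs_le]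
    have n1 : (0 : ℤ) ≤ (i : ℤ) % 2 ^ k := Int.emod_nonneg _ (by positivity)
    have n2 : (0 : ℤ) ≤ (j : ℤ) % 2 ^ k := Int.emod_nonneg _ (by positivity)
    constructor <;> linarith
  have h3 : |(((i : ℤ) - j : ℤ) : ℝ)| ≤ 2 ^ k := by exact_mod_cast h2
  gcongr

theorem multKernel_weak_type {A : ℝ} (hA : 0 ≤ A) {n : ℕ} {M : ZMod (2 ^ n) → ℂ}
    (hM : ∀ η, ‖M η‖ ≤ A) (hd : ∀ η, ‖M (η - 1) - M η‖ * (1 + freq η) ≤ A)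
    (f : ZMod (2 ^ n) → ℂ) (t : ℝ) (ht : 0 < t) :
    t * (Finset.univ.filter fun u =>
        t < ‖∑ v, multKernel M (u - v) / (2 ^ n : ℕ) * f v‖).card
      ≤ (10 * (200 * A + A ^ 2) + 18 * π + 1) * ∑ v, ‖f v‖ := by
  have hπ := Real.pi_gt_three
  have hN : (0 : ℝ) < (2 ^ n : ℕ) := by positivity
  set ρ : ℕ → ℝ := fun k => 2 * π * 2 ^ k / (2 ^ n : ℕ) with hρ
  have hNρ : ∀ k, (2 ^ n : ℕ) * ρ k = 2 * π * 2 ^ k := fun k => by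
    simp only [hρ]; field_simp
  have hone : ∀ k : ℕ, (1 : ℝ) ≤ 2 ^ k := fun k => one_le_pow₀ (by norm_num)
  refine weak_type_of_dyadic n (fun k x => x.val / 2 ^ k) ?_ ?_ ?_ ?_
    (fun u v => multKernel M (u - v) / (2 ^ n : ℕ))
    (fun k q => Finset.univ.filter fun z => chord (z - ((q * 2 ^ k : ℕ) : ZMod (2 ^ n))) < 3 * ρ k)
    (18 * π) (200 * A + A ^ 2) (by positivity) (by positivity) ?_ ?_ ?_ f t ht
  · intro x y hxy
    exact ZMod.val_injective _ (by simpa using hxy)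
  · intro k x y hxy
    simp only [pow_succ, ← Nat.div_div_eq_div_mul] at hxy ⊢
    rw [hxy]
  · intro x y
    simp only [Nat.div_eq_of_lt (ZMod.val_lt _)]
  · intro k hk x
    rw [card_dyadic_block (by omega), card_dyadic_block (by omega)]
    rw [pow_succ]; omega
  · intro k hk x
    rw [card_dyadic_block hk]
    have h1 : (Finset.univ.filter fun z : ZMod (2 ^ n) =>
        chord (z - ((x.val / 2 ^ k * 2 ^ k : ℕ) : ZMod (2 ^ n))) < 3 * ρ k).card
        = (Finset.univ.filter fun z : ZMod (2 ^ n) => chord z < 3 * ρ k).card := by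
      refine Finset.card_equiv (Equiv.subRight ((x.val / 2 ^ k * 2 ^ k : ℕ) : ZMod (2 ^ n))) ?_
      intro z; simp
    rw [h1]
    have h2 := card_chord_lt_le (N := 2 ^ n) (R := 3 * ρ k) (by
      have := hNρ k
      nlinarith [hone k])
    refine h2.trans (le_of_eq ?_)
    push_cast
    have := hNρ k
    push_cast at this
    linear_combination 9 * this
  · intro f
    refine (sum_sq_multKernel_conv_le hM f).trans ?_
    gcongr
    linarith
  · intro k hk y y' hyy
    have hch : chord (y - y') ≤ ρ k := by
      have := chord_sub_le_of_block (n := n) hyy.symm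
      simpa [hρ] using this
    have hz : chord (y - ((y.val / 2 ^ k * 2 ^ k : ℕ) : ZMod (2 ^ n))) ≤ ρ k := by
      have := chord_sub_le_of_block (n := n) (k := k) (i := y.val) (j := y.val / 2 ^ k * 2 ^ k)
        (by rw [Nat.mul_div_cancel _ (by positivity)])
      simpa [hρ] using this
    have hH := multKernel_hormander hA hM hd (ρ := ρ k) (h := y - y') (by
      rw [hNρ]; nlinarith [hone k]) hch
    calc _ ≤ ∑ x with 2 * ρ k ≤ chord (x - y),
          ‖multKernel M (x - y) / (2 ^ n : ℕ) - multKernel M (x - y') / (2 ^ n : ℕ)‖ := by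
          refine Finset.sum_le_sum_of_subset_of_nonneg ?_ fun _ _ _ => norm_nonneg _
          intro x hx
          simp only [Finset.mem_filter, Finset.mem_univ, true_and, not_lt] at hx ⊢
          have := chord_add_le (x - y) (y - ((y.val / 2 ^ k * 2 ^ k : ℕ) : ZMod (2 ^ n)))
          rw [sub_add_sub_cancel] at this
          linarith
      _ = ∑ u with 2 * ρ k ≤ chord u,
          ‖multKernel M (u + (y - y')) - multKernel M u‖ / (2 ^ n : ℕ) := by
          rw [Finset.sum_filter, Finset.sum_filter]
          refine Fintype.sum_equiv (Equiv.subRight y) _ _ fun x => ?_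
          simp only [Equiv.subRight_apply, sub_add_sub_cancel]
          rw [← sub_div, norm_div, Complex.norm_natCast, norm_sub_rev]
      _ ≤ 200 * (2 ^ n : ℕ) * A / (2 ^ n : ℕ) := by
          rw [← Finset.sum_div]
          gcongr
      _ = 200 * A := by field_simp
      _ ≤ _ := by nlinarith [sq_nonneg A]

theorem multKernel_strong_type_of_lt_two {A p : ℝ} (hA : 0 ≤ A) (hp : 1 < p) (hp2 : p < 2) :
    ∃ C, 0 ≤ C ∧ ∀ (n : ℕ) (M : ZMod (2 ^ n) → ℂ), (∀ η, ‖M η‖ ≤ A) →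
      (∀ η, ‖M (η - 1) - M η‖ * (1 + freq η) ≤ A) → ∀ f : ZMod (2 ^ n) → ℂ,
      ∑ u, ‖∑ v, multKernel M (u - v) / (2 ^ n : ℕ) * f v‖ ^ p ≤ C * ∑ v, ‖f v‖ ^ p := by
  refine ⟨2 ^ p * p * ((10 * (200 * A + A ^ 2) + 18 * π + 1) / (p - 1) + A ^ 2 / (2 - p)), ?_,
    fun n M hM hd f => ?_⟩
  · have h1 : 0 < p - 1 := by linarith
    have h2 : 0 < 2 - p := by linarith
    positivity
  · exact strong_type_of_weak_type hp hp2
      (T := fun f u => ∑ v, multKernel M (u - v) / (2 ^ n : ℕ) * f v)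
      (fun f g => by
        funext u
        simp only [Pi.add_apply, mul_add, Finset.sum_add_distrib])
      (fun f t ht => multKernel_weak_type hA hM hd f t ht)
      (fun f => sum_sq_multKernel_conv_le hM f) f

theorem multKernel_neg {N : ℕ} [NeZero N] (M : ZMod N → ℂ) (u : ZMod N) :
    multKernel M (-u) = multKernel (fun η => M (-η)) u := by
  simp only [multKernel]
  refine Fintype.sum_equiv (Equiv.neg _) _ _ fun η => ?_
  simp

theorem multKernel_strong_type {A p : ℝ} (hA : 0 ≤ A) (hp : 1 < p) :
    ∃ C, 0 ≤ C ∧ ∀ (n : ℕ) (M : ZMod (2 ^ n) → ℂ), (∀ η, ‖M η‖ ≤ A) →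
      (∀ η, ‖M (η - 1) - M η‖ * (1 + freq η) ≤ A) → ∀ f : ZMod (2 ^ n) → ℂ,
      ∑ u, ‖∑ v, multKernel M (u - v) / (2 ^ n : ℕ) * f v‖ ^ p ≤ C * ∑ v, ‖f v‖ ^ p := by
  rcases lt_trichotomy p 2 with h | rfl | h
  · exact multKernel_strong_type_of_lt_two hA hp h
  · refine ⟨A ^ 2, by positivity, fun n M hM _ f => ?_⟩
    have := sum_sq_multKernel_conv_le hM f
    simp only [Real.rpow_two]
    exact this
  · set q := p.conjExponent with hq
    have hpq : p.HolderConjugate q := Real.HolderConjugate.conjExponent hp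
    have hq2 : q < 2 := by
      rw [hq, Real.conjExponent, div_lt_iff₀ (by linarith)]; linarith
    obtain ⟨C, hC, h⟩ := multKernel_strong_type_of_lt_two (A := 2 * A) (by positivity)
      hpq.symm.lt hq2
    refine ⟨C ^ (p - 1), by positivity, fun n M hM hd f => ?_⟩
    refine lp_bound_of_transpose hpq (fun u v => multKernel M (u - v) / (2 ^ n : ℕ)) hC
      (fun g => ?_) f
    have := h n (fun η => M (-η)) (fun η => (hM _).trans (by linarith)) (fun η => ?_) g
    · simpa only [← multKernel_neg, neg_sub] using this
    · have h1 := hd (1 - η)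
      have h2 : freq η ≤ freq (1 - η) + 1 := by
        have := freq_le_freq_add_one (-η)
        rw [freq_neg] at this
        rwa [show (1 : ZMod (2 ^ n)) - η = -η + 1 by ring]
      have h3 : (freq η : ℝ) ≤ freq (1 - η) + 1 := by exact_mod_cast h2
      have h4 : ‖M (-(η - 1)) - M (-η)‖ = ‖M (1 - η - 1) - M (1 - η)‖ := by
        rw [norm_sub_rev]; congr 2 <;> ring_nf
      rw [h4]
      have h5 : (0 : ℝ) ≤ freq (1 - η) := Nat.cast_nonneg _
      calc _ ≤ ‖M (1 - η - 1) - M (1 - η)‖ * (2 * (1 + freq (1 - η))) := by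
            gcongr; linarith
        _ ≤ _ := by linarith

/-- Discrete Marcinkiewicz–Hörmander multiplier theorem on `ℤ/2ⁿ`, uniformly in `n`. -/
theorem sum_multiplier_rpow_le {A p : ℝ} (hA : 0 ≤ A) (hp : 1 < p) :
    ∃ C, 0 ≤ C ∧ ∀ (n : ℕ) (M : ZMod (2 ^ n) → ℂ), (∀ η, ‖M η‖ ≤ A) →
      (∀ η, ‖M (η - 1) - M η‖ * (1 + freq η) ≤ A) → ∀ f : ZMod (2 ^ n) → ℂ,
      ∑ u : ZMod (2 ^ n), ‖∑ η : ZMod (2 ^ n), ZMod.stdAddChar (u * η) * M η *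
        ((∑ v, ZMod.stdAddChar (-(v * η)) * f v) / (2 ^ n : ℕ))‖ ^ p ≤ C * ∑ v, ‖f v‖ ^ p := by
  obtain ⟨C, hC, h⟩ := multKernel_strong_type hA hp
  refine ⟨C, hC, fun n M hM hd f => ?_⟩
  refine le_trans (le_of_eq ?_) (h n M hM hd f)
  refine Finset.sum_congr rfl fun u _ => ?_
  congr 2
  symm
  simp only [multKernel, Finset.sum_div, Finset.sum_mul, Finset.mul_sum]
  rw [Finset.sum_comm]
  refine Finset.sum_congr rfl fun η _ => Finset.sum_congr rfl fun v _ => ?_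
  rw [show (u - v) * η = u * η + -(v * η) by ring, AddChar.map_add_eq_mul]
  ring

/-- The character `e^{2πixξ}` in one scalar variable. -/
def circleChar (x : ℝ) (ξ : ℤ) : ℂ := Complex.exp (2 * π * Complex.I * (x * ξ))

theorem norm_circleChar (x : ℝ) (ξ : ℤ) : ‖circleChar x ξ‖ = 1 := by
  have : (2 * π * Complex.I * (x * ξ) : ℂ) = ((2 * π * (x * ξ) : ℝ) : ℂ) * Complex.I := by
    push_cast; ring
  rw [circleChar, this, Complex.norm_exp_ofReal_mul_I]

@[fun_prop]
theorem continuous_circleChar (ξ : ℤ) : Continuous fun x => circleChar x ξ := by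
  unfold circleChar
  fun_prop

theorem rpow_add_le_two_rpow_mul {p s r : ℝ} (hp : 1 ≤ p) (hs : 0 ≤ s) (hr : 0 ≤ r) :
    (s + r) ^ p ≤ 2 ^ (p - 1) * (s ^ p + r ^ p) := by
  lift s to NNReal using hs
  lift r to NNReal using hr
  exact_mod_cast NNReal.rpow_add_le_mul_rpow_add_rpow s r hp

section Grid

variable {N : ℕ} [NeZero N]

theorem sum_zmod_val {E : Type*} [AddCommMonoid E] (F : ℕ → E) :
    ∑ u : ZMod N, F u.val = ∑ i ∈ Finset.range N, F i := by
  refine Finset.sum_nbij' (fun u => u.val) (fun i => (i : ZMod N)) ?_ ?_ ?_ ?_ ?_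
  · intro u _; exact Finset.mem_range.2 (ZMod.val_lt u)
  · intro i _; exact Finset.mem_univ _
  · intro u _; simp
  · intro i hi; exact ZMod.val_natCast_of_lt (Finset.mem_range.1 hi)
  · intro u _; rfl

theorem valMinAbs_intCast {ξ : ℤ} (h : |ξ| * 2 < N) : (ξ : ZMod N).valMinAbs = ξ := by
  rw [ZMod.valMinAbs_spec]
  have := abs_lt.1 (show |ξ * 2| < N by rwa [abs_mul, abs_two])
  exact ⟨rfl, this.1, this.2.le⟩

theorem sum_zmod_valMinAbs {E : Type*} [AddCommMonoid E] {K : ℤ} (hK : 2 * K ≤ N) {F : ℤ → E}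
    (hF : ∀ ξ, K ≤ |ξ| → F ξ = 0) :
    ∑ η : ZMod N, F η.valMinAbs = ∑ ξ ∈ Finset.Ioo (-K) K, F ξ := by
  classical
  rw [← Finset.sum_filter_of_ne (p := fun η : ZMod N => |η.valMinAbs| < K)
    fun η _ h => by
      by_contra! hcon
      exact h (hF _ hcon)]
  refine Finset.sum_nbij' (fun u => u.valMinAbs) (fun i => (i : ZMod N)) ?_ ?_ ?_ ?_ ?_
  · intro u hu
    rw [Finset.mem_Ioo, ← abs_lt]
    exact (Finset.mem_filter.1 hu).2
  · intro i hi
    rw [Finset.mem_Ioo, ← abs_lt] at hi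
    rw [Finset.mem_filter, valMinAbs_intCast (by linarith)]
    exact ⟨Finset.mem_univ _, hi⟩
  · intro u _; simp
  · intro i hi
    rw [Finset.mem_Ioo, ← abs_lt] at hi
    exact valMinAbs_intCast (by linarith)
  · intro u _; rfl

theorem stdAddChar_mul_eq_circleChar (u : ZMod N) (ξ : ℤ) :
    ZMod.stdAddChar (u * (ξ : ZMod N)) = circleChar (u.val / N) ξ := by
  have : u * (ξ : ZMod N) = ((u.val * ξ : ℤ) : ZMod N) := by simp
  rw [this, ZMod.stdAddChar_coe, circleChar]
  congr 1
  push_cast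
  ring

end Grid

/-- The discrete Fourier coefficient of `f` sampled on the grid `{i / N}`. -/
def gridCoeff (N : ℕ) (f : ℝ → ℂ) (ξ : ℤ) : ℂ :=
  (∑ i ∈ Finset.range N, circleChar (i / N) (-ξ) * f (i / N)) / N

theorem sum_grid_multiplier_rpow_le {A p : ℝ} (hA : 0 ≤ A) (hp : 1 < p) :
    ∃ C, 0 ≤ C ∧ ∀ (K : ℤ) (m : ℤ → ℂ), (∀ ξ, ‖m ξ‖ ≤ A) →
      (∀ ξ : ℤ, ‖m (ξ + 1) - m ξ‖ * (1 + |(ξ : ℝ)|) ≤ A) → (∀ ξ, K ≤ |ξ| → m ξ = 0) →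
      ∀ n : ℕ, 2 * K + 4 ≤ (2 ^ n : ℕ) → ∀ f : ℝ → ℂ,
      ∑ i ∈ Finset.range (2 ^ n), ‖∑ ξ ∈ Finset.Ioo (-K) K, circleChar (i / (2 ^ n : ℕ)) ξ * m ξ *
        gridCoeff (2 ^ n) f ξ‖ ^ p ≤ C * ∑ i ∈ Finset.range (2 ^ n), ‖f (i / (2 ^ n : ℕ))‖ ^ p := by
  obtain ⟨C, hC, h⟩ := sum_multiplier_rpow_le (A := 2 * A) (by positivity) hp
  refine ⟨C, hC, fun K m hm hd hsupp n hn f => ?_⟩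
  have h1 := h n (fun η => m η.valMinAbs) (fun η => (hm _).trans (by linarith)) (fun η => ?_)
    (fun u => f (u.val / (2 ^ n : ℕ)))
  · have e1 := sum_zmod_val (N := 2 ^ n) (fun i => ‖f (i / (2 ^ n : ℕ))‖ ^ p)
    have e2 := sum_zmod_val (N := 2 ^ n) (fun i => ‖∑ ξ ∈ Finset.Ioo (-K) K,
      circleChar (i / (2 ^ n : ℕ)) ξ * m ξ * gridCoeff (2 ^ n) f ξ‖ ^ p)
    rw [← e1, ← e2]
    refine le_trans (le_of_eq (Finset.sum_congr rfl fun u _ => ?_)) h1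
    congr 2
    rw [← sum_zmod_valMinAbs (N := 2 ^ n) (by linarith) fun ξ hξ => by simp [hsupp ξ hξ]]
    refine Finset.sum_congr rfl fun η _ => ?_
    rw [← stdAddChar_mul_eq_circleChar, ZMod.coe_valMinAbs, gridCoeff, ← sum_zmod_val]
    congr 2
    refine Finset.sum_congr rfl fun v _ => ?_
    rw [← stdAddChar_mul_eq_circleChar]
    push_cast
    rw [mul_neg]
  · set ξ := η.valMinAbs with hξ
    have hfreq : (freq η : ℝ) = |(ξ : ℝ)| := by
      rw [freq, Nat.cast_natAbs, Int.cast_abs]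
    rw [hfreq]
    have hη : η = (ξ : ZMod (2 ^ n)) := (ZMod.coe_valMinAbs η).symm
    by_cases h0 : |ξ| ≤ K
    · have h2 : |ξ - 1| ≤ K + 1 := (abs_sub _ _).trans (by simpa using h0)
      have h3 : (η - 1).valMinAbs = ξ - 1 := by
        rw [← valMinAbs_intCast (N := 2 ^ n) (ξ := ξ - 1) (by linarith), hη]
        push_cast
        rfl
      rw [h3]
      have h4 := hd (ξ - 1)
      rw [sub_add_cancel, norm_sub_rev] at h4
      have h5 : |(ξ : ℝ)| ≤ |((ξ - 1 : ℤ) : ℝ)| + 1 := by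
        have := abs_add_le ((ξ : ℝ) - 1) 1
        rw [sub_add_cancel, abs_one] at this
        push_cast
        exact this
      have h6 := abs_nonneg ((ξ - 1 : ℤ) : ℝ)
      calc _ ≤ ‖m (ξ - 1) - m ξ‖ * (2 * (1 + |((ξ - 1 : ℤ) : ℝ)|)) := by
            gcongr; linarith
        _ ≤ _ := by linarith
    · push Not at h0
      have h2 : m (η - 1).valMinAbs = 0 := by
        refine hsupp _ ?_
        by_contra! hcon
        set ζ := (η - 1).valMinAbs with hζ
        have h3 : |ζ + 1| ≤ K := (abs_add_le _ _).trans (by simpa using hcon)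
        have h4 := valMinAbs_intCast (N := 2 ^ n) (ξ := ζ + 1) (by linarith)
        have h5 : ((ζ + 1 : ℤ) : ZMod (2 ^ n)) = η := by
          rw [Int.cast_add, hζ, ZMod.coe_valMinAbs]; simp
        rw [h5, ← hξ] at h4
        rw [h4] at h0
        linarith
      rw [h2, hsupp _ h0.le]
      simp only [sub_zero, norm_zero, zero_mul]
      positivity

theorem tendsto_riemann_sum {E : Type*} [NormedAddCommGroup E] [NormedSpace ℝ E] [CompleteSpace E]
    {G : ℝ → E} (hG : Continuous G) :
    Filter.Tendsto (fun N : ℕ => (N : ℝ)⁻¹ • ∑ i ∈ Finset.range N, G (i / N)) Filter.atTop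
      (nhds (∫ x in (0 : ℝ)..1, G x)) := by
  have hu : UniformContinuousOn G (Set.Icc 0 1) :=
    isCompact_Icc.uniformContinuousOn_of_continuous hG.continuousOn
  rw [Metric.uniformContinuousOn_iff] at hu
  rw [Metric.tendsto_atTop]
  intro ε hε
  obtain ⟨δ, hδ, h⟩ := hu (ε / 2) (by positivity)
  obtain ⟨N₀, hN₀⟩ := exists_nat_gt (1 / δ)
  refine ⟨N₀ + 1, fun N hN => ?_⟩
  have hNpos : (0 : ℝ) < N := by exact_mod_cast (by omega : 0 < N)
  have hNδ : 1 / (N : ℝ) < δ := by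
    have : (N₀ : ℝ) + 1 ≤ N := by exact_mod_cast hN
    rw [div_lt_iff₀ hNpos]
    rw [div_lt_iff₀ hδ] at hN₀
    nlinarith
  have hInt : ∀ a b, IntervalIntegrable G volume a b := fun a b => hG.intervalIntegrable a b
  have hadj := intervalIntegral.sum_integral_adjacent_intervals (f := G) (μ := volume)
    (a := fun i : ℕ => (i : ℝ) / N) (n := N) fun k _ => hInt _ _
  simp only [Nat.cast_zero, zero_div, div_self hNpos.ne'] at hadj
  rw [← hadj, Finset.smul_sum, dist_eq_norm, ← Finset.sum_sub_distrib]
  have hlen : ∀ i : ℕ, ((i + 1 : ℕ) : ℝ) / N - i / N = (N : ℝ)⁻¹ := fun i => by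
    push_cast; field_simp; ring
  have hterm : ∀ i ∈ Finset.range N, ‖(N : ℝ)⁻¹ • G (i / N)
      - ∫ x in (i / N : ℝ)..((i + 1 : ℕ) / N : ℝ), G x‖ ≤ ε / 2 * (N : ℝ)⁻¹ := by
    intro i hi
    have hiN : (i : ℝ) + 1 ≤ N := by exact_mod_cast Finset.mem_range.1 hi
    have h1 : (N : ℝ)⁻¹ • G (i / N) = ∫ x in (i / N : ℝ)..((i + 1 : ℕ) / N : ℝ), G (i / N) := by
      rw [intervalIntegral.integral_const, hlen]
    have hle : (i / N : ℝ) ≤ ((i + 1 : ℕ) / N : ℝ) := by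
      push_cast; gcongr; linarith
    rw [h1, ← intervalIntegral.integral_sub (by simp) (hInt _ _)]
    refine (intervalIntegral.norm_integral_le_of_norm_le_const (C := ε / 2) fun x hx => ?_).trans
      (le_of_eq ?_)
    · rw [Set.uIoc_of_le hle] at hx
      have hi0 : (0 : ℝ) ≤ i / N := by positivity
      have hi1 : ((i + 1 : ℕ) / N : ℝ) ≤ 1 := by
        rw [div_le_one hNpos]; push_cast; exact hiN
      rw [← dist_eq_norm]
      refine (h _ ⟨hi0, by linarith⟩ x ⟨by linarith [hx.1], by linarith [hx.2]⟩ ?_).le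
      rw [Real.dist_eq, abs_sub_comm, abs_of_nonneg (by linarith [hx.1])]
      have := hlen i
      rw [inv_eq_one_div] at this
      linarith [hx.2]
    · rw [hlen, abs_of_pos (by positivity)]
  refine (norm_sum_le_of_le _ hterm).trans_lt ?_
  rw [Finset.sum_const, Finset.card_range, nsmul_eq_mul]
  field_simp
  linarith

/-- The Fourier coefficient on the circle, in one scalar variable. -/
def circleCoeff (f : ℝ → ℂ) (ξ : ℤ) : ℂ := ∫ x in (0 : ℝ)..1, circleChar x (-ξ) * f x

theorem tendsto_gridCoeff {f : ℝ → ℂ} (hf : Continuous f) (ξ : ℤ) :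
    Filter.Tendsto (fun N => gridCoeff N f ξ) Filter.atTop (nhds (circleCoeff f ξ)) := by
  refine (tendsto_riemann_sum (G := fun x => circleChar x (-ξ) * f x)
    (by fun_prop)).congr fun N => ?_
  rw [gridCoeff, Complex.real_smul, div_eq_inv_mul]
  push_cast
  rfl

theorem integral_multiplier_rpow_le {A p : ℝ} (hA : 0 ≤ A) (hp : 1 < p) :
    ∃ C, 0 ≤ C ∧ ∀ (K : ℤ) (m : ℤ → ℂ), (∀ ξ, ‖m ξ‖ ≤ A) →
      (∀ ξ : ℤ, ‖m (ξ + 1) - m ξ‖ * (1 + |(ξ : ℝ)|) ≤ A) → (∀ ξ, K ≤ |ξ| → m ξ = 0) →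
      ∀ f : ℝ → ℂ, Continuous f →
      ∫ x in (0 : ℝ)..1, ‖∑ ξ ∈ Finset.Ioo (-K) K, circleChar x ξ * m ξ * circleCoeff f ξ‖ ^ p
        ≤ C * ∫ x in (0 : ℝ)..1, ‖f x‖ ^ p := by
  obtain ⟨C, hC, h⟩ := sum_grid_multiplier_rpow_le hA hp
  have hp0 : 0 < p := by linarith
  refine ⟨2 ^ (p - 1) * C, by positivity, fun K m hm hd hsupp f hf => ?_⟩
  set F : (ℤ → ℂ) → ℝ → ℂ := fun c x => ∑ ξ ∈ Finset.Ioo (-K) K, circleChar x ξ * m ξ * c ξ with hF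
  have hpow : Filter.Tendsto (fun n : ℕ => 2 ^ n) Filter.atTop Filter.atTop :=
    tendsto_pow_atTop_atTop_of_one_lt one_lt_two
  set δ : ℕ → ℝ := fun n => ∑ ξ ∈ Finset.Ioo (-K) K,
    ‖m ξ‖ * ‖gridCoeff (2 ^ n) f ξ - circleCoeff f ξ‖ with hδ
  have hδ0 : ∀ n, 0 ≤ δ n := fun n => Finset.sum_nonneg fun _ _ => by positivity
  have hδt : Filter.Tendsto δ Filter.atTop (nhds 0) := by
    have h1 : Filter.Tendsto δ Filter.atTop
        (nhds (∑ ξ ∈ Finset.Ioo (-K) K, ‖m ξ‖ * ‖circleCoeff f ξ - circleCoeff f ξ‖)) :=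
      tendsto_finsetSum _ fun ξ _ =>
        ((((tendsto_gridCoeff hf ξ).comp hpow).sub_const _).norm).const_mul _
    simpa using h1
  have hFδ : ∀ n x, ‖F (circleCoeff f) x‖ ≤ ‖F (gridCoeff (2 ^ n) f) x‖ + δ n := by
    intro n x
    have h1 : ‖F (gridCoeff (2 ^ n) f) x - F (circleCoeff f) x‖ ≤ δ n := by
      simp only [hF, hδ, ← Finset.sum_sub_distrib, ← mul_sub]
      refine norm_sum_le_of_le _ fun ξ _ => ?_
      rw [norm_mul, norm_mul, norm_circleChar, one_mul]
    have := norm_sub_norm_le (F (circleCoeff f) x) (F (gridCoeff (2 ^ n) f) x)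
    rw [norm_sub_rev] at this
    linarith
  have hFc : Continuous fun x => ‖F (circleCoeff f) x‖ ^ p := by
    refine Continuous.rpow_const ?_ fun _ => Or.inr hp0.le
    simp only [hF]
    fun_prop
  have hfc : Continuous fun x => ‖f x‖ ^ p :=
    Continuous.rpow_const (by fun_prop) fun _ => Or.inr hp0.le
  have hlim : Filter.Tendsto (fun n => 2 ^ (p - 1) * (C * (((2 ^ n : ℕ) : ℝ)⁻¹ •
      ∑ i ∈ Finset.range (2 ^ n), ‖f (i / (2 ^ n : ℕ))‖ ^ p) + δ n ^ p)) Filter.atTop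
      (nhds (2 ^ (p - 1) * (C * (∫ x in (0 : ℝ)..1, ‖f x‖ ^ p) + 0 ^ p))) :=
    ((((tendsto_riemann_sum hfc).comp hpow).const_mul C).add
      (hδt.rpow_const (Or.inr hp0.le))).const_mul _
  rw [Real.zero_rpow hp0.ne', add_zero, ← mul_assoc] at hlim
  refine le_of_tendsto_of_tendsto ((tendsto_riemann_sum hFc).comp hpow) hlim ?_
  obtain ⟨n₀, hn₀⟩ := Filter.eventually_atTop.1
    (hpow.eventually (Filter.eventually_ge_atTop (2 * K + 4).toNat))
  filter_upwards [Filter.eventually_ge_atTop n₀] with n hn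
  have h1 := h K m hm hd hsupp n (by have := hn₀ n hn; omega) f
  simp only [Function.comp_apply, smul_eq_mul]
  have hpos : (0 : ℝ) < (2 ^ n : ℕ) := by positivity
  rw [inv_mul_le_iff₀ hpos]
  calc ∑ i ∈ Finset.range (2 ^ n), ‖F (circleCoeff f) (i / (2 ^ n : ℕ))‖ ^ p
      ≤ ∑ i ∈ Finset.range (2 ^ n), 2 ^ (p - 1) *
        (‖F (gridCoeff (2 ^ n) f) (i / (2 ^ n : ℕ))‖ ^ p + δ n ^ p) := by
        refine Finset.sum_le_sum fun i _ => ?_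
        exact (Real.rpow_le_rpow (norm_nonneg _) (hFδ n _) hp0.le).trans
          (rpow_add_le_two_rpow_mul hp.le (norm_nonneg _) (hδ0 n))
    _ = 2 ^ (p - 1) * (∑ i ∈ Finset.range (2 ^ n),
        ‖F (gridCoeff (2 ^ n) f) (i / (2 ^ n : ℕ))‖ ^ p + (2 ^ n : ℕ) * δ n ^ p) := by
        rw [← Finset.mul_sum, Finset.sum_add_distrib, Finset.sum_const, Finset.card_range,
          nsmul_eq_mul]
    _ ≤ 2 ^ (p - 1) * (C * ∑ i ∈ Finset.range (2 ^ n), ‖f (i / (2 ^ n : ℕ))‖ ^ p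
        + (2 ^ n : ℕ) * δ n ^ p) := by gcongr
    _ = _ := by field_simp

/-- The Fejér weight `max(0, 1 - |ξ| / K)`. -/
def fejer (K : ℕ) (ξ : ℤ) : ℝ := max 0 (1 - |(ξ : ℝ)| / K)

theorem fejer_nonneg (K : ℕ) (ξ : ℤ) : 0 ≤ fejer K ξ := le_max_left _ _

theorem fejer_le_one (K : ℕ) (ξ : ℤ) : fejer K ξ ≤ 1 :=
  max_le zero_le_one (by linarith [show 0 ≤ |(ξ : ℝ)| / K by positivity])

theorem fejer_eq_zero {K : ℕ} (hK : 0 < K) {ξ : ℤ} (h : (K : ℤ) ≤ |ξ|) : fejer K ξ = 0 := by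
  have h1 : (K : ℝ) ≤ |(ξ : ℝ)| := by exact_mod_cast h
  have h2 : (0 : ℝ) < K := by exact_mod_cast hK
  refine max_eq_left ?_
  rw [sub_nonpos, one_le_div h2]
  exact h1

theorem abs_fejer_sub_mul_le {K : ℕ} (hK : 0 < K) (ξ : ℤ) :
    |fejer K (ξ + 1) - fejer K ξ| * (1 + |(ξ : ℝ)|) ≤ 2 := by
  have h2 : (1 : ℝ) ≤ K := by exact_mod_cast hK
  by_cases h : |ξ| ≤ K
  · have h1 : |(ξ : ℝ)| ≤ K := by exact_mod_cast h
    have h3 : |fejer K (ξ + 1) - fejer K ξ| ≤ 1 / K := by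
      refine (abs_max_sub_max_le_max _ _ _ _).trans (max_le (by simp) ?_)
      rw [show 1 - |((ξ + 1 : ℤ) : ℝ)| / K - (1 - |(ξ : ℝ)| / K)
        = (|(ξ : ℝ)| - |((ξ + 1 : ℤ) : ℝ)|) / K by ring, abs_div, Nat.abs_cast]
      gcongr
      refine (abs_abs_sub_abs_le _ _).trans ?_
      push_cast
      simp
    calc _ ≤ 1 / (K : ℝ) * (1 + K) := by gcongr
      _ ≤ 2 := by
        rw [one_div, inv_mul_le_iff₀ (by linarith)]; linarith
  · push Not at h
    have h1 : (K : ℤ) ≤ |ξ + 1| := by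
      have := abs_sub (ξ + 1) 1
      rw [add_sub_cancel_right, abs_one] at this
      omega
    rw [fejer_eq_zero hK h1, fejer_eq_zero hK h.le]
    simp

theorem tendsto_fejer (ξ : ℤ) :
    Filter.Tendsto (fun K => fejer K ξ) Filter.atTop (nhds 1) := by
  have h1 : Filter.Tendsto (fun K : ℕ => max 0 (1 - |(ξ : ℝ)| / K)) Filter.atTop
      (nhds (max 0 (1 - 0))) :=
    tendsto_const_nhds.max (tendsto_const_nhds.sub (tendsto_const_div_atTop_nhds_zero_nat _))
  simpa [fejer] using h1

theorem fejer_mul_bounds {B : ℝ} {m : ℤ → ℂ} (hm : ∀ ξ, ‖m ξ‖ ≤ B)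
    (hd : ∀ ξ : ℤ, ‖m (ξ + 1) - m ξ‖ * (1 + |(ξ : ℝ)|) ≤ B) {K : ℕ} (hK : 0 < K) :
    (∀ ξ, ‖fejer K ξ * m ξ‖ ≤ 3 * B) ∧
    (∀ ξ : ℤ, ‖fejer K (ξ + 1) * m (ξ + 1) - fejer K ξ * m ξ‖ * (1 + |(ξ : ℝ)|) ≤ 3 * B) ∧
    (∀ ξ : ℤ, (K : ℤ) ≤ |ξ| → fejer K ξ * m ξ = 0) := by
  have hB : 0 ≤ B := (norm_nonneg _).trans (hm 0)
  have hnorm : ∀ ξ, ‖(fejer K ξ : ℂ)‖ ≤ 1 := fun ξ => by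
    rw [Complex.norm_real, Real.norm_of_nonneg (fejer_nonneg K ξ)]
    exact fejer_le_one K ξ
  refine ⟨fun ξ => ?_, fun ξ => ?_, fun ξ h => ?_⟩
  · rw [norm_mul]
    calc _ ≤ 1 * B := by gcongr; exacts [hnorm ξ, hm ξ]
      _ ≤ _ := by linarith
  · have e : (fejer K (ξ + 1) : ℂ) * m (ξ + 1) - fejer K ξ * m ξ
        = fejer K (ξ + 1) * (m (ξ + 1) - m ξ) + ((fejer K (ξ + 1) - fejer K ξ : ℝ) : ℂ) * m ξ := by
      push_cast; ring
    have h1 : ‖((fejer K (ξ + 1) - fejer K ξ : ℝ) : ℂ)‖ * (1 + |(ξ : ℝ)|) ≤ 2 := by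
      rw [Complex.norm_real]; exact abs_fejer_sub_mul_le hK ξ
    rw [e]
    calc _ ≤ (‖(fejer K (ξ + 1) : ℂ)‖ * ‖m (ξ + 1) - m ξ‖
          + ‖((fejer K (ξ + 1) - fejer K ξ : ℝ) : ℂ)‖ * ‖m ξ‖) * (1 + |(ξ : ℝ)|) := by
          gcongr
          refine (norm_add_le _ _).trans ?_
          rw [norm_mul, norm_mul]
      _ = ‖(fejer K (ξ + 1) : ℂ)‖ * (‖m (ξ + 1) - m ξ‖ * (1 + |(ξ : ℝ)|))
          + (‖((fejer K (ξ + 1) - fejer K ξ : ℝ) : ℂ)‖ * (1 + |(ξ : ℝ)|)) * ‖m ξ‖ := by ring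
      _ ≤ 1 * B + 2 * B := by
          gcongr
          exacts [hnorm _, hd ξ, hm ξ]
      _ = _ := by ring
  · rw [fejer_eq_zero hK h]; simp

theorem rpow_integral_le {p : ℝ} (hp : 1 ≤ p) {g : ℝ → ℝ} (hg : Continuous g) (hg0 : ∀ t, 0 ≤ g t) :
    (∫ t in (0 : ℝ)..1, g t) ^ p ≤ ∫ t in (0 : ℝ)..1, g t ^ p := by
  have hgp : Continuous fun t => g t ^ p := hg.rpow_const fun _ => Or.inr (by linarith)
  simp only [intervalIntegral.integral_of_le zero_le_one]
  have : IsProbabilityMeasure (volume.restrict (Set.Ioc (0 : ℝ) 1)) := ⟨by simp⟩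
  exact (convexOn_rpow hp).map_integral_le
    (continuousOn_id.rpow_const fun _ _ => Or.inr (by linarith)) isClosed_Ici
    (Filter.Eventually.of_forall hg0)
    ((intervalIntegrable_iff_integrableOn_Ioc_of_le zero_le_one).1 (hg.intervalIntegrable 0 1))
    ((intervalIntegrable_iff_integrableOn_Ioc_of_le zero_le_one).1 (hgp.intervalIntegrable 0 1))

theorem integral_integral_swap_unit {g : ℝ → ℝ → ℝ} (hg : Continuous (Function.uncurry g)) :
    ∫ x in (0 : ℝ)..1, ∫ t in (0 : ℝ)..1, g x t = ∫ t in (0 : ℝ)..1, ∫ x in (0 : ℝ)..1, g x t := by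
  simp only [intervalIntegral.integral_of_le zero_le_one]
  refine integral_integral_swap ?_
  rw [Measure.prod_restrict]
  exact (hg.continuousOn.integrableOn_compact (isCompact_Icc.prod isCompact_Icc)).mono_set
    (Set.prod_mono Set.Ioc_subset_Icc_self Set.Ioc_subset_Icc_self)

theorem integral_rpow_le_of_eq_add_integral {p D : ℝ} (hp : 1 < p) {H G₀ : ℝ → ℂ} {G : ℝ → ℝ → ℂ}
    (hH : Continuous H) (hG₀ : Continuous G₀) (hG : Continuous (Function.uncurry G))
    (heq : ∀ x, H x = G₀ x + ∫ t in (0 : ℝ)..x, G x t)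
    (hD₀ : ∫ x in (0 : ℝ)..1, ‖G₀ x‖ ^ p ≤ D)
    (hD : ∀ t, ∫ x in (0 : ℝ)..1, ‖G x t‖ ^ p ≤ D) :
    ∫ x in (0 : ℝ)..1, ‖H x‖ ^ p ≤ 2 ^ (p - 1) * (D + D) := by
  have hp0 : 0 < p := by linarith
  have hcont_right : ∀ x, Continuous fun t => G x t := fun x =>
    hG.comp (continuous_const.prodMk continuous_id)
  have hcontp : Continuous (Function.uncurry fun x t => ‖G x t‖ ^ p) :=
    Continuous.rpow_const hG.norm fun _ => Or.inr hp0.le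
  have hpt : ∀ x ∈ Set.Icc (0 : ℝ) 1, ‖H x‖ ≤ ‖G₀ x‖ + ∫ t in (0 : ℝ)..1, ‖G x t‖ := by
    intro x hx
    rw [heq]
    refine (norm_add_le _ _).trans ?_
    gcongr
    refine (intervalIntegral.norm_integral_le_integral_norm hx.1).trans ?_
    exact intervalIntegral.integral_mono_interval le_rfl hx.1 hx.2
      (Filter.Eventually.of_forall fun _ => norm_nonneg _)
      ((hcont_right x).norm.intervalIntegrable 0 1)
  have hinner : Continuous fun x => ∫ t in (0 : ℝ)..1, ‖G x t‖ ^ p :=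
    intervalIntegral.continuous_parametric_intervalIntegral_of_continuous hcontp continuous_const
  have hG₀p : Continuous fun x => ‖G₀ x‖ ^ p := hG₀.norm.rpow_const fun _ => Or.inr hp0.le
  calc ∫ x in (0 : ℝ)..1, ‖H x‖ ^ p
      ≤ ∫ x in (0 : ℝ)..1, 2 ^ (p - 1) * (‖G₀ x‖ ^ p + ∫ t in (0 : ℝ)..1, ‖G x t‖ ^ p) := by
        refine intervalIntegral.integral_mono_on zero_le_one
          ((hH.norm.rpow_const fun _ => Or.inr hp0.le).intervalIntegrable _ _)
          ((continuous_const.mul (hG₀p.add hinner)).intervalIntegrable _ _) fun x hx => ?_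
        have h1 : 0 ≤ ∫ t in (0 : ℝ)..1, ‖G x t‖ :=
          intervalIntegral.integral_nonneg zero_le_one fun _ _ => norm_nonneg _
        refine (Real.rpow_le_rpow (norm_nonneg _) (hpt x hx) hp0.le).trans
          ((rpow_add_le_two_rpow_mul hp.le (norm_nonneg _) h1).trans ?_)
        gcongr
        exact rpow_integral_le hp.le (hcont_right x).norm fun _ => norm_nonneg _
    _ = 2 ^ (p - 1) * ((∫ x in (0 : ℝ)..1, ‖G₀ x‖ ^ p)
        + ∫ t in (0 : ℝ)..1, ∫ x in (0 : ℝ)..1, ‖G x t‖ ^ p) := by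
        rw [intervalIntegral.integral_const_mul, intervalIntegral.integral_add
          (hG₀p.intervalIntegrable _ _) (hinner.intervalIntegrable _ _),
          integral_integral_swap_unit hcontp]
    _ ≤ 2 ^ (p - 1) * (D + ∫ t in (0 : ℝ)..1, D) := by
        gcongr
        refine intervalIntegral.integral_mono_on zero_le_one ?_
          (continuous_const.intervalIntegrable _ _) fun t _ => hD t
        refine Continuous.intervalIntegrable ?_ _ _
        exact intervalIntegral.continuous_parametric_intervalIntegral_of_continuous
          (f := fun t x => ‖G x t‖ ^ p) (hcontp.comp continuous_swap) continuous_const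
    _ = _ := by
        rw [intervalIntegral.integral_const, sub_zero, one_smul]

/-- The Fejér means of the operator with symbol `σ`, applied to the Fourier coefficients `c`. -/
def fejerOp (K : ℕ) (m c : ℤ → ℂ) (x : ℝ) : ℂ :=
  ∑ ξ ∈ Finset.Ioo (-(K : ℤ)) K, circleChar x ξ * (fejer K ξ * m ξ) * c ξ

theorem continuous_uncurry_fejerOp (K : ℕ) (c : ℤ → ℂ) {τ : ℝ → ℤ → ℂ}
    (hτ : ∀ ξ, Continuous fun t => τ t ξ) :
    Continuous (Function.uncurry fun x t => fejerOp K (τ t) c x) := by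
  simp only [fejerOp, Function.uncurry_def]
  have h1 : ∀ ξ, Continuous fun z : ℝ × ℝ => τ z.2 ξ := fun ξ => (hτ ξ).comp continuous_snd
  have h2 : ∀ ξ, Continuous fun z : ℝ × ℝ => circleChar z.1 ξ :=
    fun ξ => (continuous_circleChar ξ).comp continuous_fst
  exact continuous_finsetSum _ fun ξ _ =>
    ((h2 ξ).mul (continuous_const.mul (h1 ξ))).mul continuous_const

theorem fejerOp_eq_add_integral (K : ℕ) (c : ℤ → ℂ) {σ τ : ℝ → ℤ → ℂ}
    (hτ : ∀ ξ, Continuous fun t => τ t ξ)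
    (hστ : ∀ ξ t, HasDerivAt (fun t => σ t ξ) (τ t ξ) t) (x : ℝ) :
    fejerOp K (σ x) c x = fejerOp K (σ 0) c x + ∫ t in (0 : ℝ)..x, fejerOp K (τ t) c x := by
  have h1 : ∀ ξ, σ x ξ = σ 0 ξ + ∫ t in (0 : ℝ)..x, τ t ξ := fun ξ => by
    rw [intervalIntegral.integral_eq_sub_of_hasDerivAt (fun t _ => hστ ξ t)
      ((hτ ξ).intervalIntegrable 0 x)]
    ring
  simp only [fejerOp]
  rw [intervalIntegral.integral_finsetSum, ← Finset.sum_add_distrib]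
  · refine Finset.sum_congr rfl fun ξ _ => ?_
    rw [intervalIntegral.integral_mul_const, intervalIntegral.integral_const_mul,
      intervalIntegral.integral_const_mul, h1]
    ring
  · intro ξ _
    have := hτ ξ
    exact Continuous.intervalIntegrable (by fun_prop) _ _

theorem integral_fejerOp_rpow_le {σ τ : ℝ → ℤ → ℂ} {B p : ℝ}
    (hτ : ∀ ξ, Continuous fun t => τ t ξ)
    (hστ : ∀ ξ t, HasDerivAt (fun t => σ t ξ) (τ t ξ) t)
    (hσ0 : ∀ ξ, ‖σ 0 ξ‖ ≤ B)
    (hσ1 : ∀ ξ : ℤ, ‖σ 0 (ξ + 1) - σ 0 ξ‖ * (1 + |(ξ : ℝ)|) ≤ B)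
    (hτ0 : ∀ t ξ, ‖τ t ξ‖ ≤ B)
    (hτ1 : ∀ (t : ℝ) (ξ : ℤ), ‖τ t (ξ + 1) - τ t ξ‖ * (1 + |(ξ : ℝ)|) ≤ B) (hp : 1 < p) :
    ∃ C, 0 ≤ C ∧ ∀ K : ℕ, 0 < K → ∀ f : ℝ → ℂ, Continuous f →
      ∫ x in (0 : ℝ)..1, ‖fejerOp K (σ x) (circleCoeff f) x‖ ^ p
        ≤ C * ∫ x in (0 : ℝ)..1, ‖f x‖ ^ p := by
  have hB : 0 ≤ B := (norm_nonneg _).trans (hσ0 0)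
  obtain ⟨C, hC, h⟩ := integral_multiplier_rpow_le (A := 3 * B) (by positivity) hp
  refine ⟨2 ^ (p - 1) * (C + C), by positivity, fun K hK f hf => ?_⟩
  have hbound : ∀ m : ℤ → ℂ, (∀ ξ, ‖m ξ‖ ≤ B) →
      (∀ ξ : ℤ, ‖m (ξ + 1) - m ξ‖ * (1 + |(ξ : ℝ)|) ≤ B) →
      ∫ x in (0 : ℝ)..1, ‖fejerOp K m (circleCoeff f) x‖ ^ p
        ≤ C * ∫ x in (0 : ℝ)..1, ‖f x‖ ^ p := by
    intro m hm hd
    obtain ⟨h1, h2, h3⟩ := fejer_mul_bounds hm hd hK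
    exact h K (fun ξ => fejer K ξ * m ξ) h1 h2 h3 f hf
  have hσ : ∀ ξ, Continuous fun t => σ t ξ := fun ξ =>
    continuous_iff_continuousAt.2 fun t => (hστ ξ t).continuousAt
  have hcont : ∀ m : ℝ → ℤ → ℂ, (∀ ξ, Continuous fun t => m t ξ) →
      Continuous fun x => fejerOp K (m x) (circleCoeff f) x := fun m hm => by
    simp only [fejerOp]
    fun_prop
  rw [mul_assoc, add_mul]
  exact integral_rpow_le_of_eq_add_integral hp (hcont σ hσ)
    (hcont (fun _ => σ 0) fun _ => continuous_const)
    (continuous_uncurry_fejerOp K (circleCoeff f) hτ)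
    (fejerOp_eq_add_integral K (circleCoeff f) hτ hστ)
    (hbound _ hσ0 hσ1) fun t => hbound _ (hτ0 t) (hτ1 t)

theorem tendsto_fejerOp {m c : ℤ → ℂ} {x : ℝ}
    (hs : Summable fun ξ => circleChar x ξ * m ξ * c ξ) :
    Filter.Tendsto (fun K : ℕ => fejerOp (K + 1) m c x) Filter.atTop
      (nhds (∑' ξ, circleChar x ξ * m ξ * c ξ)) := by
  have h1 : ∀ K : ℕ, fejerOp (K + 1) m c x
      = ∑' ξ, (fejer (K + 1) ξ : ℂ) * (circleChar x ξ * m ξ * c ξ) := by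
    intro K
    rw [fejerOp, tsum_eq_sum (s := Finset.Ioo (-((K + 1 : ℕ) : ℤ)) ((K + 1 : ℕ) : ℤ))]
    · exact Finset.sum_congr rfl fun ξ _ => by ring
    · intro ξ hξ
      rw [Finset.mem_Ioo, ← abs_lt, not_lt] at hξ
      rw [fejer_eq_zero (by omega) hξ]
      simp
  simp only [h1]
  refine tendsto_tsum_of_dominated_convergence hs.norm (fun ξ => ?_)
    (Filter.Eventually.of_forall fun K ξ => ?_)
  · have h2 : Filter.Tendsto (fun K : ℕ => (fejer (K + 1) ξ : ℂ)) Filter.atTop (nhds 1) := by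
      exact_mod_cast (Complex.continuous_ofReal.tendsto 1).comp
        ((tendsto_fejer ξ).comp (Filter.tendsto_add_atTop_nat 1))
    simpa using h2.mul_const (circleChar x ξ * m ξ * c ξ)
  · rw [norm_mul, Complex.norm_real, Real.norm_of_nonneg (fejer_nonneg _ _)]
    exact mul_le_of_le_one_left (norm_nonneg _) (fejer_le_one _ _)

theorem integral_le_of_le_liminf {α : Type*} [MeasurableSpace α] {μ : Measure α} {D : ℝ}
    (hD : 0 ≤ D) {g : α → ℝ} {G : ℕ → α → ℝ} (hg : ∀ x, 0 ≤ g x) (hG : ∀ n x, 0 ≤ G n x)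
    (hGi : ∀ n, Integrable (G n) μ) (hGD : ∀ n, ∫ x, G n x ∂μ ≤ D)
    (hlim : ∀ x, ENNReal.ofReal (g x)
      ≤ Filter.liminf (fun n => ENNReal.ofReal (G n x)) Filter.atTop) :
    ∫ x, g x ∂μ ≤ D := by
  by_cases hgi : Integrable g μ
  · rw [← ENNReal.ofReal_le_ofReal_iff hD,
      ofReal_integral_eq_lintegral_ofReal hgi (Filter.Eventually.of_forall hg)]
    refine (lintegral_mono hlim).trans ((lintegral_liminf_le' fun n =>
      (hGi n).aestronglyMeasurable.aemeasurable.ennreal_ofReal).trans ?_)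
    refine Filter.liminf_le_of_frequently_le' (Filter.Frequently.of_forall fun n => ?_)
    rw [← ofReal_integral_eq_lintegral_ofReal (hGi n) (Filter.Eventually.of_forall (hG n))]
    exact ENNReal.ofReal_le_ofReal (hGD n)
  · rwa [integral_undef hgi]

theorem integral_tsum_symbol_rpow_le {σ τ : ℝ → ℤ → ℂ} {B p : ℝ}
    (hτ : ∀ ξ, Continuous fun t => τ t ξ)
    (hστ : ∀ ξ t, HasDerivAt (fun t => σ t ξ) (τ t ξ) t)
    (hσ0 : ∀ ξ, ‖σ 0 ξ‖ ≤ B)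
    (hσ1 : ∀ ξ : ℤ, ‖σ 0 (ξ + 1) - σ 0 ξ‖ * (1 + |(ξ : ℝ)|) ≤ B)
    (hτ0 : ∀ t ξ, ‖τ t ξ‖ ≤ B)
    (hτ1 : ∀ (t : ℝ) (ξ : ℤ), ‖τ t (ξ + 1) - τ t ξ‖ * (1 + |(ξ : ℝ)|) ≤ B) (hp : 1 < p) :
    ∃ C, 0 ≤ C ∧ ∀ f : ℝ → ℂ, Continuous f →
      ∫ x in (0 : ℝ)..1, ‖∑' ξ, circleChar x ξ * σ x ξ * circleCoeff f ξ‖ ^ p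
        ≤ C * ∫ x in (0 : ℝ)..1, ‖f x‖ ^ p := by
  obtain ⟨C, hC, h⟩ := integral_fejerOp_rpow_le hτ hστ hσ0 hσ1 hτ0 hτ1 hp
  have hp0 : 0 < p := by linarith
  have hσ : ∀ ξ, Continuous fun t => σ t ξ := fun ξ =>
    continuous_iff_continuousAt.2 fun t => (hστ ξ t).continuousAt
  refine ⟨C, hC, fun f hf => ?_⟩
  have hnn : 0 ≤ ∫ x in (0 : ℝ)..1, ‖f x‖ ^ p :=
    intervalIntegral.integral_nonneg zero_le_one fun _ _ => by positivity
  have hcont : ∀ K, Continuous fun x => ‖fejerOp K (σ x) (circleCoeff f) x‖ ^ p := fun K => by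
    refine Continuous.rpow_const ?_ fun _ => Or.inr hp0.le
    simp only [fejerOp]
    fun_prop
  rw [intervalIntegral.integral_of_le zero_le_one]
  refine integral_le_of_le_liminf (by positivity)
    (G := fun K x => ‖fejerOp (K + 1) (σ x) (circleCoeff f) x‖ ^ p)
    (fun _ => by positivity) (fun _ _ => by positivity)
    (fun K => ((intervalIntegrable_iff_integrableOn_Ioc_of_le zero_le_one).1
      ((hcont (K + 1)).intervalIntegrable 0 1))) (fun K => ?_) fun x => ?_
  · have := h (K + 1) K.succ_pos f hf
    rwa [intervalIntegral.integral_of_le zero_le_one] at this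
  · by_cases hs : Summable fun ξ => circleChar x ξ * σ x ξ * circleCoeff f ξ
    · have h1 := ((tendsto_fejerOp hs).norm.rpow_const (p := p) (Or.inr hp0.le))
      exact (ENNReal.tendsto_ofReal h1).liminf_eq.ge
    · rw [tsum_eq_zero_of_not_summable hs, norm_zero, Real.zero_rpow hp0.ne']
      simp

theorem integral_muT_one {E : Type*} [NormedAddCommGroup E] [NormedSpace ℝ E]
    (G : (Fin 1 → ℝ) → E) : ∫ x, G x ∂(μT 1) = ∫ t in (0 : ℝ)..1, G fun _ => t := by
  have h1 := (volume_preserving_funUnique (Fin 1) ℝ).symm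
  have h2 := h1.setIntegral_preimage_emb (MeasurableEquiv.measurableEmbedding _) G (cube 1)
  have h3 : (MeasurableEquiv.funUnique (Fin 1) ℝ).symm ⁻¹' cube 1 = Set.Ico 0 1 := by
    ext t
    simp [cube]
  refine Eq.trans h2.symm ?_
  rw [intervalIntegral.integral_of_le zero_le_one, ← integral_Ico_eq_integral_Ioc, h3]
  rfl

theorem fc_eq_circleCoeff (f : (Fin 1 → ℝ) → ℂ) (ξ : ℤ) :
    fc f (fun _ => ξ) = circleCoeff (fun t => f fun _ => t) ξ := by
  rw [fc, integral_muT_one, circleCoeff]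
  congr 1
  funext t
  rw [circleChar]
  congr 2
  simp

theorem Op_eq_tsum (σ : (Fin 1 → ℝ) → (Fin 1 → ℤ) → ℂ) (f : (Fin 1 → ℝ) → ℂ) (t : ℝ) :
    Op σ f (fun _ => t) = ∑' ξ : ℤ, circleChar t ξ * σ (fun _ => t) (fun _ => ξ) *
      circleCoeff (fun t => f fun _ => t) ξ := by
  rw [Op, ← (Equiv.funUnique (Fin 1) ℤ).symm.tsum_eq]
  refine tsum_congr fun ξ => ?_
  have h1 : (Equiv.funUnique (Fin 1) ℤ).symm ξ = fun _ => ξ := rfl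
  rw [h1, fc_eq_circleCoeff]
  congr 2
  simp [eChar, circleChar]

theorem one_add_abs_mul_jb_inv_le (ξ : ℤ) :
    jb (fun _ : Fin 1 => ξ) ^ (-1 : ℝ) * (1 + |(ξ : ℝ)|) ≤ 2 := by
  have h0 : (0 : ℝ) < 1 + (ξ : ℝ) ^ 2 := by positivity
  have h1 : jb (fun _ : Fin 1 => ξ) = √(1 + (ξ : ℝ) ^ 2) := by simp [jb]
  have h2 : 0 < √(1 + (ξ : ℝ) ^ 2) := Real.sqrt_pos.2 h0
  rw [h1, Real.rpow_neg_one, inv_mul_le_iff₀ h2]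
  have h3 : 1 ≤ √(1 + (ξ : ℝ) ^ 2) := Real.one_le_sqrt.2 (by nlinarith [sq_nonneg (ξ : ℝ)])
  have h4 : |(ξ : ℝ)| ≤ √(1 + (ξ : ℝ) ^ 2) := Real.abs_le_sqrt (by linarith)
  linarith

theorem mul_one_add_abs_le {r C : ℝ} (hC : 0 < C) {ξ : ℤ}
    (h : r ≤ C * jb (fun _ : Fin 1 => ξ) ^ (-1 : ℝ)) : r * (1 + |(ξ : ℝ)|) ≤ 2 * C := by
  calc r * (1 + |(ξ : ℝ)|) ≤ C * jb (fun _ : Fin 1 => ξ) ^ (-1 : ℝ) * (1 + |(ξ : ℝ)|) := by gcongr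
    _ = C * (jb (fun _ : Fin 1 => ξ) ^ (-1 : ℝ) * (1 + |(ξ : ℝ)|)) := by ring
    _ ≤ C * 2 := by gcongr; exact one_add_abs_mul_jb_inv_le ξ
    _ = _ := by ring

theorem hasDerivAt_pd {g : (Fin 1 → ℝ) → ℂ} (hg : ContDiff ℝ (⊤ : ℕ∞) g) (t : ℝ) :
    HasDerivAt (fun t => g fun _ => t) (pd 0 g fun _ => t) t := by
  have h1 : HasDerivAt (fun t : ℝ => (fun _ => t : Fin 1 → ℝ)) (Pi.single 0 1) t := by
    rw [hasDerivAt_pi]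
    intro i
    rw [Subsingleton.elim i 0, Pi.single_eq_same]
    exact hasDerivAt_id t
  exact ((hg.differentiable (by simp)) _).hasFDerivAt.comp_hasDerivAt t h1

theorem continuous_pd {g : (Fin 1 → ℝ) → ℂ} (hg : ContDiff ℝ (⊤ : ℕ∞) g) :
    Continuous fun t : ℝ => pd 0 g fun _ => t := by
  have h1 : Continuous (fderiv ℝ g) := hg.continuous_fderiv (by simp)
  exact (h1.comp (continuous_pi fun _ => continuous_id)).clm_apply continuous_const

theorem symbDxD_zero_zero (σ : (Fin 1 → ℝ) → (Fin 1 → ℤ) → ℂ) (x ξ) :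
    symbDxD (fun _ => 0) (fun _ => 0) σ x ξ = σ x ξ := rfl

theorem symbDxD_zero_one (σ : (Fin 1 → ℝ) → (Fin 1 → ℤ) → ℂ) (x) (ξ : ℤ) :
    symbDxD (fun _ => 0) (fun _ => 1) σ x (fun _ => ξ)
      = σ x (fun _ => ξ + 1) - σ x (fun _ => ξ) := by
  have h : ((fun _ => ξ : Fin 1 → ℤ) + Pi.single 0 1) = fun _ => ξ + 1 := by
    ext i; rw [Subsingleton.elim i 0]; simp
  rw [← h]
  rfl

theorem symbDxD_one_zero (σ : (Fin 1 → ℝ) → (Fin 1 → ℤ) → ℂ) (x ξ) :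
    symbDxD (fun _ => 1) (fun _ => 0) σ x ξ = pd 0 (fun x => σ x ξ) x := rfl

theorem symbDxD_one_one {σ : (Fin 1 → ℝ) → (Fin 1 → ℤ) → ℂ}
    (hσ : ∀ ξ, ContDiff ℝ (⊤ : ℕ∞) fun x => σ x ξ) (x) (ξ : ℤ) :
    symbDxD (fun _ => 1) (fun _ => 1) σ x (fun _ => ξ)
      = pd 0 (fun x => σ x fun _ => ξ + 1) x - pd 0 (fun x => σ x fun _ => ξ) x := by
  have h1 : symbDxD (fun _ => 1) (fun _ => 1) σ x (fun _ => ξ)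
      = pd 0 (fun x => symbDxD (fun _ => 0) (fun _ => 1) σ x (fun _ => ξ)) x := rfl
  have hd : ∀ ξ, DifferentiableAt ℝ (fun x => σ x ξ) x := fun ξ =>
    (hσ ξ).differentiable (by simp) x
  simp only [h1, symbDxD_zero_one, pd]
  rw [fderiv_fun_sub (hd _) (hd _)]
  rfl

/-- **Wong–Molahajloo.** If a symbol `a : 𝕋¹ × ℤ → ℂ` satisfies
`|∂_x^β Δ_ξ^α a(x,ξ)| ≤ C_{α,β} ⟨ξ⟩^{-α}` for `α, β ≤ 1`, then
`a(x,D) : L^p(𝕋¹) → L^p(𝕋¹)` is bounded for every `1 < p < ∞`. -/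
theorem periodic_pseudodiff_circle_Lp_bounded
    (a : (Fin 1 → ℝ) → (Fin 1 → ℤ) → ℂ)
    (ha_smooth : ∀ ξ, ContDiff ℝ (⊤ : ℕ∞) fun x => a x ξ)
    (ha_per : ∀ ξ, Per fun x => a x ξ)
    (ha : ∀ α β : ℕ, α ≤ 1 → β ≤ 1 → ∃ C : ℝ, 0 < C ∧
      ∀ (x : Fin 1 → ℝ) (ξ : Fin 1 → ℤ),
        ‖symbDxD (fun _ => β) (fun _ => α) a x ξ‖ ≤ C * jb ξ ^ (-(α : ℝ))) :
    ∀ p : ℝ, 1 < p →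
      ∃ C : ℝ, 0 < C ∧ ∀ f : (Fin 1 → ℝ) → ℂ, ContDiff ℝ (⊤ : ℕ∞) f → Per f →
        lpT 1 p (Op a f) ≤ C * lpT 1 p f := by
  intro p hp
  obtain ⟨C₀₀, hC₀₀, h₀₀⟩ := ha 0 0 zero_le_one zero_le_one
  obtain ⟨C₁₀, hC₁₀, h₁₀⟩ := ha 1 0 le_rfl zero_le_one
  obtain ⟨C₀₁, hC₀₁, h₀₁⟩ := ha 0 1 zero_le_one le_rfl
  obtain ⟨C₁₁, hC₁₁, h₁₁⟩ := ha 1 1 le_rfl le_rfl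
  simp only [Nat.cast_zero, neg_zero, Real.rpow_zero, mul_one, Nat.cast_one] at h₀₀ h₁₀ h₀₁ h₁₁
  obtain ⟨C, hC, h⟩ := integral_tsum_symbol_rpow_le
    (σ := fun t ξ => a (fun _ => t) fun _ => ξ)
    (τ := fun t ξ => pd 0 (fun x => a x fun _ => ξ) fun _ => t)
    (B := C₀₀ + 2 * C₁₀ + C₀₁ + 2 * C₁₁)
    (fun ξ => continuous_pd (ha_smooth _)) (fun ξ t => hasDerivAt_pd (ha_smooth _) t)
    (fun ξ => by
      have := h₀₀ (fun _ => 0) fun _ => ξ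
      rw [symbDxD_zero_zero] at this
      linarith)
    (fun ξ => by
      have := mul_one_add_abs_le hC₁₀ (h₁₀ (fun _ => 0) fun _ => ξ)
      rw [symbDxD_zero_one] at this
      linarith)
    (fun t ξ => by
      have := h₀₁ (fun _ => t) fun _ => ξ
      rw [symbDxD_one_zero] at this
      linarith)
    (fun t ξ => by
      have := mul_one_add_abs_le hC₁₁ (h₁₁ (fun _ => t) fun _ => ξ)
      rw [symbDxD_one_one ha_smooth] at this
      linarith) hp
  refine ⟨C ^ (1 / p) + 1, by positivity, fun f hf _ => ?_⟩
  have h1 := h (fun t => f fun _ => t) (hf.continuous.comp (continuous_pi fun _ => continuous_id))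
  have h2 : 0 ≤ ∫ t in (0 : ℝ)..1, ‖f fun _ => t‖ ^ p :=
    intervalIntegral.integral_nonneg zero_le_one fun _ _ => by positivity
  simp only [lpT, integral_muT_one, Op_eq_tsum]
  calc _ ≤ (C * ∫ t in (0 : ℝ)..1, ‖f fun _ => t‖ ^ p) ^ (1 / p) := by
        refine Real.rpow_le_rpow ?_ h1 (by positivity)
        exact intervalIntegral.integral_nonneg zero_le_one fun _ _ => by positivity
    _ = C ^ (1 / p) * (∫ t in (0 : ℝ)..1, ‖f fun _ => t‖ ^ p) ^ (1 / p) :=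
        Real.mul_rpow hC h2
    _ ≤ _ := by gcongr; linarith
end
end

section
/- Let n ≥ 1 and k = [n/2]+1. Let a : 𝕋ⁿ × ℤⁿ → ℂ be a symbol, smooth in x, such that for every multi-index β with |β| ≤ k there is C_β > 0 with |∂_x^β a(x,ξ)| ≤ C_β for all (x,ξ) ∈ 𝕋ⁿ × ℤⁿ. Then the periodic pseudo-differential operator a(x,D) : L²(𝕋ⁿ) → L²(𝕋ⁿ) is a bounded operator. -/
open MeasureTheory Real ENNReal

noncomputable section

section Torus

open UnitAddTorus

local instance : MeasureSpace UnitAddCircle := ⟨AddCircle.haarAddCircle⟩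

local instance : IsProbabilityMeasure (volume : Measure UnitAddCircle) :=
  inferInstanceAs (IsProbabilityMeasure AddCircle.haarAddCircle)

/-- The covering map `ℝⁿ → 𝕋ⁿ`. -/
def torusMk {n : ℕ} (x : Fin n → ℝ) : UnitAddTorus (Fin n) := fun i => (x i : UnitAddCircle)

lemma Per.exists_continuousMap {n : ℕ} {f : (Fin n → ℝ) → ℂ} (hf : Continuous f) (hp : Per f) :
    ∃ F : C(UnitAddTorus (Fin n), ℂ), ∀ x, F (torusMk x) = f x := by
  have hq : IsOpenQuotientMap (Pi.map fun (_ : Fin n) (x : ℝ) => (x : UnitAddCircle)) :=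
    IsOpenQuotientMap.piMap fun _ => QuotientAddGroup.isOpenQuotientMap_mk
  let q : C(Fin n → ℝ, UnitAddTorus (Fin n)) := ⟨_, hq.continuous⟩
  have hqq : Topology.IsQuotientMap q := hq.isQuotientMap
  have hfac : Function.FactorsThrough (⟨f, hf⟩ : C(Fin n → ℝ, ℂ)) q := by
    intro x y hxy
    have : ∀ i, ∃ m : ℤ, (m : ℝ) = x i - y i := by
      intro i
      have h : ((x i : ℝ) : UnitAddCircle) = (y i : ℝ) := congrFun hxy i
      rw [← sub_eq_zero, ← AddCircle.coe_sub, AddCircle.coe_eq_zero_iff] at h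
      obtain ⟨m, hm⟩ := h
      exact ⟨m, by simpa using hm⟩
    choose m hm using this
    have : x = y + fun j => (m j : ℝ) := by
      ext i; simp [hm]
    change f x = f y
    rw [this, hp]
  exact ⟨hqq.lift ⟨f, hf⟩ hfac, fun x =>
    congrArg (fun g : C(Fin n → ℝ, ℂ) => g x) (hqq.lift_comp ⟨f, hf⟩ hfac)⟩

lemma integral_torus_eq {n : ℕ} {E : Type*} [NormedAddCommGroup E] [NormedSpace ℝ E]
    (G : UnitAddTorus (Fin n) → E) : ∫ t, G t = ∫ x, G (torusMk x) ∂(μT n) := by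
  rw [integral_preimage G 0, μT]
  refine setIntegral_congr_set ?_
  have h1 : {x : Fin n → ℝ | ∀ i, x i ∈ Set.Ioc ((0 : Fin n → ℝ) i) ((0 : Fin n → ℝ) i + 1)}
      = Set.univ.pi fun i => Set.Ioc ((0 : Fin n → ℝ) i) ((1 : Fin n → ℝ) i) := by
    ext x; simp
  have h2 : cube n = Set.univ.pi fun i => Set.Ico ((0 : Fin n → ℝ) i) ((1 : Fin n → ℝ) i) := rfl
  rw [h1, h2]
  exact Measure.univ_pi_Ioc_ae_eq_Icc.trans Measure.univ_pi_Ico_ae_eq_Icc.symm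

lemma mFourier_torusMk {n : ℕ} (ξ : Fin n → ℤ) (x : Fin n → ℝ) :
    mFourier ξ (torusMk x) = eChar x ξ := by
  simp only [mFourier, torusMk, ContinuousMap.coe_mk, fourier_coe_apply, eChar, Finset.mul_sum,
    Complex.exp_sum]
  refine Finset.prod_congr rfl fun i _ => ?_
  congr 1
  push_cast
  ring

lemma mFourierCoeff_eq_fc {n : ℕ} {f : (Fin n → ℝ) → ℂ} {F : UnitAddTorus (Fin n) → ℂ}
    (hF : ∀ x, F (torusMk x) = f x) (ξ : Fin n → ℤ) : mFourierCoeff F ξ = fc f ξ := by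
  rw [mFourierCoeff, integral_torus_eq, fc]
  congr 1
  ext x
  rw [mFourier_torusMk, hF, smul_eq_mul, eChar]
  congr 2
  simp

/-- Parseval's identity for continuous periodic functions. -/
lemma hasSum_sq_fc {n : ℕ} {f : (Fin n → ℝ) → ℂ} (hf : Continuous f) (hp : Per f) :
    HasSum (fun ξ => ‖fc f ξ‖ ^ 2) (∫ x, ‖f x‖ ^ 2 ∂(μT n)) := by
  obtain ⟨F, hF⟩ := hp.exists_continuousMap hf
  have h := hasSum_sq_mFourierCoeff (F.toLp 2 volume ℂ)
  simp only [mFourierCoeff_toLp, mFourierCoeff_eq_fc hF] at h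
  convert h using 1
  have : ∫ t, ‖F.toLp 2 volume ℂ t‖ ^ 2 = ∫ t, ‖F t‖ ^ 2 := by
    refine integral_congr_ae ?_
    filter_upwards [ContinuousMap.coeFn_toLp (𝕜 := ℂ) (p := 2) volume F] with t ht
    rw [ht]
  rw [this, integral_torus_eq]
  simp [hF]

/-- Pointwise Fourier inversion for continuous periodic functions with summable coefficients. -/
lemma hasSum_fc_mul_eChar {n : ℕ} {f : (Fin n → ℝ) → ℂ} (hf : Continuous f) (hp : Per f)
    (hs : Summable (fc f)) (x : Fin n → ℝ) : HasSum (fun ξ => fc f ξ * eChar x ξ) (f x) := by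
  obtain ⟨F, hF⟩ := hp.exists_continuousMap hf
  have hc : mFourierCoeff F = fc f := funext (mFourierCoeff_eq_fc hF)
  have h := hasSum_mFourier_series_apply_of_summable (f := F) (by rwa [hc]) (torusMk x)
  simpa [hF, hc, mFourier_torusMk] using h

end Torus

section Derivatives

variable {n : ℕ}

lemma contDiff_pd {f : (Fin n → ℝ) → ℂ} (hf : ContDiff ℝ (⊤ : ℕ∞) f) (j : Fin n) :
    ContDiff ℝ (⊤ : ℕ∞) (pd j f) :=
  ContDiff.clm_apply (hf.fderiv_right (m := (⊤ : ℕ∞)) le_rfl) contDiff_const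

lemma contDiff_pd_iterate {f : (Fin n → ℝ) → ℂ} (hf : ContDiff ℝ (⊤ : ℕ∞) f) (j : Fin n)
    (k : ℕ) : ContDiff ℝ (⊤ : ℕ∞) ((pd j)^[k] f) := by
  induction k with
  | zero => exact hf
  | succ k ih =>
    rw [Function.iterate_succ_apply']
    exact contDiff_pd ih j

lemma Per.pd {f : (Fin n → ℝ) → ℂ} (hp : Per f) (j : Fin n) : Per (pd j f) := by
  intro x v
  have h : (fun y => f (y + fun j => (v j : ℝ))) = f := funext fun y => hp y v
  simp only [_root_.pd]
  rw [← fderiv_comp_add_right, h]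

lemma Per.pd_iterate {f : (Fin n → ℝ) → ℂ} (hp : Per f) (j : Fin n) (k : ℕ) :
    Per ((_root_.pd j)^[k] f) := by
  induction k with
  | zero => exact hp
  | succ k ih =>
    rw [Function.iterate_succ_apply']
    exact ih.pd j

lemma pd_iterate_sum {ι : Type*} (s : Finset ι) (c : ι → ℂ) {f : ι → (Fin n → ℝ) → ℂ}
    (hf : ∀ i, ContDiff ℝ (⊤ : ℕ∞) (f i)) (j : Fin n) (k : ℕ) :
    (pd j)^[k] (fun y => ∑ i ∈ s, c i * f i y) = fun y => ∑ i ∈ s, c i * (pd j)^[k] (f i) y := by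
  induction k with
  | zero => rfl
  | succ k ih =>
    ext y
    have hd : ∀ i, DifferentiableAt ℝ ((pd j)^[k] (f i)) y := fun i =>
      (contDiff_pd_iterate (hf i) j k).contDiffAt.differentiableAt (by simp)
    simp only [Function.iterate_succ_apply', ih]
    simp only [pd]
    rw [fderiv_fun_sum fun i _ => (hd i).const_mul (c i), sum_apply]
    refine Finset.sum_congr rfl fun i _ => ?_
    rw [fderiv_const_mul (hd i)]
    simp

lemma pdM_single (j : Fin n) (k : ℕ) (f : (Fin n → ℝ) → ℂ) :
    pdM (Pi.single j k) f = (pd j)^[k] f := by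
  have hlen : (mIdxList (Pi.single j k : Fin n → ℕ)).length = k := by
    simp only [mIdxList, List.length_flatMap, List.length_replicate]
    rw [← List.ofFn_eq_map, List.sum_ofFn]
    simp
  have hl : mIdxList (Pi.single j k : Fin n → ℕ) = List.replicate k j := by
    refine List.eq_replicate_iff.2 ⟨hlen, fun i hi => ?_⟩
    simp only [mIdxList, List.mem_flatMap, List.mem_replicate] at hi
    obtain ⟨l, -, h0, rfl⟩ := hi
    by_contra h
    exact h0 (by simp [h])
  rw [pdM, hl]
  clear hl hlen
  induction k with
  | zero => rfl
  | succ k ih =>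
    rw [List.replicate_succ, List.foldr_cons, ih, Function.iterate_succ_apply']

lemma hasFDerivAt_eChar (ξ : Fin n → ℤ) (x : Fin n → ℝ) :
    HasFDerivAt (fun x => eChar x ξ) (eChar x ξ • (2 * (π : ℂ) * Complex.I) •
      ∑ j, (ξ j : ℂ) • (Complex.ofRealCLM.comp
        (ContinuousLinearMap.proj (R := ℝ) (φ := fun _ : Fin n => ℝ) j))) x := by
  have h : HasFDerivAt (fun x : Fin n → ℝ => ∑ j, (x j : ℂ) * (ξ j : ℂ))
      (∑ j, (ξ j : ℂ) • (Complex.ofRealCLM.comp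
        (ContinuousLinearMap.proj (R := ℝ) (φ := fun _ : Fin n => ℝ) j))) x := by
    refine HasFDerivAt.fun_sum fun j _ => ?_
    exact ((Complex.ofRealCLM.comp
      (ContinuousLinearMap.proj (R := ℝ) (φ := fun _ : Fin n => ℝ) j)).hasFDerivAt).mul_const _
  exact (h.const_mul (2 * (π : ℂ) * Complex.I)).cexp

lemma pd_eChar (ξ : Fin n → ℤ) (j : Fin n) (x : Fin n → ℝ) :
    pd j (fun x => eChar x ξ) x = 2 * π * Complex.I * ξ j * eChar x ξ := by
  rw [pd, (hasFDerivAt_eChar ξ x).fderiv]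
  simp [Pi.single_apply, apply_ite, mul_comm, mul_left_comm]

lemma contDiff_eChar (ξ : Fin n → ℤ) : ContDiff ℝ (⊤ : ℕ∞) (fun x => eChar x ξ) := by
  have : ContDiff ℝ (⊤ : ℕ∞) (fun x : Fin n → ℝ => ∑ j, (x j : ℂ) * (ξ j : ℂ)) :=
    ContDiff.sum fun j _ =>
      (Complex.ofRealCLM.contDiff.comp (contDiff_apply ℝ ℝ j)).mul contDiff_const
  exact (contDiff_const.mul this).cexp

lemma per_eChar (ξ : Fin n → ℤ) : Per (fun x => eChar x ξ) := by
  intro x v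
  simp only [eChar, Pi.add_apply]
  rw [Complex.exp_eq_exp_iff_exists_int]
  refine ⟨∑ j, v j * ξ j, ?_⟩
  push_cast
  simp only [add_mul, Finset.sum_add_distrib]
  ring

lemma Per.mul {f g : (Fin n → ℝ) → ℂ} (hf : Per f) (hg : Per g) : Per fun x => f x * g x :=
  fun x v => by simp only [hf x v, hg x v]

lemma cube_ae_eq_Icc : cube n =ᵐ[volume] Set.Icc (0 : Fin n → ℝ) 1 :=
  Measure.univ_pi_Ico_ae_eq_Icc

lemma Continuous.integrable_torus {E : Type*} [NormedAddCommGroup E] {f : (Fin n → ℝ) → E}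
    (hf : Continuous f) : Integrable f (μT n) := by
  rw [μT, Measure.restrict_congr_set cube_ae_eq_Icc]
  exact (hf.continuousOn.integrableOn_compact isCompact_Icc)

/-- The integral over the torus of a partial derivative vanishes. -/
lemma integral_pd_eq_zero {f : (Fin n → ℝ) → ℂ} (hf : ContDiff ℝ (⊤ : ℕ∞) f) (hp : Per f)
    (j : Fin n) : ∫ x, pd j f x ∂(μT n) = 0 := by
  cases n with
  | zero => exact j.elim0
  | succ m =>
    have hd := integral_divergence_of_hasFDerivAt_off_countable' (0 : Fin (m + 1) → ℝ) 1
      zero_le_one (fun i => if i = j then f else 0)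
      (fun i x => if i = j then fderiv ℝ f x else 0) ∅ Set.countable_empty ?_ ?_ ?_
    · have h1 : ∀ x, ∑ i, (if i = j then fderiv ℝ f x else 0) (Pi.single i (1 : ℝ)) = pd j f x := by
        intro x
        rw [Finset.sum_eq_single j (fun i _ hi => by simp [hi]) (by simp)]
        simp [pd]
      simp only [h1] at hd
      rw [μT, setIntegral_congr_set cube_ae_eq_Icc, hd]
      refine Finset.sum_eq_zero fun i _ => ?_
      rw [sub_eq_zero]
      congr 1
      ext x
      split_ifs
      · have : i.insertNth ((1 : Fin (m + 1) → ℝ) i) x =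
            i.insertNth ((0 : Fin (m + 1) → ℝ) i) x +
              fun l => (((Pi.single i 1 : Fin (m + 1) → ℤ) l : ℤ) : ℝ) := by
          ext l
          rcases Fin.eq_self_or_eq_succAbove i l with rfl | ⟨l, rfl⟩ <;> simp
        rw [this, hp]
      · rfl
    · intro i
      split_ifs
      · exact hf.continuous.continuousOn
      · exact continuousOn_const
    · intro x _ i
      split_ifs
      · exact (hf.contDiffAt.differentiableAt (by simp)).hasFDerivAt
      · exact hasFDerivAt_const _ _
    · refine ContinuousOn.integrableOn_compact isCompact_Icc (Continuous.continuousOn ?_)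
      refine continuous_finsetSum _ fun i _ => ?_
      split_ifs
      · exact (contDiff_pd hf i).continuous
      · exact continuous_const

lemma fc_eq_integral (f : (Fin n → ℝ) → ℂ) (ξ : Fin n → ℤ) :
    fc f ξ = ∫ x, eChar x (-ξ) * f x ∂(μT n) := by
  simp [fc, eChar]

lemma fc_pd {f : (Fin n → ℝ) → ℂ} (hf : ContDiff ℝ (⊤ : ℕ∞) f) (hp : Per f) (j : Fin n)
    (ξ : Fin n → ℤ) : fc (pd j f) ξ = 2 * π * Complex.I * ξ j * fc f ξ := by
  have h0 := integral_pd_eq_zero ((contDiff_eChar (-ξ)).mul hf) ((per_eChar (-ξ)).mul hp) j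
  have h1 : ∀ x, pd j (fun x => eChar x (-ξ) * f x) x =
      eChar x (-ξ) * pd j f x - 2 * π * Complex.I * ξ j * (eChar x (-ξ) * f x) := by
    intro x
    have he := pd_eChar (-ξ) j x
    simp only [pd] at he ⊢
    rw [fderiv_fun_mul ((contDiff_eChar (-ξ)).contDiffAt.differentiableAt (by simp))
      (hf.contDiffAt.differentiableAt (by simp))]
    simp only [add_apply, smul_apply, smul_eq_mul, he]
    simp
    ring
  simp only [h1] at h0
  rw [integral_sub, integral_const_mul, sub_eq_zero] at h0
  · rw [fc_eq_integral, fc_eq_integral, h0]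
  · exact ((contDiff_eChar (-ξ)).continuous.mul (contDiff_pd hf j).continuous).integrable_torus
  · exact (((contDiff_eChar (-ξ)).continuous.mul hf.continuous).integrable_torus).const_mul _

lemma fc_pd_iterate {f : (Fin n → ℝ) → ℂ} (hf : ContDiff ℝ (⊤ : ℕ∞) f) (hp : Per f) (j : Fin n)
    (k : ℕ) (ξ : Fin n → ℤ) :
    fc ((pd j)^[k] f) ξ = (2 * π * Complex.I * ξ j) ^ k * fc f ξ := by
  induction k with
  | zero => simp
  | succ k ih =>
    rw [Function.iterate_succ_apply', fc_pd (contDiff_pd_iterate hf j k) (hp.pd_iterate j k), ih]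
    ring

end Derivatives

section Parseval

variable {n : ℕ}

instance : IsProbabilityMeasure (μT n) :=
  ⟨by simp [μT, cube, volume_pi_pi]⟩

lemma eChar_add (x : Fin n → ℝ) (ξ η : Fin n → ℤ) :
    eChar x (ξ + η) = eChar x ξ * eChar x η := by
  simp only [eChar, ← Complex.exp_add, Pi.add_apply, Int.cast_add, mul_add,
    Finset.sum_add_distrib]

lemma integral_eChar (ξ : Fin n → ℤ) :
    ∫ x, eChar x ξ ∂(μT n) = if ξ = 0 then 1 else 0 := by
  split_ifs with h
  · simp [h, eChar]
  · obtain ⟨j, hj⟩ := Function.ne_iff.1 h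
    have h0 := integral_pd_eq_zero (contDiff_eChar ξ) (per_eChar ξ) j
    simp only [pd_eChar] at h0
    rw [integral_const_mul] at h0
    have : (2 * π * Complex.I * ξ j : ℂ) ≠ 0 := by
      have : (ξ j : ℂ) ≠ 0 := by exact_mod_cast hj
      simp [this, Real.pi_ne_zero]
    exact (mul_eq_zero.1 h0).resolve_left this

lemma continuous_trigPolynomial (s : Finset (Fin n → ℤ)) (d : (Fin n → ℤ) → ℂ) :
    Continuous fun x => ∑ ξ ∈ s, d ξ * eChar x ξ :=
  continuous_finsetSum _ fun ξ _ => continuous_const.mul (contDiff_eChar ξ).continuous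

lemma fc_trigPolynomial (s : Finset (Fin n → ℤ)) (d : (Fin n → ℤ) → ℂ) (η : Fin n → ℤ) :
    fc (fun x => ∑ ξ ∈ s, d ξ * eChar x ξ) η = if η ∈ s then d η else 0 := by
  have h : ∀ x, eChar x (-η) * ∑ ξ ∈ s, d ξ * eChar x ξ = ∑ ξ ∈ s, d ξ * eChar x (ξ - η) := by
    intro x
    rw [Finset.mul_sum]
    refine Finset.sum_congr rfl fun ξ _ => ?_
    rw [sub_eq_add_neg, eChar_add]
    ring
  rw [fc_eq_integral]
  simp only [h]
  rw [integral_finsetSum _ fun ξ _ =>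
    ((contDiff_eChar (ξ - η)).continuous.integrable_torus).const_mul _]
  simp [integral_const_mul, integral_eChar, sub_eq_zero]

/-- Parseval's identity for trigonometric polynomials. -/
lemma integral_norm_sq_trigPolynomial (s : Finset (Fin n → ℤ)) (d : (Fin n → ℤ) → ℂ) :
    ∫ x, ‖∑ ξ ∈ s, d ξ * eChar x ξ‖ ^ 2 ∂(μT n) = ∑ ξ ∈ s, ‖d ξ‖ ^ 2 := by
  have hp : Per fun x => ∑ ξ ∈ s, d ξ * eChar x ξ := fun x v =>
    Finset.sum_congr rfl fun ξ _ => congrArg (d ξ * ·) (per_eChar ξ x v)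
  refine (hasSum_sq_fc (continuous_trigPolynomial s d) hp).unique ?_
  simp only [fc_trigPolynomial]
  have h := hasSum_sum_of_ne_finset_zero (L := SummationFilter.unconditional _) (s := s)
    (f := fun ξ => ‖if ξ ∈ s then d ξ else 0‖ ^ 2)
    (fun ξ hξ => by simp [hξ])
  convert h using 1
  exact Finset.sum_congr rfl fun ξ hξ => by simp [hξ]

lemma Continuous.lintegral_enorm_sq {f : (Fin n → ℝ) → ℂ} (hf : Continuous f) :
    ∫⁻ x, ‖f x‖ₑ ^ 2 ∂(μT n) = ENNReal.ofReal (∫ x, ‖f x‖ ^ 2 ∂(μT n)) := by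
  have hi : Integrable (fun x => ‖f x‖ ^ 2) (μT n) := (hf.norm.pow 2).integrable_torus
  rw [ofReal_integral_eq_lintegral_ofReal hi
    (Filter.Eventually.of_forall fun x => by positivity)]
  refine lintegral_congr fun x => ?_
  rw [ENNReal.ofReal_pow (norm_nonneg _), ofReal_norm]

end Parseval

section Sobolev

variable {n : ℕ}

/-- `∑_{η ∈ ℤⁿ} |η|^{-m}` converges for `m > n`. -/
lemma summable_norm_inv_pow_int {m : ℕ} (hm : n < m) :
    Summable fun η : Fin n → ℤ => ‖η‖⁻¹ ^ m := by
  let L : Submodule ℤ (Fin n → ℝ) := Submodule.span ℤ (Set.range (Pi.basisFun ℝ (Fin n)))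
  have hL : Module.finrank ℤ L = n := by
    rw [ZLattice.rank ℝ L]
    simp
  let φ : (Fin n → ℤ) → L := fun η => ⟨fun j => (η j : ℝ), by
    rw [Module.Basis.mem_span_iff_repr_mem]
    intro j
    exact ⟨η j, by simp⟩⟩
  have hφ : Function.Injective φ := fun η η' h => by
    ext j
    have : (η j : ℝ) = η' j := congrFun (congrArg Subtype.val h) j
    exact_mod_cast this
  have hs := (ZLattice.summable_norm_pow_inv L m (by omega)).comp_injective hφ
  have hn : ∀ η, ‖φ η‖ = ‖η‖ := fun η => by
    change ‖(fun j => (η j : ℝ))‖ = ‖η‖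
    rw [Pi.norm_def, Pi.norm_def]
    congr 2
  simpa only [Function.comp_def, hn] using hs

/-- Weight of the Sobolev norm `(‖g‖² + ∑ⱼ ‖∂ⱼᵏ g‖²)^{1/2}` on the Fourier side. -/
def sobolevWeight (k : ℕ) (η : Fin n → ℤ) : ℝ :=
  1 + ∑ j, ‖(2 * π * Complex.I * η j : ℂ) ^ k‖ ^ 2

lemma one_le_sobolevWeight (k : ℕ) (η : Fin n → ℤ) : 1 ≤ sobolevWeight k η :=
  le_add_of_nonneg_right (Finset.sum_nonneg fun _ _ => by positivity)

lemma norm_pow_le_sobolevWeight (hn : 1 ≤ n) (k : ℕ) (η : Fin n → ℤ) :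
    ‖η‖ ^ (2 * k) ≤ sobolevWeight k η := by
  have : Nonempty (Fin n) := ⟨⟨0, hn⟩⟩
  obtain ⟨j, hj⟩ := Finite.exists_max fun j => ‖η j‖
  have h1 : ‖η‖ ≤ ‖η j‖ := (pi_norm_le_iff_of_nonneg (norm_nonneg _)).2 hj
  have h2 : ‖η j‖ ≤ ‖(2 * π * Complex.I * η j : ℂ)‖ := by
    simp only [norm_mul, Complex.norm_ofNat, Complex.norm_real, Complex.norm_I, mul_one,
      Complex.norm_intCast, Int.norm_eq_abs]
    refine le_mul_of_one_le_left (abs_nonneg _) ?_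
    rw [Real.norm_of_nonneg Real.pi_nonneg]
    linarith [Real.pi_gt_three]
  calc ‖η‖ ^ (2 * k) ≤ ‖(2 * π * Complex.I * η j : ℂ)‖ ^ (2 * k) := by
        gcongr
        exact h1.trans h2
    _ = ‖(2 * π * Complex.I * η j : ℂ) ^ k‖ ^ 2 := by rw [norm_pow, ← pow_mul, mul_comm 2 k]
    _ ≤ ∑ j, ‖(2 * π * Complex.I * η j : ℂ) ^ k‖ ^ 2 :=
        Finset.single_le_sum (f := fun j => ‖(2 * π * Complex.I * η j : ℂ) ^ k‖ ^ 2)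
          (fun _ _ => by positivity) (Finset.mem_univ j)
    _ ≤ sobolevWeight k η := le_add_of_nonneg_left zero_le_one

lemma summable_sobolevWeight_inv (hn : 1 ≤ n) {k : ℕ} (hk : n < 2 * k) :
    Summable fun η : Fin n → ℤ => (sobolevWeight k η)⁻¹ := by
  refine Summable.of_norm_bounded_eventually (summable_norm_inv_pow_int hk) ?_
  refine (Set.finite_singleton (0 : Fin n → ℤ)).subset fun η hη => ?_
  by_contra h0
  refine hη ?_
  have hpos : 0 < ‖η‖ := norm_pos_iff.2 h0
  change ‖(sobolevWeight k η)⁻¹‖ ≤ ‖η‖⁻¹ ^ (2 * k)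
  rw [norm_inv, Real.norm_of_nonneg (zero_le_one.trans (one_le_sobolevWeight k η)), inv_pow]
  exact inv_anti₀ (by positivity) (norm_pow_le_sobolevWeight hn k η)

/-- Sobolev embedding on the torus: for `2k > n` the sup norm is controlled by the `L²` norms of
the function and of its pure derivatives of order `k`. -/
lemma exists_sobolev_bound (hn : 1 ≤ n) {k : ℕ} (hk : n < 2 * k) :
    ∃ S : ℝ, 0 ≤ S ∧ ∀ g : (Fin n → ℝ) → ℂ, ContDiff ℝ (⊤ : ℕ∞) g → Per g → ∀ x,
      ‖g x‖ ^ 2 ≤ S * (∫ y, ‖g y‖ ^ 2 ∂(μT n) + ∑ j, ∫ y, ‖(pd j)^[k] g y‖ ^ 2 ∂(μT n)) := by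
  have hW : ∀ η : Fin n → ℤ, 0 < sobolevWeight k η := fun η =>
    zero_lt_one.trans_le (one_le_sobolevWeight k η)
  have hWs := summable_sobolevWeight_inv hn hk
  refine ⟨∑' η : Fin n → ℤ, (sobolevWeight k η)⁻¹, tsum_nonneg fun η => (inv_pos.2 (hW η)).le,
    fun g hg hp x => ?_⟩
  have hsum : HasSum (fun η => sobolevWeight k η * ‖fc g η‖ ^ 2)
      (∫ y, ‖g y‖ ^ 2 ∂(μT n) + ∑ j, ∫ y, ‖(pd j)^[k] g y‖ ^ 2 ∂(μT n)) := by
    have h := (hasSum_sq_fc hg.continuous hp).add (hasSum_sum (s := Finset.univ) fun j _ =>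
      hasSum_sq_fc (contDiff_pd_iterate hg j k).continuous (hp.pd_iterate j k))
    convert h using 2 with η
    simp only [fc_pd_iterate hg hp, norm_mul, mul_pow, sobolevWeight, add_mul, one_mul,
      Finset.sum_mul]
  have hA : ∀ η : Fin n → ℤ, √(sobolevWeight k η)⁻¹ ^ (2 : ℝ) = (sobolevWeight k η)⁻¹ :=
    fun η => by rw [Real.rpow_two, Real.sq_sqrt (inv_pos.2 (hW η)).le]
  have hB : ∀ η, (√(sobolevWeight k η) * ‖fc g η‖) ^ (2 : ℝ) =
      sobolevWeight k η * ‖fc g η‖ ^ 2 :=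
    fun η => by rw [Real.rpow_two, mul_pow, Real.sq_sqrt (hW η).le]
  have hAB : ∀ η, √(sobolevWeight k η)⁻¹ * (√(sobolevWeight k η) * ‖fc g η‖) = ‖fc g η‖ :=
    fun η => by
      rw [← mul_assoc, ← Real.sqrt_mul (inv_pos.2 (hW η)).le, inv_mul_cancel₀ (hW η).ne',
        Real.sqrt_one, one_mul]
  obtain ⟨hs, hle⟩ := Real.summable_and_inner_le_Lp_mul_Lq_tsum_of_nonneg
    Real.HolderConjugate.two_two
    (fun η : Fin n → ℤ => Real.sqrt_nonneg (sobolevWeight k η)⁻¹)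
    (fun η => mul_nonneg (Real.sqrt_nonneg (sobolevWeight k η)) (norm_nonneg (fc g η)))
    (by simpa only [hA] using hWs) (by simpa only [hB] using hsum.summable)
  simp only [hAB, hA, hB, hsum.tsum_eq] at hs hle
  have hx := hasSum_fc_mul_eChar hg.continuous hp hs.of_norm x
  have hnorm : ∀ η, ‖fc g η * eChar x η‖ = ‖fc g η‖ := fun η => by
    rw [norm_mul, eChar, show (2 * (π : ℂ) * Complex.I * ∑ j, (x j : ℂ) * (η j : ℂ)) =
      ((2 * π * ∑ j, x j * η j : ℝ) : ℂ) * Complex.I by push_cast; ring,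
      Complex.norm_exp_ofReal_mul_I, mul_one]
  have hgx : ‖g x‖ ≤ ∑' η, ‖fc g η‖ := by
    rw [← hx.tsum_eq]
    refine (norm_tsum_le_tsum_norm (by simpa only [hnorm] using hs)).trans_eq ?_
    simp only [hnorm]
  have hI : 0 ≤ ∫ y, ‖g y‖ ^ 2 ∂(μT n) + ∑ j, ∫ y, ‖(pd j)^[k] g y‖ ^ 2 ∂(μT n) := by
    rw [← hsum.tsum_eq]
    exact tsum_nonneg fun η => mul_nonneg (hW η).le (by positivity)
  calc ‖g x‖ ^ 2 ≤ _ := pow_le_pow_left₀ (norm_nonneg _) (hgx.trans hle) 2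
    _ = _ := by
      rw [mul_pow, ← Real.sqrt_eq_rpow, ← Real.sqrt_eq_rpow, Real.sq_sqrt hI,
        Real.sq_sqrt (tsum_nonneg fun η => (inv_pos.2 (hW η)).le)]

end Sobolev

section Boundedness

variable {n : ℕ}

lemma continuous_eChar_mul_sum {b : (Fin n → ℝ) → (Fin n → ℤ) → ℂ}
    (hb : ∀ ξ, Continuous fun y => b y ξ) (s : Finset (Fin n → ℤ)) (c : (Fin n → ℤ) → ℂ) :
    Continuous fun p : (Fin n → ℝ) × (Fin n → ℝ) =>
      ∑ ξ ∈ s, c ξ * eChar p.1 ξ * b p.2 ξ :=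
  continuous_finsetSum _ fun ξ _ =>
    (continuous_const.mul ((contDiff_eChar ξ).continuous.comp continuous_fst)).mul
      ((hb ξ).comp continuous_snd)

/-- `L²` bound on `𝕋ⁿ × 𝕋ⁿ` for an operator whose symbol is evaluated at an independent point. -/
lemma lintegral_lintegral_enorm_sq_le {b : (Fin n → ℝ) → (Fin n → ℤ) → ℂ} {B : ℝ}
    (hb : ∀ ξ, Continuous fun y => b y ξ) (hB : ∀ y ξ, ‖b y ξ‖ ≤ B)
    (s : Finset (Fin n → ℤ)) (c : (Fin n → ℤ) → ℂ) :
    ∫⁻ x, ∫⁻ y, ‖∑ ξ ∈ s, c ξ * eChar x ξ * b y ξ‖ₑ ^ 2 ∂(μT n) ∂(μT n) ≤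
      ENNReal.ofReal (B ^ 2 * ∑ ξ ∈ s, ‖c ξ‖ ^ 2) := by
  rw [lintegral_lintegral_swap]
  · refine (lintegral_mono (g := fun _ => ENNReal.ofReal (B ^ 2 * ∑ ξ ∈ s, ‖c ξ‖ ^ 2))
      fun y => ?_).trans_eq (by simp)
    have h : ∀ x, ∑ ξ ∈ s, c ξ * eChar x ξ * b y ξ = ∑ ξ ∈ s, (c ξ * b y ξ) * eChar x ξ :=
      fun x => Finset.sum_congr rfl fun ξ _ => by ring
    simp only [h]
    rw [(continuous_trigPolynomial s fun ξ => c ξ * b y ξ).lintegral_enorm_sq,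
      integral_norm_sq_trigPolynomial, Finset.mul_sum]
    refine ENNReal.ofReal_le_ofReal (Finset.sum_le_sum fun ξ _ => ?_)
    rw [norm_mul, mul_pow, mul_comm]
    gcongr
    exact hB y ξ
  · exact ((continuous_eChar_mul_sum hb s c).enorm.measurable.pow_const 2).aemeasurable

/-- Uniform `L²` bound for the operator truncated to finitely many frequencies. -/
lemma exists_lintegral_enorm_sq_le (hn : 1 ≤ n) {a : (Fin n → ℝ) → (Fin n → ℤ) → ℂ}
    (ha_smooth : ∀ ξ, ContDiff ℝ (⊤ : ℕ∞) fun x => a x ξ) (ha_per : ∀ ξ, Per fun x => a x ξ)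
    {k : ℕ} (hk : n < 2 * k) {B : ℝ} (hB0 : ∀ x ξ, ‖a x ξ‖ ≤ B)
    (hB : ∀ j x ξ, ‖(pd j)^[k] (fun x => a x ξ) x‖ ≤ B) :
    ∃ C : ℝ, 0 ≤ C ∧ ∀ (s : Finset (Fin n → ℤ)) (c : (Fin n → ℤ) → ℂ),
      ∫⁻ x, ‖∑ ξ ∈ s, eChar x ξ * a x ξ * c ξ‖ₑ ^ 2 ∂(μT n) ≤
        ENNReal.ofReal (C * ∑ ξ ∈ s, ‖c ξ‖ ^ 2) := by
  obtain ⟨S, hS, hsob⟩ := exists_sobolev_bound hn hk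
  refine ⟨S * (B ^ 2 + n * B ^ 2), by positivity, fun s c => ?_⟩
  have ha_cont : ∀ ξ, Continuous fun y => a y ξ := fun ξ => (ha_smooth ξ).continuous
  have hd_cont : ∀ j ξ, Continuous fun y => (pd j)^[k] (fun y => a y ξ) y := fun j ξ =>
    (contDiff_pd_iterate (ha_smooth ξ) j k).continuous
  have key : ∀ x, ‖∑ ξ ∈ s, eChar x ξ * a x ξ * c ξ‖ₑ ^ 2 ≤ ENNReal.ofReal S *
      (∫⁻ y, ‖∑ ξ ∈ s, c ξ * eChar x ξ * a y ξ‖ₑ ^ 2 ∂(μT n) +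
        ∑ j, ∫⁻ y, ‖∑ ξ ∈ s, c ξ * eChar x ξ * (pd j)^[k] (fun y => a y ξ) y‖ₑ ^ 2 ∂(μT n)) := by
    intro x
    have hsm : ContDiff ℝ (⊤ : ℕ∞) fun y => ∑ ξ ∈ s, c ξ * eChar x ξ * a y ξ :=
      ContDiff.sum fun ξ _ => contDiff_const.mul (ha_smooth ξ)
    have hper : Per fun y => ∑ ξ ∈ s, c ξ * eChar x ξ * a y ξ := fun y v =>
      Finset.sum_congr rfl fun ξ _ => congrArg (c ξ * eChar x ξ * ·) (ha_per ξ y v)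
    have h := hsob _ hsm hper x
    simp only [pd_iterate_sum s (fun ξ => c ξ * eChar x ξ) ha_smooth] at h
    rw [hsm.continuous.lintegral_enorm_sq]
    have hj : ∀ j, ∫⁻ y, ‖∑ ξ ∈ s, c ξ * eChar x ξ * (pd j)^[k] (fun y => a y ξ) y‖ₑ ^ 2 ∂(μT n)
        = ENNReal.ofReal
          (∫ y, ‖∑ ξ ∈ s, c ξ * eChar x ξ * (pd j)^[k] (fun y => a y ξ) y‖ ^ 2 ∂(μT n)) :=
      fun j => Continuous.lintegral_enorm_sq
        (continuous_finsetSum _ fun ξ _ => continuous_const.mul (hd_cont j ξ))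
    simp only [hj]
    rw [← ENNReal.ofReal_sum_of_nonneg fun j _ => integral_nonneg fun y => by positivity,
      ← ENNReal.ofReal_add (integral_nonneg fun y => by positivity)
        (Finset.sum_nonneg fun j _ => integral_nonneg fun y => by positivity),
      ← ENNReal.ofReal_mul hS, ← ofReal_norm, ← ENNReal.ofReal_pow (norm_nonneg _)]
    refine ENNReal.ofReal_le_ofReal (le_trans (le_of_eq ?_) h)
    congr 2
    exact Finset.sum_congr rfl fun ξ _ => by ring
  have hmeas : ∀ {b : (Fin n → ℝ) → (Fin n → ℤ) → ℂ}, (∀ ξ, Continuous fun y => b y ξ) →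
      Measurable fun x => ∫⁻ y, ‖∑ ξ ∈ s, c ξ * eChar x ξ * b y ξ‖ₑ ^ 2 ∂(μT n) := fun hb =>
    ((continuous_eChar_mul_sum hb s c).enorm.measurable.pow_const 2).lintegral_prod_right'
  calc ∫⁻ x, ‖∑ ξ ∈ s, eChar x ξ * a x ξ * c ξ‖ₑ ^ 2 ∂(μT n)
      ≤ _ := lintegral_mono key
    _ = ENNReal.ofReal S *
      (∫⁻ x, ∫⁻ y, ‖∑ ξ ∈ s, c ξ * eChar x ξ * a y ξ‖ₑ ^ 2 ∂(μT n) ∂(μT n) +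
        ∑ j, ∫⁻ x, ∫⁻ y, ‖∑ ξ ∈ s, c ξ * eChar x ξ * (pd j)^[k] (fun y => a y ξ) y‖ₑ ^ 2
          ∂(μT n) ∂(μT n)) := by
      rw [lintegral_const_mul' _ _ ENNReal.ofReal_ne_top, lintegral_add_left (hmeas ha_cont),
        lintegral_finsetSum _ fun j _ => hmeas (hd_cont j)]
    _ ≤ ENNReal.ofReal S * (ENNReal.ofReal (B ^ 2 * ∑ ξ ∈ s, ‖c ξ‖ ^ 2) +
        ∑ _j : Fin n, ENNReal.ofReal (B ^ 2 * ∑ ξ ∈ s, ‖c ξ‖ ^ 2)) := by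
      gcongr with j
      · exact lintegral_lintegral_enorm_sq_le ha_cont hB0 s c
      · exact lintegral_lintegral_enorm_sq_le (hd_cont j) (hB j) s c
    _ = _ := by
      rw [← ENNReal.ofReal_sum_of_nonneg fun j _ => by positivity,
        ← ENNReal.ofReal_add (by positivity) (by positivity), ← ENNReal.ofReal_mul hS]
      congr 1
      simp
      ring

/-- An `L²` bound on all finite truncations passes to the full operator. -/
lemma lintegral_enorm_sq_Op_le {a : (Fin n → ℝ) → (Fin n → ℤ) → ℂ}
    (ha : ∀ ξ, Continuous fun x => a x ξ) {f : (Fin n → ℝ) → ℂ} {M : ℝ≥0∞}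
    (hM : ∀ s : Finset (Fin n → ℤ),
      ∫⁻ x, ‖∑ ξ ∈ s, eChar x ξ * a x ξ * fc f ξ‖ₑ ^ 2 ∂(μT n) ≤ M) :
    ∫⁻ x, ‖Op a f x‖ₑ ^ 2 ∂(μT n) ≤ M := by
  have hpt : ∀ x, ‖Op a f x‖ₑ ^ 2 ≤ Filter.liminf (fun s : Finset (Fin n → ℤ) =>
      ‖∑ ξ ∈ s, eChar x ξ * a x ξ * fc f ξ‖ₑ ^ 2) Filter.atTop := by
    intro x
    by_cases hs : Summable fun ξ => eChar x ξ * a x ξ * fc f ξ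
    · exact ((((ENNReal.continuous_pow 2).comp continuous_enorm).tendsto _).comp
        hs.hasSum).liminf_eq.ge
    · simp [Op, tsum_eq_zero_of_not_summable hs]
  calc ∫⁻ x, ‖Op a f x‖ₑ ^ 2 ∂(μT n) ≤ _ := lintegral_mono hpt
    _ ≤ _ := lintegral_liminf_le fun s => by
      refine (Continuous.enorm ?_).measurable.pow_const 2
      exact continuous_finsetSum _ fun ξ _ =>
        ((contDiff_eChar ξ).continuous.mul (ha ξ)).mul continuous_const
    _ ≤ M := Filter.liminf_le_of_frequently_le' (Filter.Frequently.of_forall hM)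

lemma integral_norm_sq_le_of_lintegral {α : Type*} [MeasurableSpace α] {μ : Measure α}
    {g : α → ℂ} {M : ℝ} (hM : 0 ≤ M) (h : ∫⁻ x, ‖g x‖ₑ ^ 2 ∂μ ≤ ENNReal.ofReal M) :
    ∫ x, ‖g x‖ ^ 2 ∂μ ≤ M := by
  by_cases hg : Integrable (fun x => ‖g x‖ ^ 2) μ
  · rw [← ENNReal.ofReal_le_ofReal_iff hM, ofReal_integral_eq_lintegral_ofReal hg
      (Filter.Eventually.of_forall fun x => by positivity)]
    refine le_trans (le_of_eq (lintegral_congr fun x => ?_)) h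
    rw [ENNReal.ofReal_pow (norm_nonneg _), ofReal_norm]
  · rwa [integral_undef hg]

end Boundedness

/-- **Ruzhansky–Turunen.** If a symbol `a : 𝕋ⁿ × ℤⁿ → ℂ` satisfies
`|∂_x^β a(x,ξ)| ≤ C_β` for `|β| ≤ [n/2]+1`, then `a(x,D) : L²(𝕋ⁿ) → L²(𝕋ⁿ)` is bounded. -/
theorem periodic_pseudodiff_L2_bounded
    (n : ℕ) (hn : 1 ≤ n)
    (a : (Fin n → ℝ) → (Fin n → ℤ) → ℂ)
    (ha_smooth : ∀ ξ, ContDiff ℝ (⊤ : ℕ∞) fun x => a x ξ)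
    (ha_per : ∀ ξ, Per fun x => a x ξ)
    (ha : ∀ β : Fin n → ℕ, (∑ j, β j) ≤ n / 2 + 1 → ∃ C : ℝ, 0 < C ∧
      ∀ (x : Fin n → ℝ) (ξ : Fin n → ℤ), ‖pdM β (fun x' => a x' ξ) x‖ ≤ C) :
    ∃ C : ℝ, 0 < C ∧ ∀ f : (Fin n → ℝ) → ℂ, ContDiff ℝ (⊤ : ℕ∞) f → Per f →
      lpT n 2 (Op a f) ≤ C * lpT n 2 f := by
  obtain ⟨C₀, -, hC₀⟩ := ha 0 (by simp)
  have hj : ∀ j : Fin n, ∃ C : ℝ, 0 < C ∧ ∀ x ξ,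
      ‖(pd j)^[n / 2 + 1] (fun x => a x ξ) x‖ ≤ C := fun j => by
    simpa only [pdM_single] using ha (Pi.single j (n / 2 + 1)) (by simp)
  choose C₁ hC₁ hC₁' using hj
  have h0 : ∀ x ξ, ‖a x ξ‖ ≤ C₀ := fun x ξ => by
    have := hC₀ x ξ
    rwa [← Pi.single_zero (⟨0, hn⟩ : Fin n), pdM_single] at this
  have hsum : 0 ≤ ∑ j, C₁ j := Finset.sum_nonneg fun j _ => (hC₁ j).le
  obtain ⟨C, hC, hbound⟩ := exists_lintegral_enorm_sq_le hn ha_smooth ha_per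
    (k := n / 2 + 1) (by omega) (B := max C₀ (∑ j, C₁ j))
    (fun x ξ => (h0 x ξ).trans (le_max_left _ _))
    (fun j x ξ => (hC₁' j x ξ).trans ((Finset.single_le_sum (fun j _ => (hC₁ j).le)
      (Finset.mem_univ j)).trans (le_max_right _ _)))
  refine ⟨√C + 1, by positivity, fun f hf hp => ?_⟩
  have hI : 0 ≤ ∫ x, ‖f x‖ ^ 2 ∂(μT n) := integral_nonneg fun x => by positivity
  have hparseval := hasSum_sq_fc hf.continuous hp
  have hOp : ∫ x, ‖Op a f x‖ ^ 2 ∂(μT n) ≤ C * ∫ x, ‖f x‖ ^ 2 ∂(μT n) := by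
    refine integral_norm_sq_le_of_lintegral (mul_nonneg hC hI)
      (lintegral_enorm_sq_Op_le (fun ξ => (ha_smooth ξ).continuous) fun s =>
        (hbound s (fc f)).trans (ENNReal.ofReal_le_ofReal ?_))
    gcongr
    exact sum_le_hasSum s (fun ξ _ => by positivity) hparseval
  simp only [lpT, Real.rpow_two, ← Real.sqrt_eq_rpow]
  calc √(∫ x, ‖Op a f x‖ ^ 2 ∂(μT n)) ≤ √(C * ∫ x, ‖f x‖ ^ 2 ∂(μT n)) := Real.sqrt_le_sqrt hOp
    _ = √C * √(∫ x, ‖f x‖ ^ 2 ∂(μT n)) := Real.sqrt_mul hC _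
    _ ≤ (√C + 1) * √(∫ x, ‖f x‖ ^ 2 ∂(μT n)) := by
      gcongr
      linarith
end
end
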